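/- Let m ≥ 2 and n ≥ 1. The set of totally irrational matrices ξ ∈ ℝ^{n×m} that satisfy Property (B) but neither Property (A) nor Property (C) is nonempty and has full Hausdorff dimension mn in ℝ^{n×m} ≅ ℝ^{mn}. -/

import Mathlib

open Filter

/-- The sup-norm of the `i`-th integer vector `x i`, viewed in `ℝ^m`. -/
noncomputable def Xval {m : ℕ} (x : ℕ → Fin m → ℤ) (i : ℕ) : ℝ :=
  ‖(fun j => (x i j : ℝ))‖

/-- The sup-norm of the remainder `ξ 𝒙ᵢ − 𝒚ᵢ`. -/
noncomputable def Lval {m n : ℕ} (ξ : Matrix (Fin n) (Fin m) ℝ)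
    (x : ℕ → Fin m → ℤ) (y : ℕ → Fin n → ℤ) (i : ℕ) : ℝ :=
  ‖(ξ.mulVec (fun j => (x i j : ℝ)) - (fun k => (y i k : ℝ)))‖

/-- `ξ` is totally irrational: `‖ξ𝒙 − 𝒚‖ > 0` for every nonzero integer pair `(𝒙,𝒚)`. -/
def TotallyIrrational {m n : ℕ} (ξ : Matrix (Fin n) (Fin m) ℝ) : Prop :=
  ∀ (u : Fin m → ℤ) (v : Fin n → ℤ), (u, v) ≠ 0 →
    0 < ‖(ξ.mulVec (fun j => (u j : ℝ)) - (fun k => (v k : ℝ)))‖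

/-- `(𝒙ᵢ, 𝒚ᵢ)_{i}` is a sequence of best approximation vectors for `ξ`
(with respect to the sup norms). -/
structure IsBestApproxSeq {m n : ℕ} (ξ : Matrix (Fin n) (Fin m) ℝ)
    (x : ℕ → Fin m → ℤ) (y : ℕ → Fin n → ℤ) : Prop where
  nonzero : ∀ i, x i ≠ 0
  first : Xval x 0 = 1
  xStrictMono : StrictMono (Xval x)
  lStrictAnti : StrictAnti (Lval ξ x y)
  best : ∀ (i : ℕ) (u : Fin m → ℤ) (v : Fin n → ℤ), u ≠ 0 →
    ‖(fun j => (u j : ℝ))‖ < Xval x (i + 1) →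
    Lval ξ x y i ≤ ‖(ξ.mulVec (fun j => (u j : ℝ)) - (fun k => (v k : ℝ)))‖

/-- Property (A): `ξ` is badly approximable. -/
def PropA {m n : ℕ} (ξ : Matrix (Fin n) (Fin m) ℝ) : Prop :=
  ∃ c : ℝ, 0 < c ∧ ∀ (u : Fin m → ℤ) (v : Fin n → ℤ), u ≠ 0 →
    c ≤ ‖(fun j => (u j : ℝ))‖ ^ m *
        ‖(ξ.mulVec (fun j => (u j : ℝ)) - (fun k => (v k : ℝ)))‖ ^ n

/-- Property (B): the ratios `X_{i+1}/X_i` are bounded. -/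
def PropB {m : ℕ} (x : ℕ → Fin m → ℤ) : Prop :=
  ∃ M : ℝ, ∀ i : ℕ, Xval x (i + 1) / Xval x i ≤ M

/-- Property (C): the ratios `L_i/L_{i+1}` are bounded. -/
def PropC {m n : ℕ} (ξ : Matrix (Fin n) (Fin m) ℝ)
    (x : ℕ → Fin m → ℤ) (y : ℕ → Fin n → ℤ) : Prop :=
  ∃ M : ℝ, ∀ i : ℕ, Lval ξ x y i / Lval ξ x y (i + 1) ≤ M

/-- The ordinary exponent `ω(ξ) = limsup (−log Lᵢ)/(log Xᵢ)`, as a value in `[0,+∞]`. -/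
noncomputable def ordExp {m n : ℕ} (ξ : Matrix (Fin n) (Fin m) ℝ)
    (x : ℕ → Fin m → ℤ) (y : ℕ → Fin n → ℤ) : EReal :=
  limsup (fun i => ((-Real.log (Lval ξ x y i) / Real.log (Xval x i) : ℝ) : EReal)) atTop

/-- The uniform exponent `ω̂(ξ) = liminf (−log Lᵢ)/(log X_{i+1})`, as a value in `[0,+∞]`. -/
noncomputable def unifExp {m n : ℕ} (ξ : Matrix (Fin n) (Fin m) ℝ)
    (x : ℕ → Fin m → ℤ) (y : ℕ → Fin n → ℤ) : EReal :=
  liminf (fun i => ((-Real.log (Lval ξ x y i) / Real.log (Xval x (i + 1)) : ℝ) : EReal)) atTop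

section Lattice

open MeasureTheory
open scoped Pointwise

/-- An integer vector, viewed as a real vector. -/
abbrev toR {ι : Type*} (v : ι → ℤ) : ι → ℝ := fun i => (v i : ℝ)

theorem toR_ne_zero {ι : Type*} {v : ι → ℤ} (hv : v ≠ 0) : toR v ≠ 0 := by
  intro h
  apply hv
  ext i
  have := congrFun h i
  simpa [toR] using this

theorem one_le_norm_toR {ι : Type*} [Fintype ι] {v : ι → ℤ} (hv : v ≠ 0) : 1 ≤ ‖toR v‖ := by
  obtain ⟨i, hi⟩ := Function.ne_iff.1 hv
  refine le_trans ?_ (norm_le_pi_norm (toR v) i)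
  have : (1 : ℤ) ≤ |v i| := Int.one_le_abs hi
  rw [Real.norm_eq_abs]
  exact_mod_cast this

theorem eq_zero_of_norm_toR_lt {ι : Type*} [Fintype ι] {v : ι → ℤ} (h : ‖toR v‖ < 1) : v = 0 := by
  by_contra hv
  exact absurd (one_le_norm_toR hv) (not_le.2 h)

theorem minkowski_box {ι : Type*} [Fintype ι] [DecidableEq ι] (g : Matrix ι ι ℝ)
    (hg : |g.det| = 1) (b : ι → ℝ) (hb : ∀ i, 0 < b i) (hb1 : 1 < ∏ i, b i) :
    ∃ v : ι → ℤ, v ≠ 0 ∧ ∀ i, |g.mulVec (toR v) i| ≤ b i := by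
  classical
  set B := Pi.basisFun ℝ ι with hB
  set s : Set (ι → ℝ) := (Matrix.toLin' g) ⁻¹' (Set.Icc (-b) b) with hs
  have hvol : volume s = ENNReal.ofReal (∏ i, (2 * b i)) := by
    rw [hs, Measure.addHaar_preimage_linearMap]
    · rw [LinearMap.det_toLin', abs_inv, hg, Real.volume_Icc_pi]
      simp only [inv_one, ENNReal.ofReal_one, one_mul]
      rw [ENNReal.ofReal_prod_of_nonneg]
      · refine Finset.prod_congr rfl fun i _ => ?_
        congr 1
        simp
        ring
      · intro i _
        have := hb i
        positivity
    · rw [LinearMap.det_toLin']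
      intro h
      simp [h] at hg
  have hF := ZSpan.isAddFundamentalDomain' B (volume : Measure (ι → ℝ))
  have hFvol : volume (ZSpan.fundamentalDomain B) = 1 := by
    rw [hB, ZSpan.fundamentalDomain_pi_basisFun, Real.volume_pi_Ico]
    simp
  have hcount : Countable (Submodule.span ℤ (Set.range B)).toAddSubgroup :=
    inferInstanceAs (Countable (Submodule.span ℤ (Set.range B)))
  have key := exists_ne_zero_mem_lattice_of_measure_mul_two_pow_lt_measure
    (L := (Submodule.span ℤ (Set.range B)).toAddSubgroup) (μ := volume)
    (F := ZSpan.fundamentalDomain B) (s := s) hF ?_ ?_ ?_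
  · obtain ⟨x, hx0, hxs⟩ := key
    have hx := x.2
    have h2 : ∀ i, ∃ c : ℤ, (c : ℝ) = (x : ι → ℝ) i := by
      intro i
      have := (B.mem_span_iff_repr_mem ℤ (x : ι → ℝ)).1 hx i
      obtain ⟨c, hc⟩ := this
      exact ⟨c, by simpa [hB] using hc⟩
    choose v hv using h2
    have hvx : toR v = x := by
      ext i
      exact hv i
    refine ⟨v, ?_, ?_⟩
    · rintro rfl
      apply hx0
      ext i
      rw [← hvx]
      simp
    · intro i
      have : Matrix.toLin' g x ∈ Set.Icc (-b) b := hxs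
      rw [← hvx, Matrix.toLin'_apply] at this
      exact abs_le.2 ⟨this.1 i, this.2 i⟩
  · intro x hx
    have : Matrix.toLin' g x ∈ Set.Icc (-b) b := hx
    change Matrix.toLin' g (-x) ∈ Set.Icc (-b) b
    rw [map_neg]
    exact ⟨neg_le_neg this.2, by simpa using neg_le_neg this.1⟩
  · exact (convex_Icc _ _).linear_preimage _
  · rw [hFvol, hvol, one_mul, Module.finrank_fintype_fun_eq_card, Finset.prod_mul_distrib]
    rw [Finset.prod_const, Finset.card_univ]
    rw [show (2 : ENNReal) ^ Fintype.card ι = ENNReal.ofReal (2 ^ Fintype.card ι) by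
      rw [ENNReal.ofReal_pow (by norm_num)]; simp]
    rw [ENNReal.ofReal_lt_ofReal_iff]
    · have : (0:ℝ) < 2 ^ Fintype.card ι := by positivity
      nlinarith
    · have : (0:ℝ) < 2 ^ Fintype.card ι := by positivity
      nlinarith

theorem exists_lattice_near {ι : Type*} [Fintype ι] [DecidableEq ι] {δ : ℝ} (hδ : 0 < δ) :
    ∃ C : ℝ, 0 < C ∧ ∀ g : Matrix ι ι ℝ, |g.det| = 1 →
      (∀ v : ι → ℤ, v ≠ 0 → δ ≤ ‖g.mulVec (toR v)‖) →
      ∀ z : ι → ℝ, ∃ v : ι → ℤ, ‖g.mulVec (toR v) - z‖ ≤ C := by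
  classical
  set h : ℝ := 2 * (2 / δ) ^ Fintype.card ι with hh
  have hh0 : 0 < h := by positivity
  set K : ℕ := ⌊h⌋₊ with hK
  refine ⟨(K.factorial : ℝ) * (δ / 2), by positivity, ?_⟩
  intro g hg hmin z
  have hfac : (0 : ℝ) < K.factorial := by exact_mod_cast K.factorial_pos
  set z' : ι → ℝ := (K.factorial : ℝ)⁻¹ • z with hz'
  set G : Matrix (ι ⊕ Unit) (ι ⊕ Unit) ℝ :=
    Matrix.fromBlocks g (Matrix.of fun i _ => z' i) 0 1 with hG
  have hdet : |G.det| = 1 := by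
    rw [hG, Matrix.det_fromBlocks_zero₂₁, Matrix.det_one, mul_one]
    exact hg
  obtain ⟨v, hv0, hv⟩ := minkowski_box G hdet (Sum.elim (fun _ => δ / 2) (fun _ => h))
    (by rintro (i | i) <;> simp <;> positivity) (by
      simp only [Fintype.prod_sum_type, Sum.elim_inl, Sum.elim_inr, Finset.prod_const,
        Finset.card_univ, Fintype.card_unit, pow_one]
      rw [hh, div_pow, div_pow]
      have h1 : (0:ℝ) < 2 ^ Fintype.card ι := by positivity
      have h2 : (0:ℝ) < δ ^ Fintype.card ι := by positivity
      field_simp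
      norm_num)
  have hsplit : ∀ i, G.mulVec (toR v) (Sum.inl i)
      = g.mulVec (toR (v ∘ Sum.inl)) i + v (Sum.inr ()) * z' i := by
    intro i
    simp [hG, Matrix.mulVec, dotProduct, Fintype.sum_sum_type, Matrix.fromBlocks, toR, mul_comm]
  have hsplit2 : G.mulVec (toR v) (Sum.inr ()) = v (Sum.inr ()) := by
    simp [hG, Matrix.mulVec, dotProduct, Fintype.sum_sum_type, Matrix.fromBlocks]
  set k : ℤ := v (Sum.inr ()) with hk
  have hknear : ∀ i, |g.mulVec (toR (v ∘ Sum.inl)) i + k * z' i| ≤ δ / 2 := by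
    intro i
    rw [← hsplit]
    exact hv (Sum.inl i)
  have hkle : |(k : ℝ)| ≤ h := by
    rw [← hsplit2]
    exact hv (Sum.inr ())
  have hk0 : k ≠ 0 := by
    intro hk0
    have hv' : v ∘ Sum.inl ≠ 0 := by
      intro h0
      apply hv0
      ext i
      rcases i with i | i
      · exact congrFun h0 i
      · exact hk0
    have h1 := hmin _ hv'
    have h2 : ‖g.mulVec (toR (v ∘ Sum.inl))‖ ≤ δ / 2 := by
      refine (pi_norm_le_iff_of_nonneg (by positivity)).2 fun i => ?_
      have := hknear i
      rw [hk0] at this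
      simpa using this
    linarith
  have hdvd : k ∣ (K.factorial : ℤ) := by
    rw [← Int.natAbs_dvd]
    have h1 : k.natAbs ≤ K := by
      rw [hK]
      apply Nat.le_floor
      rw [Nat.cast_natAbs]
      exact_mod_cast hkle
    exact_mod_cast Nat.dvd_factorial (Int.natAbs_pos.2 hk0) h1
  obtain ⟨j, hj⟩ := hdvd
  refine ⟨-(j • (v ∘ Sum.inl)), ?_⟩
  have hjR : (K.factorial : ℝ) = k * j := by exact_mod_cast hj
  have hjle : |(j : ℝ)| ≤ K.factorial := by
    have h1 : |(K.factorial : ℝ)| = |(k : ℝ)| * |(j : ℝ)| := by rw [hjR, abs_mul]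
    rw [abs_of_pos hfac] at h1
    have h2 : (1 : ℝ) ≤ |(k : ℝ)| := by exact_mod_cast Int.one_le_abs hk0
    nlinarith [abs_nonneg (j : ℝ)]
  have hvec : g.mulVec (toR (-(j • (v ∘ Sum.inl)))) = -((j : ℝ) • g.mulVec (toR (v ∘ Sum.inl))) := by
    rw [← Matrix.mulVec_smul, ← Matrix.mulVec_neg]
    congr 1
    ext i
    simp [toR]
  rw [hvec]
  refine (pi_norm_le_iff_of_nonneg (by positivity)).2 fun i => ?_
  have hzi : z i = k * j * z' i := by
    rw [hz', ← hjR]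
    simp only [Pi.smul_apply, smul_eq_mul]
    field_simp
  have h3 : (-((j : ℝ) • g.mulVec (toR (v ∘ Sum.inl))) - z) i
      = -(j * (g.mulVec (toR (v ∘ Sum.inl)) i + k * z' i)) := by
    simp only [Pi.sub_apply, Pi.neg_apply, Pi.smul_apply, smul_eq_mul, hzi]
    ring
  rw [h3, norm_neg, Real.norm_eq_abs, abs_mul]
  exact mul_le_mul hjle (hknear i) (abs_nonneg _) hfac.le

theorem card_lattice_le {ι : Type*} [Fintype ι] [DecidableEq ι] {δ : ℝ} (hδ : 0 < δ) :
    ∃ C : ℝ, 0 < C ∧ ∀ g : Matrix ι ι ℝ, |g.det| = 1 →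
      (∀ v : ι → ℤ, v ≠ 0 → δ ≤ ‖g.mulVec (toR v)‖) →
      ∀ R : ℝ, C ≤ R → ∀ F : Finset (ι → ℤ), (∀ v ∈ F, ‖g.mulVec (toR v)‖ ≤ R) →
        (F.card : ℝ) ≤ (4 * R) ^ Fintype.card ι := by
  classical
  obtain ⟨C, hC0, hC⟩ := exists_lattice_near (ι := ι) hδ
  refine ⟨C, hC0, ?_⟩
  intro g hg hmin R hR F hF
  set B := Pi.basisFun ℝ ι with hB
  set Λ := (Submodule.span ℤ (Set.range B)).toAddSubgroup with hΛ
  have hcount : Countable Λ := inferInstanceAs (Countable (Submodule.span ℤ (Set.range B)))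
  have hQ : IsAddFundamentalDomain Λ (ZSpan.fundamentalDomain B) volume :=
    ZSpan.isAddFundamentalDomain' B (volume : Measure (ι → ℝ))
  have hQvol : volume (ZSpan.fundamentalDomain B) = 1 := by
    rw [hB, ZSpan.fundamentalDomain_pi_basisFun, Real.volume_pi_Ico]
    simp
  have hmem : ∀ v : ι → ℤ, toR v ∈ Λ := by
    intro v
    refine (B.mem_span_iff_repr_mem ℤ (toR v)).2 fun i => ⟨v i, by simp [hB]⟩
  set e : (ι → ℤ) → Λ := fun v => ⟨toR v, hmem v⟩ with he
  have hinj : Function.Injective e := by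
    intro u v huv
    ext i
    have h1 : toR u = toR v := congrArg Subtype.val huv
    have := congrFun h1 i
    exact_mod_cast this
  set b : ι → ℝ := fun _ => R + C with hb
  set U : Set (ι → ℝ) := (Matrix.toLin' g) ⁻¹' (Set.Icc (-b) b) with hU
  have hUvol : volume U = ENNReal.ofReal ((2 * (R + C)) ^ Fintype.card ι) := by
    rw [hU, Measure.addHaar_preimage_linearMap]
    · rw [LinearMap.det_toLin', abs_inv, hg, Real.volume_Icc_pi]
      simp only [inv_one, ENNReal.ofReal_one, one_mul, hb, Pi.neg_apply]
      rw [Finset.prod_const, Finset.card_univ, ENNReal.ofReal_pow (by linarith)]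
      congr 2
      ring
    · rw [LinearMap.det_toLin']
      intro h
      simp [h] at hg
  have hUmeas : MeasurableSet U :=
    (LinearMap.continuous_of_finiteDimensional (Matrix.toLin' g)).measurable measurableSet_Icc
  have hUmem : ∀ u, ‖g.mulVec u‖ ≤ R + C → u ∈ U := by
    intro u hu
    have h1 := (pi_norm_le_iff_of_nonneg (by linarith)).1 hu
    exact ⟨fun i => (abs_le.1 (h1 i)).1, fun i => (abs_le.1 (h1 i)).2⟩
  have h1 : volume U = ∑' l : Λ, ∫⁻ q in ZSpan.fundamentalDomain B,
      (l +ᵥ U).indicator (fun _ => (1 : ENNReal)) q := by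
    rw [hQ.measure_eq_tsum]
    refine tsum_congr fun l => ?_
    rw [lintegral_indicator (hUmeas.const_vadd l), setLIntegral_const, one_mul,
      Measure.restrict_apply (hUmeas.const_vadd l)]
  have h2 : (F.card : ENNReal) ≤ volume U := by
    rw [h1, ← lintegral_tsum (fun l =>
      (measurable_const.indicator (hUmeas.const_vadd l)).aemeasurable)]
    calc (F.card : ENNReal) = ∫⁻ q in ZSpan.fundamentalDomain B, (F.card : ENNReal) := by
          rw [setLIntegral_const, hQvol, mul_one]
      _ ≤ _ := by
          refine lintegral_mono fun q => ?_
          obtain ⟨v0, hv0⟩ := hC g hg hmin (-(g.mulVec q))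
          have hinj2 : Function.Injective (fun v : ι → ℤ => e (-(v + v0))) := by
            intro u v huv
            have := hinj huv
            simpa using this
          refine le_trans ?_ (ENNReal.sum_le_tsum (F.map ⟨_, hinj2⟩))
          rw [Finset.sum_map]
          rw [Finset.card_eq_sum_ones, Nat.cast_sum]
          refine Finset.sum_le_sum fun v hv => ?_
          rw [Set.indicator_of_mem]
          · simp
          · rw [Set.mem_vadd_set_iff_neg_vadd_mem]
            apply hUmem
            have h3 : -(e (-(v + v0))) +ᵥ q = toR v + (toR v0 + q) := by
              rw [AddSubgroup.vadd_def]
              ext i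
              simp only [he, NegMemClass.coe_neg, vadd_eq_add, Pi.add_apply, Pi.neg_apply, toR]
              push_cast
              ring
            change ‖g.mulVec (-(e (-(v + v0))) +ᵥ q)‖ ≤ _
            rw [h3, Matrix.mulVec_add, Matrix.mulVec_add]
            refine (norm_add_le _ _).trans (add_le_add (hF v hv) ?_)
            simpa using hv0
  have h3 : (F.card : ℝ) ≤ (2 * (R + C)) ^ Fintype.card ι := by
    rw [hUvol] at h2
    have h4 := ENNReal.toReal_mono ENNReal.ofReal_ne_top h2
    rwa [ENNReal.toReal_ofReal (by have := hC0.trans_le hR; positivity), ENNReal.toReal_natCast] at h4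
  refine h3.trans ?_
  have := hC0.trans_le hR
  exact pow_le_pow_left₀ (by positivity) (by linarith) _

end Lattice

/-- The linear map with matrix `ζ`, on matrices viewed as functions so that they carry the
sup norm. -/
def lin {τ κ : Type*} [Fintype κ] (ζ : τ → κ → ℝ) (z : κ → ℝ) : τ → ℝ :=
  fun i => ∑ j, ζ i j * z j

section lin

variable {τ κ : Type*} [Fintype κ]

theorem lin_zero (ζ : τ → κ → ℝ) : lin ζ 0 = 0 := by
  ext i
  simp [lin]

theorem lin_smul (ζ : τ → κ → ℝ) (a : ℝ) (z : κ → ℝ) : lin ζ (a • z) = a • lin ζ z := by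
  ext i
  simp only [lin, Pi.smul_apply, smul_eq_mul, Finset.mul_sum]
  exact Finset.sum_congr rfl fun j _ => by ring

theorem add_lin (ζ ζ' : τ → κ → ℝ) (z : κ → ℝ) : lin (ζ + ζ') z = lin ζ z + lin ζ' z := by
  ext i
  simp [lin, add_mul, Finset.sum_add_distrib]

theorem sub_lin (ζ ζ' : τ → κ → ℝ) (z : κ → ℝ) : lin (ζ - ζ') z = lin ζ z - lin ζ' z := by
  ext i
  simp [lin, sub_mul, Finset.sum_sub_distrib]

theorem smul_lin (a : ℝ) (ζ : τ → κ → ℝ) (z : κ → ℝ) : lin (a • ζ) z = a • lin ζ z := by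
  ext i
  simp [lin, Finset.mul_sum, mul_assoc]

theorem zero_lin (z : κ → ℝ) : lin (0 : τ → κ → ℝ) z = 0 := by
  ext i
  simp [lin]

theorem norm_lin_le [Fintype τ] (ζ : τ → κ → ℝ) (z : κ → ℝ) :
    ‖lin ζ z‖ ≤ Fintype.card κ * ‖ζ‖ * ‖z‖ := by
  refine (pi_norm_le_iff_of_nonneg (by positivity)).2 fun i => ?_
  refine (norm_sum_le _ _).trans ?_
  calc ∑ j, ‖ζ i j * z j‖ ≤ ∑ _j : κ, ‖ζ‖ * ‖z‖ := by
        refine Finset.sum_le_sum fun j _ => ?_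
        rw [norm_mul]
        have h1 : ‖ζ i j‖ ≤ ‖ζ‖ := (norm_le_pi_norm (ζ i) j).trans (norm_le_pi_norm ζ i)
        have h2 : ‖z j‖ ≤ ‖z‖ := norm_le_pi_norm z j
        gcongr
    _ = _ := by
        rw [Finset.sum_const, Finset.card_univ, nsmul_eq_mul]
        ring

end lin

/-- The approximation error of the integer pair `(x, y)`. -/
noncomputable def err {κ τ : Type*} [Fintype κ] [Fintype τ] (ξ : τ → κ → ℝ) (x : κ → ℤ)
    (y : τ → ℤ) : ℝ :=
  ‖lin ξ (toR x) - toR y‖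

theorem err_nonneg {κ τ : Type*} [Fintype κ] [Fintype τ] (ξ : τ → κ → ℝ) (x : κ → ℤ)
    (y : τ → ℤ) : 0 ≤ err ξ x y :=
  norm_nonneg _

/-- Every integer pair is improved upon by one whose first component is at most a constant
multiple longer. -/
def BoundedGaps {κ τ : Type*} [Fintype κ] [Fintype τ] (ξ : τ → κ → ℝ) : Prop :=
  ∃ M : ℝ, ∀ (x : κ → ℤ) (y : τ → ℤ), x ≠ 0 →
    ∃ (x' : κ → ℤ) (y' : τ → ℤ), x' ≠ 0 ∧ ‖toR x'‖ ≤ M * ‖toR x‖ ∧ err ξ x' y' < err ξ x y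

/-- Some integer pairs have an error smaller than all shorter ones by an arbitrarily large
factor. -/
def UnboundedDrops {κ τ : Type*} [Fintype κ] [Fintype τ] (ξ : τ → κ → ℝ) : Prop :=
  ∀ M : ℝ, ∃ (x₀ : κ → ℤ) (y₀ : τ → ℤ), 1 < ‖toR x₀‖ ∧
    ∀ (x : κ → ℤ) (y : τ → ℤ), x ≠ 0 → ‖toR x‖ < ‖toR x₀‖ → M * err ξ x₀ y₀ ≤ err ξ x y

theorem finite_norm_toR_le {κ : Type*} [Fintype κ] (R : ℝ) : {x : κ → ℤ | ‖toR x‖ ≤ R}.Finite := by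
  classical
  refine Set.Finite.subset (Set.finite_Icc (fun _ => -⌈R⌉) (fun _ => ⌈R⌉)) fun x hx => ?_
  have h1 : ∀ i, |(x i : ℝ)| ≤ R := fun i => (norm_le_pi_norm (toR x) i).trans hx
  refine ⟨fun i => ?_, fun i => ?_⟩
  · have h2 := (abs_le.1 (h1 i)).1
    have h3 := Int.le_ceil R
    have : (-⌈R⌉ : ℝ) ≤ x i := by linarith
    exact_mod_cast this
  · have h2 := (abs_le.1 (h1 i)).2
    have h3 := Int.le_ceil R
    have : (x i : ℝ) ≤ ⌈R⌉ := by linarith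
    exact_mod_cast this

theorem finite_err_lt {κ τ : Type*} [Fintype κ] [Fintype τ] (ξ : τ → κ → ℝ) (R T : ℝ) :
    {w : (κ → ℤ) × (τ → ℤ) | ‖toR w.1‖ ≤ R ∧ err ξ w.1 w.2 < T}.Finite := by
  refine Set.Finite.subset ((finite_norm_toR_le R).prod
    (finite_norm_toR_le (T + Fintype.card κ * ‖ξ‖ * R))) ?_
  rintro ⟨x, y⟩ ⟨hx, hy⟩
  refine ⟨hx, ?_⟩
  have h1 : toR y = -(lin ξ (toR x) - toR y) + lin ξ (toR x) := by abel
  change ‖toR y‖ ≤ _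
  rw [h1]
  refine (norm_add_le _ _).trans (add_le_add ?_ ?_)
  · rw [norm_neg]
    exact hy.le
  · refine (norm_lin_le _ _).trans ?_
    gcongr

theorem exists_shortest_err_lt {κ τ : Type*} [Fintype κ] [Fintype τ] (ξ : τ → κ → ℝ) (T : ℝ)
    (h : ∃ w : (κ → ℤ) × (τ → ℤ), w.1 ≠ 0 ∧ err ξ w.1 w.2 < T) :
    ∃ w : (κ → ℤ) × (τ → ℤ), (w.1 ≠ 0 ∧ err ξ w.1 w.2 < T) ∧
      ∀ (x : κ → ℤ) (y : τ → ℤ), x ≠ 0 → err ξ x y < T →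
        ‖toR w.1‖ ≤ ‖toR x‖ ∧ (‖toR x‖ = ‖toR w.1‖ → err ξ w.1 w.2 ≤ err ξ x y) := by
  obtain ⟨w₁, hw₁, hT₁⟩ := h
  set S : Set ((κ → ℤ) × (τ → ℤ)) :=
    {w | w.1 ≠ 0 ∧ ‖toR w.1‖ ≤ ‖toR w₁.1‖ ∧ err ξ w.1 w.2 < T} with hS
  have hfin : S.Finite := (finite_err_lt ξ ‖toR w₁.1‖ T).subset fun w hw => hw.2
  obtain ⟨w, hw, hmin⟩ := hfin.exists_minimalFor (fun w => toLex (‖toR w.1‖, err ξ w.1 w.2)) S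
    ⟨w₁, hw₁, le_rfl, hT₁⟩
  refine ⟨w, ⟨hw.1, hw.2.2⟩, fun x y hx hxy => ?_⟩
  by_cases hle : ‖toR x‖ ≤ ‖toR w₁.1‖
  · have h1 : toLex (‖toR w.1‖, err ξ w.1 w.2) ≤ toLex (‖toR x‖, err ξ x y) := by
      rcases le_total (toLex (‖toR w.1‖, err ξ w.1 w.2)) (toLex (‖toR x‖, err ξ x y)) with h | h
      · exact h
      · exact hmin (j := (x, y)) ⟨hx, hle, hxy⟩ h
    rw [Prod.Lex.toLex_le_toLex] at h1
    rcases h1 with h1 | ⟨h1, h2⟩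
    · exact ⟨h1.le, fun h => absurd h h1.ne'⟩
    · exact ⟨h1.le, fun _ => h2⟩
  · push Not at hle
    have := hw.2.1.trans_lt hle
    exact ⟨this.le, fun h => absurd h this.ne'⟩

theorem err_eq {m n : ℕ} (ξ : Fin n → Fin m → ℝ) (x : Fin m → ℤ) (y : Fin n → ℤ) :
    err ξ x y = ‖(Matrix.of ξ).mulVec (fun j => (x j : ℝ)) - (fun k => (y k : ℝ))‖ :=
  rfl

theorem totallyIrrational_of_boundedGaps {m n : ℕ} {ξ : Fin n → Fin m → ℝ} (h : BoundedGaps ξ) :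
    TotallyIrrational (Matrix.of ξ) := by
  intro u v huv
  rw [← err_eq]
  by_cases hu : u = 0
  · subst hu
    have hv : v ≠ 0 := by
      rintro rfl
      exact huv rfl
    have h1 : toR (0 : Fin m → ℤ) = 0 := by
      ext i
      simp
    rw [err, h1, lin_zero, zero_sub, norm_neg]
    linarith [one_le_norm_toR hv]
  · obtain ⟨M, hM⟩ := h
    obtain ⟨x', y', -, -, h3⟩ := hM u v hu
    exact (err_nonneg _ _ _).trans_lt h3

theorem exists_norm_one {m : ℕ} (hm : 1 ≤ m) : ∃ x : Fin m → ℤ, x ≠ 0 ∧ ‖toR x‖ = 1 := by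
  refine ⟨fun _ => 1, ?_, ?_⟩
  · intro h
    simpa using congrFun h ⟨0, hm⟩
  · have : Nonempty (Fin m) := ⟨⟨0, hm⟩⟩
    have h : toR (fun _ : Fin m => (1 : ℤ)) = fun _ => (1 : ℝ) := by
      ext
      simp
    rw [h, pi_norm_const, norm_one]

theorem exists_bestApproxSeq {m n : ℕ} (hm : 1 ≤ m) {ξ : Fin n → Fin m → ℝ} (h : BoundedGaps ξ) :
    ∃ (x : ℕ → Fin m → ℤ) (y : ℕ → Fin n → ℤ), IsBestApproxSeq (Matrix.of ξ) x y ∧ PropB x := by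
  obtain ⟨M, hM⟩ := h
  obtain ⟨e, he0, he1⟩ := exists_norm_one hm
  have hex : ∀ w : (Fin m → ℤ) × (Fin n → ℤ), w.1 ≠ 0 →
      ∃ w' : (Fin m → ℤ) × (Fin n → ℤ), w'.1 ≠ 0 ∧ err ξ w'.1 w'.2 < err ξ w.1 w.2 := by
    intro w hw
    obtain ⟨x', y', h1, -, h3⟩ := hM w.1 w.2 hw
    exact ⟨(x', y'), h1, h3⟩
  obtain ⟨w₀, ⟨hw₀, hw₀T⟩, hmin₀⟩ := exists_shortest_err_lt ξ (err ξ e 0 + 1)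
    ⟨(e, 0), he0, lt_add_one _⟩
  choose f hf hfmin using fun w : {w : (Fin m → ℤ) × (Fin n → ℤ) // w.1 ≠ 0} =>
    exists_shortest_err_lt ξ (err ξ w.1.1 w.1.2) (hex w.1 w.2)
  let F : {w : (Fin m → ℤ) × (Fin n → ℤ) // w.1 ≠ 0} → {w : (Fin m → ℤ) × (Fin n → ℤ) // w.1 ≠ 0} :=
    fun w => ⟨f w, (hf w).1⟩
  let W : ℕ → {w : (Fin m → ℤ) × (Fin n → ℤ) // w.1 ≠ 0} := fun i => F^[i] ⟨w₀, hw₀⟩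
  have hW : ∀ i, (W (i + 1)).1 = f (W i) := fun i => by
    simp only [W, Function.iterate_succ_apply']
    rfl
  have hlt : ∀ i, err ξ (W (i + 1)).1.1 (W (i + 1)).1.2 < err ξ (W i).1.1 (W i).1.2 := fun i => by
    rw [hW]
    exact (hf (W i)).2
  have hmin : ∀ i (x : Fin m → ℤ) (y : Fin n → ℤ), x ≠ 0 → err ξ x y < err ξ (W i).1.1 (W i).1.2 →
      ‖toR (W (i + 1)).1.1‖ ≤ ‖toR x‖ := fun i x y hx hxy => by
    rw [hW]
    exact (hfmin (W i) x y hx hxy).1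
  refine ⟨fun i => (W i).1.1, fun i => (W i).1.2, ⟨fun i => (W i).2, ?_, ?_, ?_, ?_⟩, M, ?_⟩
  · change ‖toR w₀.1‖ = 1
    refine le_antisymm ?_ (one_le_norm_toR hw₀)
    rw [← he1]
    exact (hmin₀ e 0 he0 (lt_add_one _)).1
  · refine strictMono_nat_of_lt_succ fun i => ?_
    change ‖toR (W i).1.1‖ < ‖toR (W (i + 1)).1.1‖
    rcases i with _ | i
    · have h2 := hmin₀ (W 1).1.1 (W 1).1.2 (W 1).2 ((hlt 0).trans hw₀T)
      refine lt_of_le_of_ne h2.1 fun h => ?_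
      exact absurd (h2.2 h.symm) (not_le.2 (hlt 0))
    · have h2 := hfmin (W i) (W (i + 2)).1.1 (W (i + 2)).1.2 (W (i + 2)).2
        ((hlt (i + 1)).trans (hlt i))
      rw [← hW] at h2
      refine lt_of_le_of_ne h2.1 fun h => ?_
      exact absurd (h2.2 h.symm) (not_le.2 (hlt (i + 1)))
  · exact strictAnti_nat_of_succ_lt fun i => hlt i
  · intro i u v hu hlt'
    by_contra hcon
    exact absurd (hmin i u v hu (not_le.1 hcon)) (not_le.2 hlt')
  · intro i
    obtain ⟨x', y', h1, h2, h3⟩ := hM (W i).1.1 (W i).1.2 (W i).2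
    have h4 := (hmin i x' y' h1 h3).trans h2
    have h5 := one_le_norm_toR (W i).2
    exact (div_le_iff₀ (by change 0 < ‖toR (W i).1.1‖; linarith)).2 h4

theorem not_propC_of_unboundedDrops {m n : ℕ} {ξ : Fin n → Fin m → ℝ}
    (hT : TotallyIrrational (Matrix.of ξ)) (h : UnboundedDrops ξ) {x : ℕ → Fin m → ℤ}
    {y : ℕ → Fin n → ℤ} (hxy : IsBestApproxSeq (Matrix.of ξ) x y) : ¬PropC (Matrix.of ξ) x y := by
  rintro ⟨M, hM⟩
  obtain ⟨x₀, y₀, hx₀, hdrop⟩ := h (|M| + 1)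
  have hx₀0 : x₀ ≠ 0 := by
    rintro rfl
    have h1 : toR (0 : Fin m → ℤ) = 0 := by
      ext i
      simp
    rw [h1, norm_zero] at hx₀
    linarith
  have hgrow : ∀ i : ℕ, (i + 1 : ℝ) ≤ Xval x i := by
    have hnat : ∀ i, ∃ k : ℕ, Xval x i = k := by
      intro i
      have : Nonempty (Fin m) := by
        by_contra hc
        rw [not_nonempty_iff] at hc
        exact hxy.nonzero 0 (Subsingleton.elim _ _)
      obtain ⟨j, hj⟩ := Finite.exists_max (fun j => ‖((x i j : ℤ) : ℝ)‖)
      refine ⟨(x i j).natAbs, ?_⟩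
      rw [Nat.cast_natAbs]
      push_cast
      rw [Xval]
      refine le_antisymm ((pi_norm_le_iff_of_nonneg (abs_nonneg _)).2 hj) ?_
      exact norm_le_pi_norm (fun j => (x i j : ℝ)) j
    choose k hk using hnat
    have hmono : StrictMono k := by
      intro i j hij
      have := hxy.xStrictMono hij
      rw [hk, hk] at this
      exact_mod_cast this
    intro i
    rw [hk]
    have h0 : k 0 = 1 := by
      have := hxy.first
      rw [hk] at this
      exact_mod_cast this
    induction i with
    | zero => simp [h0]
    | succ i ih =>
      have h1 := hmono (Nat.lt_add_one i)
      have h2 : i + 1 ≤ k i := by exact_mod_cast ih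
      have : i + 1 + 1 ≤ k (i + 1) := by omega
      exact_mod_cast this
  have hexists : ∃ i, ‖toR x₀‖ ≤ Xval x i := by
    obtain ⟨i, hi⟩ := exists_nat_ge ‖toR x₀‖
    exact ⟨i, hi.trans (by linarith [hgrow i])⟩
  classical
  obtain ⟨i, hi, hi'⟩ : ∃ i, ‖toR x₀‖ ≤ Xval x (i + 1) ∧ Xval x i < ‖toR x₀‖ := by
    have h1 := Nat.find_spec hexists
    have h2 : Nat.find hexists ≠ 0 := by
      intro h0
      rw [h0, hxy.first] at h1
      linarith
    obtain ⟨j, hj⟩ := Nat.exists_eq_succ_of_ne_zero h2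
    refine ⟨j, by rwa [hj] at h1, ?_⟩
    have := Nat.find_min hexists (m := j) (by omega)
    exact not_le.1 this
  have hpos : ∀ u v, u ≠ 0 → 0 < err ξ u v := fun u v hu => hT u v fun h => hu (congrArg Prod.fst h)
  have hLi : (|M| + 1) * err ξ x₀ y₀ ≤ Lval (Matrix.of ξ) x y i :=
    hdrop (x i) (y i) (hxy.nonzero i) hi'
  have hnext : Lval (Matrix.of ξ) x y (i + 1) ≤ err ξ x₀ y₀ := by
    rcases lt_or_eq_of_le hi with hlt | heq
    · have h1 : Lval (Matrix.of ξ) x y i ≤ err ξ x₀ y₀ := hxy.best i x₀ y₀ hx₀0 hlt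
      exact (hxy.lStrictAnti (Nat.lt_succ_self i)).le.trans h1
    · refine hxy.best (i + 1) x₀ y₀ hx₀0 ?_
      change ‖toR x₀‖ < _
      rw [heq]
      exact hxy.xStrictMono (Nat.lt_succ_self _)
  have hpos' : 0 < Lval (Matrix.of ξ) x y (i + 1) := hpos _ _ (hxy.nonzero _)
  have h1 := hM i
  rw [div_le_iff₀ hpos'] at h1
  have h2 : (|M| + 1) * Lval (Matrix.of ξ) x y (i + 1) ≤ (|M| + 1) * err ξ x₀ y₀ := by gcongr
  nlinarith [le_abs_self M]

/-- The unimodular matrix sending `(x, y)` to `(x, ξ x - y)`, up to the sign of `y`. -/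
def shear {κ τ : Type*} [DecidableEq κ] [DecidableEq τ] (ξ : τ → κ → ℝ) :
    Matrix (κ ⊕ τ) (κ ⊕ τ) ℝ :=
  Matrix.fromBlocks 1 0 (Matrix.of ξ) (-1)

theorem abs_det_shear {κ τ : Type*} [Fintype κ] [Fintype τ] [DecidableEq κ] [DecidableEq τ]
    (ξ : τ → κ → ℝ) : |(shear ξ).det| = 1 := by
  rw [shear, Matrix.det_fromBlocks_zero₁₂, Matrix.det_one, one_mul, Matrix.det_neg, abs_mul,
    abs_pow, abs_neg, abs_one, one_pow, Matrix.det_one, abs_one, one_mul]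

theorem shear_mulVec_inl {κ τ : Type*} [Fintype κ] [Fintype τ] [DecidableEq κ] [DecidableEq τ]
    (ξ : τ → κ → ℝ) (v : κ ⊕ τ → ℤ) (i : κ) :
    (shear ξ).mulVec (toR v) (Sum.inl i) = v (Sum.inl i) := by
  simp [shear, Matrix.mulVec, dotProduct, Fintype.sum_sum_type, Matrix.one_apply]

theorem shear_mulVec_inr {κ τ : Type*} [Fintype κ] [Fintype τ] [DecidableEq κ] [DecidableEq τ]
    (ξ : τ → κ → ℝ) (v : κ ⊕ τ → ℤ) (i : τ) :
    (shear ξ).mulVec (toR v) (Sum.inr i)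
      = (lin ξ (toR (v ∘ Sum.inl)) - toR (v ∘ Sum.inr)) i := by
  simp [shear, Matrix.mulVec, dotProduct, Fintype.sum_sum_type, Matrix.one_apply, lin, toR,
    sub_eq_add_neg, Matrix.neg_apply]

/-- Dirichlet's theorem, from Minkowski's. -/
theorem exists_small_err {κ τ : Type*} [Fintype κ] [Fintype τ] (ξ : τ → κ → ℝ) {X L : ℝ}
    (hX : 0 < X) (hL : 0 < L) (hL1 : L < 1)
    (h : 1 < X ^ Fintype.card κ * L ^ Fintype.card τ) :
    ∃ (x : κ → ℤ) (y : τ → ℤ), x ≠ 0 ∧ ‖toR x‖ ≤ X ∧ err ξ x y ≤ L := by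
  classical
  obtain ⟨v, hv0, hv⟩ := minkowski_box (shear ξ) (abs_det_shear ξ)
    (Sum.elim (fun _ => X) (fun _ => L)) (by rintro (i | i) <;> simpa) (by
      simpa [Fintype.prod_sum_type] using h)
  have h1 : ‖toR (v ∘ Sum.inl)‖ ≤ X := (pi_norm_le_iff_of_nonneg hX.le).2 fun i => by
    have := hv (Sum.inl i)
    rwa [shear_mulVec_inl] at this
  have h2 : err ξ (v ∘ Sum.inl) (v ∘ Sum.inr) ≤ L := (pi_norm_le_iff_of_nonneg hL.le).2 fun i => by
    have := hv (Sum.inr i)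
    rwa [shear_mulVec_inr] at this
  refine ⟨v ∘ Sum.inl, v ∘ Sum.inr, fun h0 => hv0 ?_, h1, h2⟩
  have h3 : v ∘ Sum.inr = 0 := by
    apply eq_zero_of_norm_toR_lt
    have h4 : toR (0 : κ → ℤ) = 0 := by
      ext i
      simp
    rw [err, h0, h4, lin_zero, zero_sub, norm_neg] at h2
    linarith
  ext i
  rcases i with i | i
  · exact congrFun h0 i
  · exact congrFun h3 i

theorem not_propA_of_unboundedDrops {m n : ℕ} (hm : 1 ≤ m) (hn : 1 ≤ n) {ξ : Fin n → Fin m → ℝ}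
    (hT : TotallyIrrational (Matrix.of ξ)) (h : UnboundedDrops ξ) : ¬PropA (Matrix.of ξ) := by
  rintro ⟨c, hc, hA⟩
  have hpos : ∀ u v, u ≠ 0 → 0 < err ξ u v := fun u v hu => hT u v fun h => hu (congrArg Prod.fst h)
  set M : ℝ := 4 ^ (m + 1) / c + 2 with hMdef
  have hM2 : 2 ≤ M := by
    have : 0 ≤ 4 ^ (m + 1) / c := by positivity
    linarith
  obtain ⟨x₀, y₀, hx₀, hdrop⟩ := h M
  have hx₀0 : x₀ ≠ 0 := by
    rintro rfl
    have h1 : toR (0 : Fin m → ℤ) = 0 := by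
      ext i
      simp
    rw [h1, norm_zero] at hx₀
    linarith
  obtain ⟨e, he0, he1⟩ := exists_norm_one hm
  have hL0 := hpos x₀ y₀ hx₀0
  have hsmall : M * err ξ x₀ y₀ ≤ 1 / 2 := by
    refine (hdrop e (fun i => round (lin ξ (toR e) i)) he0 (by linarith)).trans ?_
    refine (pi_norm_le_iff_of_nonneg (by norm_num)).2 fun i => ?_
    exact abs_sub_round _
  have hA0 : c ≤ ‖toR x₀‖ ^ m * err ξ x₀ y₀ ^ n := hA x₀ y₀ hx₀0
  have hlarge : 1 < (‖toR x₀‖ / 2) ^ m * (M * err ξ x₀ y₀ / 2) ^ n := by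
    have h1 : M / 2 ≤ (M / 2) ^ n := le_self_pow₀ (by linarith) (by omega)
    have h2 : (‖toR x₀‖ / 2) ^ m * (M * err ξ x₀ y₀ / 2) ^ n
        = (‖toR x₀‖ ^ m * err ξ x₀ y₀ ^ n) * (M / 2) ^ n / 2 ^ m := by
      rw [div_pow, show M * err ξ x₀ y₀ / 2 = err ξ x₀ y₀ * (M / 2) by ring, mul_pow]
      ring
    rw [h2, lt_div_iff₀ (by positivity), one_mul]
    calc (2 : ℝ) ^ m ≤ 4 ^ m := by gcongr; norm_num
      _ < c * (M / 2) := by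
          rw [hMdef, pow_succ]
          have : (0 : ℝ) < 4 ^ m := by positivity
          field_simp
          nlinarith
      _ ≤ _ := mul_le_mul hA0 h1 (by linarith) (by positivity)
  obtain ⟨x, y, hx, hxX, hxL⟩ := exists_small_err ξ (X := ‖toR x₀‖ / 2) (L := M * err ξ x₀ y₀ / 2)
    (by linarith) (by positivity) (by linarith) (by simpa using hlarge)
  have := hdrop x y hx (by linarith)
  have h3 : 0 < M * err ξ x₀ y₀ := by positivity
  linarith

theorem sum_inv_pow_le {V : Type*} {α β : ℕ} (hα : 1 ≤ α) {x₀ x₁ B : ℝ} (hx₀ : 0 < x₀)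
    (hx₁ : 0 < x₁) (hB : 0 ≤ B) (f : V → ℝ) (F : Finset V) (hf : ∀ v ∈ F, x₀ ≤ f v)
    (hcount : ∀ F' ⊆ F, ∀ T, x₁ ≤ T → (∀ v ∈ F', f v ≤ T) → (F'.card : ℝ) ≤ B * T ^ (α + β))
    (J : ℕ) (hJ : ∀ v ∈ F, f v ≤ x₁ * 2 ^ J) :
    ∑ v ∈ F, (f v ^ β)⁻¹ ≤
      B * x₁ ^ (α + β) * (x₀ ^ β)⁻¹ + B * 2 ^ (α + β) * (x₁ * 2 ^ J) ^ α := by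
  classical
  induction J generalizing F with
  | zero =>
    have h1 : ∑ v ∈ F, (f v ^ β)⁻¹ ≤ ∑ v ∈ F, (x₀ ^ β)⁻¹ := by
      refine Finset.sum_le_sum fun v hv => ?_
      have := hf v hv
      gcongr
    rw [Finset.sum_const, nsmul_eq_mul] at h1
    have h2 := hcount F subset_rfl x₁ le_rfl (by simpa using hJ)
    have h3 : 0 ≤ B * 2 ^ (α + β) * (x₁ * 2 ^ 0) ^ α := by positivity
    have h4 : (F.card : ℝ) * (x₀ ^ β)⁻¹ ≤ B * x₁ ^ (α + β) * (x₀ ^ β)⁻¹ := by gcongr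
    exact (h1.trans h4).trans (le_add_of_nonneg_right h3)
  | succ J ih =>
    set T : ℝ := x₁ * 2 ^ J with hT
    have hTpos : 0 < T := by positivity
    have hx₁T : x₁ ≤ T := le_mul_of_one_le_right hx₁.le (one_le_pow₀ (by norm_num))
    rw [← Finset.sum_filter_add_sum_filter_not F (fun v => f v ≤ T)]
    have h1 := ih (F.filter fun v => f v ≤ T) (fun v hv => hf v (Finset.mem_filter.1 hv).1)
      (fun F' hF' => hcount F' (hF'.trans (Finset.filter_subset _ _)))
      (fun v hv => (Finset.mem_filter.1 hv).2)
    have h2 : ∑ v ∈ F with ¬f v ≤ T, (f v ^ β)⁻¹ ≤ ∑ v ∈ F with ¬f v ≤ T, (T ^ β)⁻¹ := by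
      refine Finset.sum_le_sum fun v hv => ?_
      have := (not_le.1 (Finset.mem_filter.1 hv).2).le
      gcongr
    rw [Finset.sum_const, nsmul_eq_mul] at h2
    have h3 := hcount (F.filter fun v => ¬f v ≤ T) (Finset.filter_subset _ _) (2 * T)
      (by linarith) (fun v hv => by
        have := hJ v (Finset.mem_filter.1 hv).1
        rw [pow_succ] at this
        linarith)
    have h4 : ((F.filter fun v => ¬f v ≤ T).card : ℝ) * (T ^ β)⁻¹ ≤ B * 2 ^ (α + β) * T ^ α := by
      rw [← div_eq_mul_inv, div_le_iff₀ (by positivity)]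
      refine h3.trans (le_of_eq ?_)
      rw [mul_pow, pow_add T]
      ring
    have h5 : (x₁ * 2 ^ (J + 1)) ^ α = 2 ^ α * T ^ α := by
      rw [hT, ← mul_pow, pow_succ]
      congr 1
      ring
    have h6 : (2 : ℝ) ≤ 2 ^ α := le_self_pow₀ (by norm_num) (by omega)
    have h7 : B * 2 ^ (α + β) * (2 * T ^ α) ≤ B * 2 ^ (α + β) * (2 ^ α * T ^ α) := by gcongr
    rw [h5]
    linarith

theorem card_fin_le_of_dist {q : ℕ} (A : Finset (Fin q)) {ℓ : ℝ} (hℓ : 0 ≤ ℓ)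
    (hA : ∀ c ∈ A, ∀ c' ∈ A, ((c : ℕ) : ℝ) - ((c' : ℕ) : ℝ) ≤ ℓ) : (A.card : ℝ) ≤ ℓ + 1 := by
  rcases A.eq_empty_or_nonempty with rfl | hne
  · simp
    linarith
  · obtain ⟨c₀, hc₀, hmin⟩ := A.exists_min_image (fun c => (c : ℕ)) hne
    have h1 : A.card ≤ (Finset.range (⌊ℓ⌋₊ + 1)).card := by
      refine Finset.card_le_card_of_injOn (fun c => (c : ℕ) - (c₀ : ℕ)) ?_ ?_
      · intro c hc
        simp only [Finset.coe_range, Set.mem_Iio]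
        rw [Nat.lt_succ_iff]
        apply Nat.le_floor
        rw [Nat.cast_sub (hmin c hc)]
        exact hA c hc c₀ hc₀
      · intro c hc c' hc' h
        have h1 := hmin c hc
        have h2 := hmin c' hc'
        simp only at h
        ext
        omega
    rw [Finset.card_range] at h1
    have h2 : (A.card : ℝ) ≤ (⌊ℓ⌋₊ + 1 : ℕ) := by exact_mod_cast h1
    push_cast at h2
    linarith [Nat.floor_le hℓ]

/-- The centers of a grid of spacing `4 * r` in the unit box around the origin. -/
def gridCenter {κ : Type*} {q : ℕ} (r : ℝ) (t : κ → Fin q) : κ → ℝ :=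
  fun j => -1 + r * (4 * ((t j : ℕ) : ℝ) + 2)

theorem card_row_le {κ : Type*} [Fintype κ] [DecidableEq κ] {q : ℕ} {r η : ℝ} (hr : 0 < r)
    (hη : 0 < η) (h : ℝ) {u : κ → ℝ} (hu : 0 < ‖u‖) (A : Finset (κ → Fin q))
    (hA : ∀ t ∈ A, |h + ∑ j, gridCenter r t j * u j| ≤ η) :
    (A.card : ℝ) ≤ q ^ (Fintype.card κ - 1) * (η / (2 * r * ‖u‖) + 1) := by
  classical
  have hne : Nonempty κ := by
    by_contra hc
    rw [not_nonempty_iff] at hc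
    rw [Subsingleton.elim u 0, norm_zero] at hu
    exact lt_irrefl _ hu
  obtain ⟨j₀, hj₀⟩ : ∃ j₀, ‖u‖ = |u j₀| := by
    obtain ⟨j, hj⟩ := Finite.exists_max (fun j => ‖u j‖)
    exact ⟨j, le_antisymm ((pi_norm_le_iff_of_nonneg (norm_nonneg _)).2 hj) (norm_le_pi_norm u j)⟩
  set π : (κ → Fin q) → ({j // j ≠ j₀} → Fin q) := fun t j => t j with hπ
  set N : ℕ := ⌊η / (2 * r * ‖u‖) + 1⌋₊ with hN
  have hfib : ∀ a ∈ A.image π, (A.filter fun t => π t = a).card ≤ N := by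
    intro a _
    apply Nat.le_floor
    have hinj : Set.InjOn (fun t : κ → Fin q => t j₀) (A.filter fun t => π t = a) := by
      intro t ht t' ht' htt
      have h1 : π t = π t' := by
        rw [(Finset.mem_filter.1 ht).2, (Finset.mem_filter.1 ht').2]
      ext j
      by_cases hj : j = j₀
      · rw [hj]
        exact congrArg _ htt
      · exact congrArg _ (congrFun h1 ⟨j, hj⟩)
    rw [← Finset.card_image_of_injOn hinj]
    refine card_fin_le_of_dist _ (by positivity) ?_
    intro c hc c' hc'
    obtain ⟨t, ht, rfl⟩ := Finset.mem_image.1 hc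
    obtain ⟨t', ht', rfl⟩ := Finset.mem_image.1 hc'
    have h1 : π t = π t' := by
      rw [(Finset.mem_filter.1 ht).2, (Finset.mem_filter.1 ht').2]
    have hsum : ∀ s : κ → Fin q, ∑ j, gridCenter r s j * u j
        = gridCenter r s j₀ * u j₀ + ∑ j ∈ Finset.univ.erase j₀, gridCenter r s j * u j := fun s =>
      (Finset.add_sum_erase _ _ (Finset.mem_univ j₀)).symm
    have heq : ∑ j ∈ Finset.univ.erase j₀, gridCenter r t j * u j
        = ∑ j ∈ Finset.univ.erase j₀, gridCenter r t' j * u j := by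
      refine Finset.sum_congr rfl fun j hj => ?_
      have : t j = t' j := congrFun h1 ⟨j, (Finset.mem_erase.1 hj).1⟩
      rw [gridCenter, gridCenter, this]
    have e1 := hA t (Finset.mem_filter.1 ht).1
    have e2 := hA t' (Finset.mem_filter.1 ht').1
    rw [hsum, heq] at e1
    rw [hsum] at e2
    have e3 : |gridCenter r t j₀ * u j₀ - gridCenter r t' j₀ * u j₀| ≤ 2 * η := by
      rw [abs_le] at e1 e2 ⊢
      constructor <;> linarith [e1.1, e1.2, e2.1, e2.2]
    rw [← sub_mul, abs_mul, ← hj₀] at e3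
    have e4 : gridCenter r t j₀ - gridCenter r t' j₀
        = 4 * r * (((t j₀ : ℕ) : ℝ) - ((t' j₀ : ℕ) : ℝ)) := by
      simp only [gridCenter]
      ring
    rw [e4, abs_mul, abs_of_pos (by positivity : 0 < 4 * r)] at e3
    rw [le_div_iff₀ (by positivity)]
    have e5 := le_abs_self (((t j₀ : ℕ) : ℝ) - ((t' j₀ : ℕ) : ℝ))
    have e6 : (((t j₀ : ℕ) : ℝ) - ((t' j₀ : ℕ) : ℝ)) * (2 * r * ‖u‖)
        ≤ |((t j₀ : ℕ) : ℝ) - ((t' j₀ : ℕ) : ℝ)| * (2 * r * ‖u‖) := by gcongr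
    linarith
  have h1 := Finset.card_le_mul_card_image A N hfib
  have h2 : (A.image π).card ≤ q ^ (Fintype.card κ - 1) := by
    refine (Finset.card_le_univ _).trans (le_of_eq ?_)
    rw [Fintype.card_fun, Fintype.card_fin]
    congr 1
    rw [Fintype.card_subtype_compl, Fintype.card_subtype_eq]
  have h3 : (N : ℝ) ≤ η / (2 * r * ‖u‖) + 1 := Nat.floor_le (by positivity)
  calc (A.card : ℝ) ≤ (N * (A.image π).card : ℕ) := by exact_mod_cast h1
    _ = N * ((A.image π).card : ℝ) := by push_cast; ring
    _ ≤ (η / (2 * r * ‖u‖) + 1) * (q ^ (Fintype.card κ - 1) : ℕ) := by gcongr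
    _ = _ := by push_cast; ring

theorem abs_gridCenter_le {κ : Type*} {q ρ D : ℕ} (hq : 2 * q = ρ ^ D) (t : κ → Fin q) (j : κ) :
    |gridCenter (((ρ : ℝ) ^ D)⁻¹) t j| ≤ 1 - 2 * ((ρ : ℝ) ^ D)⁻¹ := by
  have h1 : ((t j : ℕ) : ℝ) + 1 ≤ q := by exact_mod_cast (t j).2
  have h2 : (2 : ℝ) * q = (ρ : ℝ) ^ D := by exact_mod_cast hq
  have h3 : (0 : ℝ) ≤ ((t j : ℕ) : ℝ) := Nat.cast_nonneg _
  have hpos : (0 : ℝ) < (ρ : ℝ) ^ D := by rw [← h2]; linarith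
  have h4 : ((ρ : ℝ) ^ D)⁻¹ * (2 * q) = 1 := by rw [h2]; exact inv_mul_cancel₀ hpos.ne'
  have h5 : 0 < ((ρ : ℝ) ^ D)⁻¹ := by positivity
  rw [gridCenter, abs_le]
  constructor <;> nlinarith

section Compat

variable {κ τ : Type*} [Fintype κ] [Fintype τ]

/-- The first block of coordinates of the lattice vector `g v`. -/
def gx (g : Matrix (κ ⊕ τ) (κ ⊕ τ) ℝ) (v : κ ⊕ τ → ℤ) : κ → ℝ :=
  fun i => g.mulVec (toR v) (Sum.inl i)

/-- The second block of coordinates of the lattice vector `g v`. -/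
def gy (g : Matrix (κ ⊕ τ) (κ ⊕ τ) ℝ) (v : κ ⊕ τ → ℤ) : τ → ℝ :=
  fun i => g.mulVec (toR v) (Sum.inr i)

/-- The lattice `g`, sheared by `c` and renormalised at scale `lam`, has no nonzero vector of
norm less than `δ`. -/
def Cpt (g : Matrix (κ ⊕ τ) (κ ⊕ τ) ℝ) (c : τ → κ → ℝ) (lam δ : ℝ) : Prop :=
  ∀ v : κ ⊕ τ → ℤ, v ≠ 0 → δ * lam ^ Fintype.card τ ≤ ‖gx g v‖ ∨
    δ * (lam ^ Fintype.card κ)⁻¹ ≤ ‖gy g v + lin c (gx g v)‖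

theorem norm_mulVec_le (g : Matrix (κ ⊕ τ) (κ ⊕ τ) ℝ) (v : κ ⊕ τ → ℤ) {R : ℝ}
    (hx : ‖gx g v‖ ≤ R) (hy : ‖gy g v‖ ≤ R) : ‖g.mulVec (toR v)‖ ≤ R := by
  have hR : 0 ≤ R := (norm_nonneg _).trans hx
  refine (pi_norm_le_iff_of_nonneg hR).2 ?_
  rintro (i | i)
  · exact (norm_le_pi_norm (gx g v) i).trans hx
  · exact (norm_le_pi_norm (gy g v) i).trans hy

theorem norm_gx_le (g : Matrix (κ ⊕ τ) (κ ⊕ τ) ℝ) (v : κ ⊕ τ → ℤ) :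
    ‖gx g v‖ ≤ ‖g.mulVec (toR v)‖ :=
  (pi_norm_le_iff_of_nonneg (norm_nonneg _)).2 fun _ => norm_le_pi_norm (g.mulVec (toR v)) _

theorem norm_gy_le (g : Matrix (κ ⊕ τ) (κ ⊕ τ) ℝ) (v : κ ⊕ τ → ℤ) :
    ‖gy g v‖ ≤ ‖g.mulVec (toR v)‖ :=
  (pi_norm_le_iff_of_nonneg (norm_nonneg _)).2 fun _ => norm_le_pi_norm (g.mulVec (toR v)) _

theorem norm_gridCenter_le {q ρ D : ℕ} (hq : 2 * q = ρ ^ D) (hq0 : 0 < q) (t : τ → κ → Fin q) :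
    ‖fun i => gridCenter (((ρ : ℝ) ^ D)⁻¹) (t i)‖ ≤ 1 - 2 * ((ρ : ℝ) ^ D)⁻¹ := by
  have h2 : (2 : ℝ) * q = (ρ : ℝ) ^ D := by exact_mod_cast hq
  have h0 : (1 : ℝ) ≤ q := by exact_mod_cast hq0
  have h1 : (0 : ℝ) ≤ 1 - 2 * ((ρ : ℝ) ^ D)⁻¹ := by
    rw [← h2, sub_nonneg, ← div_eq_mul_inv, div_le_one (by linarith)]
    linarith
  exact (pi_norm_le_iff_of_nonneg h1).2 fun i => (pi_norm_le_iff_of_nonneg h1).2 fun j =>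
    abs_gridCenter_le hq (t i) j

set_option maxHeartbeats 1000000 in
theorem exists_many_compat (κ τ : Type*) [Fintype κ] [Fintype τ] [DecidableEq κ] [DecidableEq τ]
    [Nonempty κ] [Nonempty τ] :
    ∃ δs : ℝ, 0 < δs ∧ δs ≤ 1 ∧ ∀ δin : ℝ, 0 < δin → ∃ ρ₀ : ℕ, ∀ ρ : ℕ, ρ₀ ≤ ρ → Even ρ →
      ∀ g : Matrix (κ ⊕ τ) (κ ⊕ τ) ℝ, |g.det| = 1 →
      (∀ v : κ ⊕ τ → ℤ, v ≠ 0 → δin ≤ ‖g.mulVec (toR v)‖) →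
      ∀ q : ℕ, 2 * q = ρ ^ (Fintype.card κ + Fintype.card τ) →
      ∃ G : Finset (τ → κ → Fin q), q ^ (Fintype.card κ * Fintype.card τ) ≤ 2 * G.card ∧
        ∀ t ∈ G, Cpt g
          (fun i => gridCenter (((ρ : ℝ) ^ (Fintype.card κ + Fintype.card τ))⁻¹) (t i)) ρ δs := by
  classical
  set α := Fintype.card κ with hα
  set β := Fintype.card τ with hβ
  have hα1 : 1 ≤ α := Fintype.card_pos
  have hβ1 : 1 ≤ β := Fintype.card_pos
  have hα1R : (1 : ℝ) ≤ α := by exact_mod_cast hα1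
  set B : ℝ := (8 * α) ^ (α + β) with hB
  have hBpos : 0 < B := by positivity
  have hB1 : 1 ≤ B := one_le_pow₀ (by linarith)
  set E : ℝ := 4 ^ β * B * 2 ^ (α + β) * 2 ^ α with hE
  have hE1 : 1 ≤ E := by
    have h1 : (1 : ℝ) ≤ 4 ^ β := one_le_pow₀ (by norm_num)
    have h2 : (1 : ℝ) ≤ 2 ^ (α + β) := one_le_pow₀ (by norm_num)
    have h3 : (1 : ℝ) ≤ 2 ^ α := one_le_pow₀ (by norm_num)
    exact one_le_mul_of_one_le_of_one_le (one_le_mul_of_one_le_of_one_le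
      (one_le_mul_of_one_le_of_one_le h1 hB1) h2) h3
  set δs : ℝ := (4 * E)⁻¹ with hδs
  have hδs0 : 0 < δs := by positivity
  have hδs1 : δs ≤ 1 := inv_le_one_of_one_le₀ (by linarith)
  have hEδ : E * δs = 1 / 4 := by
    rw [hδs]
    field_simp
  clear_value δs E B
  refine ⟨δs, hδs0, hδs1, fun δin hδin => ?_⟩
  obtain ⟨C, hC0, hC⟩ := card_lattice_le (ι := κ ⊕ τ) hδin
  set x₀ : ℝ := δin / (2 * α) with hx₀
  have hx₀pos : 0 < x₀ := by positivity
  set x₁ : ℝ := x₀ + C with hx₁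
  have hx₁pos : 0 < x₁ := by positivity
  set K₁ : ℝ := B * x₁ ^ (α + β) * (x₀ ^ β)⁻¹ with hK₁
  have hK₁pos : 0 < K₁ := by positivity
  refine ⟨⌈x₁ / δs⌉₊ + ⌈2 / δin⌉₊ + ⌈4 * 4 ^ β * K₁⌉₊ + 1, fun ρ hρ hρeven g hg hmin q hq => ?_⟩
  have hρR : x₁ / δs + 2 / δin + 4 * 4 ^ β * K₁ + 1 ≤ (ρ : ℝ) := by
    have h1 : ((⌈x₁ / δs⌉₊ + ⌈2 / δin⌉₊ + ⌈4 * 4 ^ β * K₁⌉₊ + 1 : ℕ) : ℝ) ≤ ρ := by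
      exact_mod_cast hρ
    push_cast at h1
    linarith [Nat.le_ceil (x₁ / δs), Nat.le_ceil (2 / δin), Nat.le_ceil (4 * 4 ^ β * K₁)]
  have hp1 : 0 < x₁ / δs := by positivity
  have hp2 : 0 < 2 / δin := by positivity
  have hp3 : 0 < 4 * 4 ^ β * K₁ := by positivity
  have hρ1 : (1 : ℝ) ≤ ρ := by linarith
  have hρpos : (0 : ℝ) < ρ := by linarith
  have hqR : (2 : ℝ) * q = (ρ : ℝ) ^ (α + β) := by exact_mod_cast hq
  have hqpos : (0 : ℝ) < q := by
    have : (0 : ℝ) < (ρ : ℝ) ^ (α + β) := by positivity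
    linarith
  have hq0 : 0 < q := by exact_mod_cast hqpos
  set r : ℝ := ((ρ : ℝ) ^ (α + β))⁻¹ with hr
  have hrpos : 0 < r := by positivity
  set Y : ℝ := δs * (ρ : ℝ) ^ β with hY
  have hYx₁ : x₁ ≤ Y := by
    have h1 : (ρ : ℝ) ≤ (ρ : ℝ) ^ β := le_self_pow₀ hρ1 (by omega)
    have h2 : x₁ / δs ≤ (ρ : ℝ) ^ β := by linarith
    rw [div_le_iff₀ hδs0] at h2
    linarith
  have hYpos : 0 < Y := by positivity
  set η : ℝ := δs * ((ρ : ℝ) ^ α)⁻¹ with hη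
  have hηpos : 0 < η := by positivity
  have hηin : η ≤ δin / 2 := by
    have h1 : (ρ : ℝ) ≤ (ρ : ℝ) ^ α := le_self_pow₀ hρ1 (by omega)
    have h2 : 2 / δin ≤ (ρ : ℝ) ^ α := by linarith
    have h3 : ((ρ : ℝ) ^ α)⁻¹ ≤ δin / 2 := by
      rw [inv_le_comm₀ (by positivity) (by positivity), inv_div]
      exact h2
    calc η ≤ 1 * ((ρ : ℝ) ^ α)⁻¹ := by rw [hη]; gcongr
      _ ≤ _ := by rw [one_mul]; exact h3
  set S : Set (κ ⊕ τ → ℤ) := {v | x₀ ≤ ‖gx g v‖ ∧ ‖gx g v‖ ≤ Y ∧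
    ‖g.mulVec (toR v)‖ ≤ 2 * α * ‖gx g v‖} with hS
  have hcard : Fintype.card (κ ⊕ τ) = α + β := by rw [Fintype.card_sum]
  have hcount : ∀ F' : Finset (κ ⊕ τ → ℤ), (∀ v ∈ F', v ∈ S) → ∀ T, x₁ ≤ T →
      (∀ v ∈ F', ‖gx g v‖ ≤ T) → (F'.card : ℝ) ≤ B * T ^ (α + β) := by
    intro F' hF' T hT hFT
    have h1 := hC g hg hmin (2 * α * T) (by nlinarith) F' (fun v hv =>
      (hF' v hv).2.2.trans (by have := hFT v hv; gcongr))
    rw [hcard] at h1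
    refine h1.trans (le_of_eq ?_)
    rw [hB, ← mul_pow]
    congr 1
    ring
  have hSfin : S.Finite := by
    by_contra hinf
    obtain ⟨F', hF', hF'c⟩ := Set.Infinite.exists_subset_card_eq hinf (⌈B * Y ^ (α + β)⌉₊ + 1)
    have h1 := hcount F' (fun v hv => hF' hv) Y hYx₁ (fun v hv => (hF' hv).2.1)
    rw [hF'c] at h1
    push_cast at h1
    linarith [Nat.le_ceil (B * Y ^ (α + β))]
  set V : Finset (κ ⊕ τ → ℤ) := hSfin.toFinset with hV
  have hVmem : ∀ v, v ∈ V ↔ v ∈ S := fun v => hSfin.mem_toFinset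
  have hsum : ∑ v ∈ V, (‖gx g v‖ ^ β)⁻¹ ≤ K₁ + B * 2 ^ (α + β) * (2 * Y) ^ α := by
    obtain ⟨J, hJ1, hJ2⟩ := exists_nat_pow_near (x := Y / x₁) (y := (2 : ℝ))
      ((one_le_div hx₁pos).2 hYx₁) one_lt_two
    rw [le_div_iff₀ hx₁pos] at hJ1
    rw [div_lt_iff₀ hx₁pos] at hJ2
    refine (sum_inv_pow_le hα1 hx₀pos hx₁pos hBpos.le (fun v => ‖gx g v‖) V
      (fun v hv => ((hVmem v).1 hv).1)
      (fun F' hF' => hcount F' fun v hv => (hVmem v).1 (hF' hv)) (J + 1) ?_).trans ?_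
    · intro v hv
      have := ((hVmem v).1 hv).2.1
      linarith
    · have h1 : x₁ * 2 ^ (J + 1) ≤ 2 * Y := by
        rw [pow_succ]
        linarith
      gcongr
  set bad : (κ ⊕ τ → ℤ) → Finset (τ → κ → Fin q) := fun v =>
    Finset.univ.filter fun t => ‖gy g v + lin (fun i => gridCenter r (t i)) (gx g v)‖ ≤ η with hbad
  have hbadcard : ∀ v ∈ V, ((bad v).card : ℝ)
      ≤ (q : ℝ) ^ (α * β) * ((4 * η) ^ β * (‖gx g v‖ ^ β)⁻¹) := by
    intro v hv
    obtain ⟨hv1, hv2, -⟩ := (hVmem v).1 hv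
    have hupos : 0 < ‖gx g v‖ := hx₀pos.trans_le hv1
    set A : τ → Finset (κ → Fin q) := fun i =>
      Finset.univ.filter fun t => |gy g v i + ∑ j, gridCenter r t j * gx g v j| ≤ η with hA
    have hsub : bad v ⊆ Fintype.piFinset A := by
      intro t ht
      rw [Fintype.mem_piFinset]
      intro i
      rw [hA, Finset.mem_filter]
      refine ⟨Finset.mem_univ _, ?_⟩
      exact (norm_le_pi_norm (gy g v + lin (fun i => gridCenter r (t i)) (gx g v)) i).trans
        (Finset.mem_filter.1 ht).2
    have hrow : ∀ i, ((A i).card : ℝ) ≤ (q : ℝ) ^ α * (4 * η / ‖gx g v‖) := by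
      intro i
      refine (card_row_le hrpos hηpos (gy g v i) hupos (A i)
        (fun t ht => (Finset.mem_filter.1 ht).2)).trans ?_
      have e1 : η / (2 * r * ‖gx g v‖) = Y / (2 * ‖gx g v‖) := by
        rw [hη, hr, hY, pow_add]
        field_simp
      have e2 : η * q * 2 = Y := by
        rw [mul_assoc, mul_comm (q : ℝ) 2, hqR, hη, hY, pow_add]
        field_simp
      have e3 : (1 : ℝ) ≤ Y / ‖gx g v‖ := (one_le_div hupos).2 hv2
      have e4 : (q : ℝ) ^ α = q ^ (α - 1) * q := by
        rw [← pow_succ]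
        congr 1
        omega
      rw [e1, e4, mul_assoc]
      gcongr
      rw [show (q : ℝ) * (4 * η / ‖gx g v‖) = 2 * (Y / ‖gx g v‖) by rw [← e2]; ring,
        show Y / (2 * ‖gx g v‖) = (Y / ‖gx g v‖) / 2 by field_simp]
      linarith
    calc ((bad v).card : ℝ) ≤ (Fintype.piFinset A).card := by
          exact_mod_cast Finset.card_le_card hsub
      _ = ∏ i, ((A i).card : ℝ) := by rw [Fintype.card_piFinset]; push_cast; rfl
      _ ≤ ∏ _i : τ, (q : ℝ) ^ α * (4 * η / ‖gx g v‖) :=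
          Finset.prod_le_prod (fun i _ => Nat.cast_nonneg _) fun i _ => hrow i
      _ = _ := by
          rw [Finset.prod_const, Finset.card_univ, ← hβ, mul_pow, div_pow, ← pow_mul,
            div_eq_mul_inv]
  have hfrac : (4 * η) ^ β * ∑ v ∈ V, (‖gx g v‖ ^ β)⁻¹ ≤ 1 / 2 := by
    have e1 : (4 * η) ^ β * (K₁ + B * 2 ^ (α + β) * (2 * Y) ^ α)
        = δs ^ β * (4 ^ β * K₁) * ((ρ : ℝ) ^ (α * β))⁻¹ + E * δs ^ (α + β) := by
      rw [hη, hY, hE, mul_pow, mul_pow, mul_pow, mul_pow, inv_pow, ← pow_mul, ← pow_mul,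
        mul_comm β α, pow_add δs]
      field_simp
    have e2 : δs ^ β ≤ 1 := pow_le_one₀ hδs0.le hδs1
    have e3 : δs ^ (α + β) ≤ δs := pow_le_of_le_one hδs0.le hδs1 (by omega)
    have e4 : (4 ^ β * K₁) * ((ρ : ℝ) ^ (α * β))⁻¹ ≤ 1 / 4 := by
      have : (ρ : ℝ) ≤ (ρ : ℝ) ^ (α * β) := le_self_pow₀ hρ1 (by positivity)
      rw [← div_eq_mul_inv, div_le_iff₀ (by positivity)]
      linarith
    have e5 : E * δs ^ (α + β) ≤ 1 / 4 := by
      calc E * δs ^ (α + β) ≤ E * δs := by gcongr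
        _ = 1 / 4 := hEδ
    have e6 : δs ^ β * (4 ^ β * K₁) * ((ρ : ℝ) ^ (α * β))⁻¹ ≤ 1 / 4 := by
      rw [mul_assoc]
      have : 0 ≤ (4 ^ β * K₁) * ((ρ : ℝ) ^ (α * β))⁻¹ := by positivity
      nlinarith
    calc _ ≤ (4 * η) ^ β * (K₁ + B * 2 ^ (α + β) * (2 * Y) ^ α) := by gcongr
      _ ≤ 1 / 2 := by rw [e1]; linarith
  refine ⟨(V.biUnion bad)ᶜ, ?_, ?_⟩
  · have h1 : ((V.biUnion bad).card : ℝ) ≤ (q : ℝ) ^ (α * β) * (1 / 2) := by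
      calc ((V.biUnion bad).card : ℝ) ≤ ∑ v ∈ V, ((bad v).card : ℝ) := by
            exact_mod_cast Finset.card_biUnion_le
        _ ≤ ∑ v ∈ V, (q : ℝ) ^ (α * β) * ((4 * η) ^ β * (‖gx g v‖ ^ β)⁻¹) :=
            Finset.sum_le_sum hbadcard
        _ = (q : ℝ) ^ (α * β) * ((4 * η) ^ β * ∑ v ∈ V, (‖gx g v‖ ^ β)⁻¹) := by
            rw [← Finset.mul_sum, ← Finset.mul_sum]
        _ ≤ _ := by gcongr
    have h2 : Fintype.card (τ → κ → Fin q) = q ^ (α * β) := by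
      rw [Fintype.card_fun, Fintype.card_fun, Fintype.card_fin, ← pow_mul]
    have h3 := Finset.card_compl (V.biUnion bad)
    have h4 : (V.biUnion bad).card ≤ Fintype.card (τ → κ → Fin q) := Finset.card_le_univ _
    rw [h2] at h3 h4
    have h5 : 2 * (V.biUnion bad).card ≤ q ^ (α * β) := by
      have : (2 : ℝ) * (V.biUnion bad).card ≤ (q : ℝ) ^ (α * β) := by linarith
      exact_mod_cast this
    omega
  · intro t ht v hv0
    by_contra hcon
    push Not at hcon
    obtain ⟨hc1, hc2⟩ := hcon
    refine Finset.mem_compl.1 ht (Finset.mem_biUnion.2 ⟨v, (hVmem v).2 ?_, ?_⟩)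
    · have hnorm : ‖fun i => gridCenter r (t i)‖ ≤ 1 :=
        (norm_gridCenter_le hq hq0 t).trans (by linarith)
      have h1 : ‖gy g v‖ ≤ α * ‖gx g v‖ + η := by
        have e1 : gy g v = (gy g v + lin (fun i => gridCenter r (t i)) (gx g v))
          - lin (fun i => gridCenter r (t i)) (gx g v) := by abel
        rw [e1]
        refine (norm_sub_le _ _).trans ?_
        have e2 := norm_lin_le (fun i => gridCenter r (t i)) (gx g v)
        have e3 : (α : ℝ) * ‖fun i => gridCenter r (t i)‖ * ‖gx g v‖ ≤ α * 1 * ‖gx g v‖ := by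
          gcongr
        rw [← hα] at e2
        linarith
      have hx0 : x₀ ≤ ‖gx g v‖ := by
        by_contra hlt
        push Not at hlt
        have e1 : α * ‖gx g v‖ < δin / 2 := by
          rw [hx₀, lt_div_iff₀ (by positivity)] at hlt
          linarith
        have e2 : ‖gx g v‖ ≤ α * ‖gx g v‖ := le_mul_of_one_le_left (norm_nonneg _) hα1R
        have e3 := hmin v hv0
        have e4 := norm_mulVec_le g v (R := max ‖gx g v‖ ‖gy g v‖) (le_max_left _ _)
          (le_max_right _ _)
        have e5 : max ‖gx g v‖ ‖gy g v‖ < δin := max_lt (by linarith) (by linarith)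
        linarith
      refine ⟨hx0, hc1.le, norm_mulVec_le g v ?_ ?_⟩
      · nlinarith [norm_nonneg (gx g v)]
      · have e1 : δin / 2 ≤ α * ‖gx g v‖ := by
          rw [hx₀, div_le_iff₀ (by positivity)] at hx0
          linarith
        linarith
    · rw [hbad, Finset.mem_filter]
      exact ⟨Finset.mem_univ _, hc2.le⟩

end Compat

section Act

variable {κ τ : Type*} [Fintype κ] [Fintype τ]

/-- The lattice `g` sheared by `c` and renormalised at scale `lam`. -/
noncomputable def act [DecidableEq κ] [DecidableEq τ] (lam : ℝ) (c : τ → κ → ℝ)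
    (g : Matrix (κ ⊕ τ) (κ ⊕ τ) ℝ) : Matrix (κ ⊕ τ) (κ ⊕ τ) ℝ :=
  Matrix.fromBlocks ((lam ^ Fintype.card τ)⁻¹ • 1) 0 (lam ^ Fintype.card κ • Matrix.of c)
    (lam ^ Fintype.card κ • 1) * g

theorem gx_act [DecidableEq κ] [DecidableEq τ] (lam : ℝ) (c : τ → κ → ℝ)
    (g : Matrix (κ ⊕ τ) (κ ⊕ τ) ℝ) (v : κ ⊕ τ → ℤ) :
    gx (act lam c g) v = (lam ^ Fintype.card τ)⁻¹ • gx g v := by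
  ext i
  rw [gx, act, ← Matrix.mulVec_mulVec]
  simp [Matrix.mulVec, dotProduct, Fintype.sum_sum_type, Matrix.one_apply, gx]

theorem gy_act [DecidableEq κ] [DecidableEq τ] (lam : ℝ) (c : τ → κ → ℝ)
    (g : Matrix (κ ⊕ τ) (κ ⊕ τ) ℝ) (v : κ ⊕ τ → ℤ) :
    gy (act lam c g) v = lam ^ Fintype.card κ • (gy g v + lin c (gx g v)) := by
  ext i
  have h1 : gy (act lam c g) v i = ∑ j, lam ^ Fintype.card κ * c i j * gx g v j
      + ∑ j, lam ^ Fintype.card κ * (1 : Matrix τ τ ℝ) i j * gy g v j := by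
    rw [gy, act, ← Matrix.mulVec_mulVec, Matrix.mulVec, dotProduct, Fintype.sum_sum_type]
    rfl
  rw [h1]
  simp only [Matrix.one_apply, mul_ite, mul_one, mul_zero, ite_mul, zero_mul, Finset.sum_ite_eq,
    Finset.mem_univ, if_true, Pi.smul_apply, Pi.add_apply, smul_eq_mul, lin, mul_add,
    Finset.mul_sum]
  rw [add_comm]
  congr 1
  exact Finset.sum_congr rfl fun j _ => mul_assoc _ _ _

theorem abs_det_act [DecidableEq κ] [DecidableEq τ] {lam : ℝ} (hlam : 0 < lam) (c : τ → κ → ℝ)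
    (g : Matrix (κ ⊕ τ) (κ ⊕ τ) ℝ) : |(act lam c g).det| = |g.det| := by
  rw [act, Matrix.det_mul, Matrix.det_fromBlocks_zero₁₂, Matrix.det_smul, Matrix.det_smul,
    Matrix.det_one, Matrix.det_one, mul_one, mul_one, inv_pow, ← pow_mul, ← pow_mul,
    mul_comm (Fintype.card τ), inv_mul_cancel₀ (by positivity), one_mul]

theorem cpt_act_iff [DecidableEq κ] [DecidableEq τ] {lam : ℝ} (hlam : 0 < lam) (c c' : τ → κ → ℝ)
    (g : Matrix (κ ⊕ τ) (κ ⊕ τ) ℝ) (ρ δ : ℝ) :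
    Cpt (act lam c g) c' ρ δ ↔
      Cpt g (c + (lam ^ (Fintype.card κ + Fintype.card τ))⁻¹ • c') (lam * ρ) δ := by
  refine forall_congr' fun v => imp_congr_right fun _ => or_congr ?_ ?_
  · rw [gx_act, norm_smul, Real.norm_of_nonneg (by positivity), mul_pow, inv_mul_eq_div,
      le_div_iff₀ (by positivity)]
    ring_nf
  · have h1 : gy (act lam c g) v + lin c' (gx (act lam c g) v) = lam ^ Fintype.card κ •
        (gy g v + lin (c + (lam ^ (Fintype.card κ + Fintype.card τ))⁻¹ • c') (gx g v)) := by
      rw [gy_act, gx_act, lin_smul, add_lin, smul_lin, smul_add, smul_add, smul_add, smul_smul,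
        add_assoc]
      congr 3
      rw [pow_add]
      field_simp
    rw [h1, norm_smul, Real.norm_of_nonneg (by positivity),
      show δ * ((lam * ρ) ^ Fintype.card κ)⁻¹
        = δ * (ρ ^ Fintype.card κ)⁻¹ / lam ^ Fintype.card κ by rw [mul_pow, mul_inv]; ring,
      div_le_iff₀ (by positivity), mul_comm (lam ^ Fintype.card κ)]

theorem Cpt.le_norm_act [DecidableEq κ] [DecidableEq τ] {lam δ : ℝ} (hlam : 0 < lam)
    {c : τ → κ → ℝ} {g : Matrix (κ ⊕ τ) (κ ⊕ τ) ℝ} (h : Cpt g c lam δ) (v : κ ⊕ τ → ℤ)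
    (hv : v ≠ 0) : δ ≤ ‖(act lam c g).mulVec (toR v)‖ := by
  rcases h v hv with h | h
  · refine le_trans ?_ (norm_gx_le _ _)
    rw [gx_act, norm_smul, Real.norm_of_nonneg (by positivity), inv_mul_eq_div,
      le_div_iff₀ (by positivity)]
    exact h
  · refine le_trans ?_ (norm_gy_le _ _)
    rw [gy_act, norm_smul, Real.norm_of_nonneg (by positivity)]
    rw [← div_eq_mul_inv, div_le_iff₀ (by positivity)] at h
    linarith

theorem Cpt.mono {g : Matrix (κ ⊕ τ) (κ ⊕ τ) ℝ} {c : τ → κ → ℝ} {lam δ δ' : ℝ} (hlam : 0 ≤ lam)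
    (h : Cpt g c lam δ) (hδ : δ' ≤ δ) : Cpt g c lam δ' := fun v hv =>
  (h v hv).imp (fun h => le_trans (by gcongr) h) fun h => le_trans (by gcongr) h

theorem Cpt.of_near {g : Matrix (κ ⊕ τ) (κ ⊕ τ) ℝ} {c ξ : τ → κ → ℝ} {lam δ : ℝ} (hlam : 0 < lam)
    (hδ : 0 < δ) (h : Cpt g c lam δ)
    (hξ : ‖ξ - c‖ ≤ (lam ^ (Fintype.card κ + Fintype.card τ))⁻¹) :
    Cpt g ξ lam (δ / (Fintype.card κ + 1)) := by
  set α : ℝ := (Fintype.card κ : ℝ) with hα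
  have hα0 : 0 ≤ α := Nat.cast_nonneg _
  intro v hv
  by_cases hx : δ / (α + 1) * lam ^ Fintype.card τ ≤ ‖gx g v‖
  · exact Or.inl hx
  right
  push Not at hx
  have hle : δ / (α + 1) ≤ δ := div_le_self hδ.le (by linarith)
  rcases h v hv with h | h
  · exfalso
    have : δ / (α + 1) * lam ^ Fintype.card τ ≤ δ * lam ^ Fintype.card τ := by gcongr
    linarith
  · have h1 : gy g v + lin c (gx g v) = gy g v + lin ξ (gx g v) - lin (ξ - c) (gx g v) := by
      rw [sub_lin]
      abel
    rw [h1] at h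
    have h2 := norm_sub_le (gy g v + lin ξ (gx g v)) (lin (ξ - c) (gx g v))
    have h3 := norm_lin_le (ξ - c) (gx g v)
    have h4 : (Fintype.card κ : ℝ) * ‖ξ - c‖ * ‖gx g v‖
        ≤ α * (lam ^ (Fintype.card κ + Fintype.card τ))⁻¹ * (δ / (α + 1) * lam ^ Fintype.card τ) := by
      gcongr
    have h5 : α * (lam ^ (Fintype.card κ + Fintype.card τ))⁻¹ * (δ / (α + 1) * lam ^ Fintype.card τ)
        = δ * (lam ^ Fintype.card κ)⁻¹ - δ / (α + 1) * (lam ^ Fintype.card κ)⁻¹ := by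
      rw [pow_add]
      field_simp
      ring
    linarith

theorem Cpt.scale {g : Matrix (κ ⊕ τ) (κ ⊕ τ) ℝ} {c : τ → κ → ℝ} {lam δ σ : ℝ} (hlam : 0 < lam)
    (hδ : 0 ≤ δ) (hσ : 1 ≤ σ) (h : Cpt g c lam δ) :
    Cpt g c (lam * σ) (δ * (σ ^ (Fintype.card κ + Fintype.card τ))⁻¹) := by
  have hσ0 : 0 < σ := by linarith
  have h1 : 1 ≤ σ ^ Fintype.card κ := one_le_pow₀ hσ
  have h2 : 1 ≤ σ ^ Fintype.card τ := one_le_pow₀ hσ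
  intro v hv
  refine (h v hv).imp (fun h => le_trans ?_ h) (fun h => le_trans ?_ h)
  · rw [mul_pow, pow_add]
    calc δ * (σ ^ Fintype.card κ * σ ^ Fintype.card τ)⁻¹ * (lam ^ Fintype.card τ * σ ^ Fintype.card τ)
        = δ * lam ^ Fintype.card τ * (σ ^ Fintype.card κ)⁻¹ := by field_simp
      _ ≤ δ * lam ^ Fintype.card τ * 1 := by gcongr; exact inv_le_one_of_one_le₀ h1
      _ = _ := mul_one _
  · rw [mul_pow, pow_add]
    have h3 : lam ^ Fintype.card κ ≤ lam ^ Fintype.card κ * σ ^ Fintype.card κ :=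
      le_mul_of_one_le_right (by positivity) h1
    have h4 : (σ ^ Fintype.card κ * σ ^ Fintype.card τ)⁻¹ ≤ 1 :=
      inv_le_one_of_one_le₀ (one_le_mul_of_one_le_of_one_le h1 h2)
    calc _ ≤ δ * 1 * (lam ^ Fintype.card κ)⁻¹ := by gcongr
      _ = _ := by rw [mul_one]

/-- The number `δs` is a level of compatibility that can be reached from any other level by many
grid refinements. -/
def RefinesTo (κ τ : Type*) [Fintype κ] [Fintype τ] [DecidableEq κ] [DecidableEq τ]
    (δs : ℝ) : Prop :=
  ∀ δin : ℝ, 0 < δin → ∃ ρ₀ : ℕ, ∀ ρ : ℕ, ρ₀ ≤ ρ → Even ρ →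
    ∀ g : Matrix (κ ⊕ τ) (κ ⊕ τ) ℝ, |g.det| = 1 → ∀ (c : τ → κ → ℝ) (lam : ℝ), 0 < lam →
    Cpt g c lam δin → ∀ q : ℕ, 2 * q = ρ ^ (Fintype.card κ + Fintype.card τ) →
    ∃ G : Finset (τ → κ → Fin q), q ^ (Fintype.card κ * Fintype.card τ) ≤ 2 * G.card ∧
      ∀ t ∈ G, Cpt g (c + (lam ^ (Fintype.card κ + Fintype.card τ))⁻¹ •
        (fun i => gridCenter (((ρ : ℝ) ^ (Fintype.card κ + Fintype.card τ))⁻¹) (t i)))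
        (lam * ρ) δs

theorem exists_refinesTo (κ τ : Type*) [Fintype κ] [Fintype τ] [DecidableEq κ]
    [DecidableEq τ] [Nonempty κ] [Nonempty τ] : ∃ δs : ℝ, 0 < δs ∧ δs ≤ 1 ∧ RefinesTo κ τ δs := by
  obtain ⟨δs, h0, h1, h⟩ := exists_many_compat κ τ
  refine ⟨δs, h0, h1, fun δin hδin => ?_⟩
  obtain ⟨ρ₀, hρ₀⟩ := h δin hδin
  refine ⟨ρ₀, fun ρ hρ hev g hg c lam hlam hc q hq => ?_⟩
  obtain ⟨G, hG, hG'⟩ := hρ₀ ρ hρ hev (act lam c g) (by rw [abs_det_act hlam, hg])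
    (fun v hv => hc.le_norm_act hlam v hv) q hq
  exact ⟨G, hG, fun t ht => (cpt_act_iff hlam c _ g ρ δs).1 (hG' t ht)⟩

theorem norm_gridCenter_sub_le {κ τ : Type*} [Fintype κ] [Fintype τ] {q ρ D : ℕ} {lam : ℝ}
    (hq : 2 * q = ρ ^ D) (hq0 : 0 < q) (hlam : 0 < lam) (c : τ → κ → ℝ) (t : τ → κ → Fin q) :
    ‖c + (lam ^ D)⁻¹ • (fun i => gridCenter ((ρ : ℝ) ^ D)⁻¹ (t i)) - c‖ ≤
      (lam ^ D)⁻¹ - 2 * ((lam * ρ) ^ D)⁻¹ := by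
  rw [add_sub_cancel_left, norm_smul, Real.norm_of_nonneg (by positivity)]
  refine (mul_le_mul_of_nonneg_left (norm_gridCenter_le hq hq0 t)
    (by positivity)).trans (le_of_eq ?_)
  rw [mul_pow, mul_inv]
  ring

/-- A single step: a lattice that is not too distorted at scale `lam` can be moved slightly so as
to satisfy a uniform bound at scale `lam * ρ`. -/
theorem RefinesTo.exists_step {κ τ : Type*} [Fintype κ] [Fintype τ] [DecidableEq κ]
    [DecidableEq τ] [Nonempty κ] {δs : ℝ} (h : RefinesTo κ τ δs) {δin : ℝ} (hδin : 0 < δin) :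
    ∃ ρ₀ : ℕ, ∀ ρ : ℕ, ρ₀ ≤ ρ → Even ρ →
      ∀ g : Matrix (κ ⊕ τ) (κ ⊕ τ) ℝ, |g.det| = 1 → ∀ (c : τ → κ → ℝ) (lam : ℝ), 0 < lam →
      Cpt g c lam δin → ∃ c' : τ → κ → ℝ, Cpt g c' (lam * ρ) δs ∧
        ‖c' - c‖ ≤ (lam ^ (Fintype.card κ + Fintype.card τ))⁻¹ -
          2 * ((lam * ρ) ^ (Fintype.card κ + Fintype.card τ))⁻¹ := by
  obtain ⟨ρ₀, hρ₀⟩ := h δin hδin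
  refine ⟨ρ₀ + 1, fun ρ hρ hev g hg c lam hlam hc => ?_⟩
  have hD : Fintype.card κ + Fintype.card τ ≠ 0 := by
    have := Fintype.card_pos (α := κ)
    omega
  obtain ⟨q, hq⟩ := hev.two_dvd.trans (dvd_pow_self ρ hD)
  have hq0 : 0 < q := by
    have : 0 < ρ ^ (Fintype.card κ + Fintype.card τ) := pow_pos (by omega) _
    omega
  obtain ⟨G, hG, hG'⟩ := hρ₀ ρ (by omega) hev g hg c lam hlam hc q hq.symm
  have hGpos : 0 < G.card := by
    have : 0 < q ^ (Fintype.card κ * Fintype.card τ) := pow_pos hq0 _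
    omega
  obtain ⟨t, ht⟩ := Finset.card_pos.1 hGpos
  exact ⟨_, hG' t ht, norm_gridCenter_sub_le hq.symm hq0 hlam c t⟩

end Act

section

open Topology

theorem exists_limit_of_nested {E : Type*} [MetricSpace E] [CompleteSpace E] {c : ℕ → E}
    {r : ℕ → ℝ} (hr : Filter.Tendsto r Filter.atTop (𝓝 0)) (hr0 : ∀ k, 0 ≤ r k)
    (h : ∀ k, dist (c (k + 1)) (c k) ≤ r k - r (k + 1)) : ∃ ξ, ∀ k, dist ξ (c k) ≤ r k := by
  have hd : ∀ k l, dist (c (k + l)) (c k) ≤ r k - r (k + l) := by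
    intro k l
    induction l with
    | zero => simp
    | succ l ih =>
      have := dist_triangle (c (k + (l + 1))) (c (k + l)) (c k)
      have h2 := h (k + l)
      rw [← add_assoc] at this ⊢
      linarith
  have hd' : ∀ k l, k ≤ l → dist (c l) (c k) ≤ r k - r l := by
    intro k l hkl
    obtain ⟨j, rfl⟩ := Nat.exists_eq_add_of_le hkl
    exact hd k j
  have hanti : ∀ k l, k ≤ l → r l ≤ r k := fun k l hkl => by
    linarith [hd' k l hkl, dist_nonneg (x := c l) (y := c k)]
  have hC : CauchySeq c := by
    refine cauchySeq_of_le_tendsto_0 r (fun n m N hn hm => ?_) hr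
    rcases le_total n m with hnm | hnm
    · rw [dist_comm]
      linarith [hd' n m hnm, hr0 m, hanti N n hn]
    · linarith [hd' m n hnm, hr0 n, hanti N m hm]
  obtain ⟨ξ, hξ⟩ := cauchySeq_tendsto_of_complete hC
  refine ⟨ξ, fun k => ?_⟩
  refine le_of_tendsto (hξ.dist tendsto_const_nhds) ?_
  filter_upwards [Filter.eventually_ge_atTop k] with l hl
  linarith [hd' k l hl, hr0 l]

theorem cpt_zero_one {κ τ : Type*} [Fintype κ] [Fintype τ] {g : Matrix (κ ⊕ τ) (κ ⊕ τ) ℝ} {δ : ℝ}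
    (h : ∀ v : κ ⊕ τ → ℤ, v ≠ 0 → δ ≤ ‖g.mulVec (toR v)‖) : Cpt g 0 1 δ := by
  intro v hv
  rw [zero_lin, add_zero, one_pow, one_pow, inv_one, mul_one]
  by_contra hcon
  push Not at hcon
  have h1 := norm_mulVec_le g v (R := max ‖gx g v‖ ‖gy g v‖) (le_max_left _ _) (le_max_right _ _)
  have h2 := max_lt hcon.1 hcon.2
  linarith [h v hv]

/-- Badly approximable perturbations exist, uniformly over lattices without short vectors. -/
theorem exists_badly_approximable (κ τ : Type*) [Fintype κ] [Fintype τ] [DecidableEq κ]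
    [DecidableEq τ] [Nonempty κ] [Nonempty τ] {δin η : ℝ} (hδin : 0 < δin) (hη : 0 < η) :
    ∃ δ' : ℝ, 0 < δ' ∧ ∀ g : Matrix (κ ⊕ τ) (κ ⊕ τ) ℝ, |g.det| = 1 →
      (∀ v : κ ⊕ τ → ℤ, v ≠ 0 → δin ≤ ‖g.mulVec (toR v)‖) →
      ∃ Ξ : τ → κ → ℝ, ‖Ξ‖ ≤ η ∧ ∀ lam : ℝ, 1 ≤ lam → Cpt g Ξ lam δ' := by
  obtain ⟨δs, hδs, -, hstep⟩ := exists_refinesTo κ τ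
  set α := Fintype.card κ with hα
  set D := Fintype.card κ + Fintype.card τ with hD
  have hD1 : 1 ≤ D := by
    have := Fintype.card_pos (α := κ)
    omega
  set L : ℝ := 1 + η⁻¹ with hL
  have hL1 : 1 ≤ L := by
    have := inv_pos.2 hη
    linarith
  have hLη : (L ^ D)⁻¹ ≤ η := by
    rw [inv_le_comm₀ (by positivity) hη]
    exact (by linarith : η⁻¹ ≤ L).trans (le_self_pow₀ hL1 (by omega))
  have hLD1 : (L ^ D)⁻¹ ≤ 1 := inv_le_one_of_one_le₀ (one_le_pow₀ hL1)
  set δm : ℝ := min (δin * (L ^ D)⁻¹) δs with hδm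
  have hδm0 : 0 < δm := lt_min (by positivity) hδs
  obtain ⟨ρ₀, hρ₀⟩ := hstep.exists_step hδm0
  set ρ : ℕ := 2 * (ρ₀ + 1) with hρ
  have hρ2 : (2 : ℝ) ≤ ρ := by
    rw [hρ]
    push_cast
    nlinarith [Nat.cast_nonneg (α := ℝ) ρ₀]
  refine ⟨min (δin / (α + 1) * (L ^ D)⁻¹) (δm / (α + 1) * ((ρ : ℝ) ^ D)⁻¹),
    lt_min (by positivity) (by positivity), fun g hg hmin => ?_⟩
  have hc1 : Cpt g 0 1 δin := cpt_zero_one hmin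
  have hc0 : Cpt g 0 L δm := by
    have := hc1.scale one_pos hδin.le hL1
    rw [one_mul] at this
    exact this.mono (by linarith) (min_le_left _ _)
  have hlampos : ∀ k : ℕ, 0 < L * (ρ : ℝ) ^ k := fun k => by positivity
  have hnext : ∀ (k : ℕ) (c : τ → κ → ℝ), Cpt g c (L * ρ ^ k) δm → ∃ c', Cpt g c' (L * ρ ^ (k + 1)) δm ∧
      ‖c' - c‖ ≤ ((L * (ρ : ℝ) ^ k) ^ D)⁻¹ - ((L * (ρ : ℝ) ^ (k + 1)) ^ D)⁻¹ := by
    intro k c hc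
    obtain ⟨c', h1, h2⟩ := hρ₀ ρ (by omega) ⟨ρ₀ + 1, by omega⟩ g hg c _ (hlampos k) hc
    rw [mul_assoc, ← pow_succ] at h1 h2
    refine ⟨c', h1.mono (hlampos _).le (min_le_right _ _), h2.trans ?_⟩
    have : 0 < ((L * (ρ : ℝ) ^ (k + 1)) ^ D)⁻¹ := by positivity
    linarith
  choose! F hF1 hF2 using hnext
  let c : ℕ → τ → κ → ℝ := fun k => Nat.rec 0 (fun k c => F k c) k
  have hcS : ∀ k, c (k + 1) = F k (c k) := fun _ => rfl
  have hc : ∀ k, Cpt g (c k) (L * ρ ^ k) δm := by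
    intro k
    induction k with
    | zero => simpa [c] using hc0
    | succ k ih => rw [hcS]; exact hF1 k _ ih
  have hrlim : Filter.Tendsto (fun k : ℕ => ((L * (ρ : ℝ) ^ k) ^ D)⁻¹) Filter.atTop (𝓝 0) := by
    have h1 : Filter.Tendsto (fun k : ℕ => (ρ : ℝ) ^ k) Filter.atTop Filter.atTop :=
      tendsto_pow_atTop_atTop_of_one_lt (by linarith)
    exact ((Filter.tendsto_pow_atTop (by omega)).comp
      (h1.const_mul_atTop (by linarith))).inv_tendsto_atTop
  obtain ⟨Ξ, hΞ⟩ := exists_limit_of_nested (c := c) hrlim (fun k => by positivity) (fun k => by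
    rw [dist_eq_norm, hcS]
    exact hF2 k _ (hc k))
  have hΞ0 : ‖Ξ‖ ≤ (L ^ D)⁻¹ := by
    have := hΞ 0
    rw [dist_eq_norm] at this
    simpa [c] using this
  refine ⟨Ξ, hΞ0.trans hLη, fun lam hlam => ?_⟩
  rcases le_total lam L with hle | hle
  · have h1 : Cpt g Ξ 1 (δin / (α + 1)) := hc1.of_near one_pos hδin (by
      rw [sub_zero, one_pow, inv_one]
      exact hΞ0.trans hLD1)
    have h2 := h1.scale one_pos (by positivity) hlam
    rw [one_mul] at h2
    refine h2.mono (by linarith) ((min_le_left _ _).trans ?_)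
    gcongr
  · obtain ⟨k, hk1, hk2⟩ := exists_nat_pow_near (x := lam / L) (y := (ρ : ℝ))
      ((one_le_div (by linarith)).2 hle) (by linarith)
    rw [le_div_iff₀ (by linarith)] at hk1
    rw [div_lt_iff₀ (by linarith)] at hk2
    have h1 : Cpt g Ξ (L * ρ ^ k) (δm / (α + 1)) := (hc k).of_near (hlampos k) hδm0 (by
      rw [← dist_eq_norm]
      exact hΞ k)
    have hσ1 : 1 ≤ lam / (L * ρ ^ k) := (one_le_div (hlampos k)).2 (by linarith)
    have hσ2 : lam / (L * ρ ^ k) ≤ ρ := by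
      rw [div_le_iff₀ (hlampos k)]
      rw [pow_succ] at hk2
      linarith
    have h2 := h1.scale (hlampos k) (by positivity) hσ1
    rw [mul_div_cancel₀ _ (hlampos k).ne'] at h2
    refine h2.mono (by linarith) ((min_le_right _ _).trans ?_)
    gcongr

end

/-- The value at the integer vector `(p, k)` of the linear forms `ζ p + k`. -/
noncomputable def formVal {K τ : Type*} [Fintype K] (ζ : τ → K → ℝ) (p : K → ℤ) (k : τ → ℤ) :
    τ → ℝ :=
  toR k + lin ζ (toR p)

theorem norm_formVal_sub_le {K τ : Type*} [Fintype K] [Fintype τ] (ζ ζ' : τ → K → ℝ) (p : K → ℤ)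
    (k : τ → ℤ) : ‖formVal ζ' p k - formVal ζ p k‖ ≤ Fintype.card K * ‖ζ' - ζ‖ * ‖toR p‖ := by
  have h : formVal ζ' p k - formVal ζ p k = lin (ζ' - ζ) (toR p) := by
    rw [sub_lin, formVal, formVal]
    abel
  rw [h]
  exact norm_lin_le _ _

/-- Arbitrarily short values of linear forms that nevertheless decrease steadily: there are forms
`ζ` without small values inside the box of size `(X, a)`, such that every small value of a form
close to `ζ` is improved upon by a factor `I` at the cost of a bounded factor in length. -/
def HasSteadyForms (K τ : Type*) [Fintype K] [Fintype τ] : Prop :=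
  ∀ I : ℝ, 1 ≤ I → ∃ M δ κ₀ : ℝ, 0 < M ∧ 0 < δ ∧ δ ≤ 1 ∧ 0 < κ₀ ∧ ∀ ε : ℝ, 0 < ε → ε < 1 →
    ∃ (ζ : τ → K → ℝ) (X a : ℝ), 1 ≤ X ∧ 0 < a ∧ a ≤ ε ∧
      X ^ Fintype.card K * a ^ Fintype.card τ = 1 ∧ ‖ζ‖ ≤ ε ∧
      (∀ (p : K → ℤ) (k : τ → ℤ), ¬(p = 0 ∧ k = 0) → δ * X ≤ ‖toR p‖ ∨ δ * a ≤ ‖formVal ζ p k‖) ∧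
      ∀ ζ' : τ → K → ℝ, ‖ζ' - ζ‖ ≤ κ₀ * (a / X) → ∀ (p : K → ℤ) (k : τ → ℤ), p ≠ 0 →
        ‖toR p‖ < δ * X → ∃ (p' : K → ℤ) (k' : τ → ℤ), ¬(p' = 0 ∧ k' = 0) ∧
          ‖toR p'‖ ≤ M * ‖toR p‖ ∧ I * ‖formVal ζ' p' k'‖ ≤ ‖formVal ζ' p k‖

section Step

variable {κ τ : Type*}

/-- The unimodular matrix sending `(p, k, q)` to `(p / X, (k + ζ (p, q)) / a, q / X)`. -/
noncomputable def stepMatrix [DecidableEq κ] [DecidableEq τ] (ζ : τ → κ ⊕ Unit → ℝ) (X a : ℝ) :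
    Matrix (κ ⊕ (τ ⊕ Unit)) (κ ⊕ (τ ⊕ Unit)) ℝ :=
  Matrix.fromBlocks (X⁻¹ • 1) 0
    (Matrix.of fun i j => Sum.elim (fun t => a⁻¹ * ζ t (Sum.inl j)) 0 i)
    (Matrix.fromBlocks (a⁻¹ • 1) (Matrix.of fun t _ => a⁻¹ * ζ t (Sum.inr ())) 0 (X⁻¹ • 1))

/-- The integer vector with components `p` and `k`, arranged for `stepMatrix`. -/
def stepVec (p : κ ⊕ Unit → ℤ) (k : τ → ℤ) : κ ⊕ (τ ⊕ Unit) → ℤ :=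
  Sum.elim (p ∘ Sum.inl) (Sum.elim k (p ∘ Sum.inr))

theorem stepVec_eq_zero {p : κ ⊕ Unit → ℤ} {k : τ → ℤ} (h : stepVec p k = 0) : p = 0 ∧ k = 0 := by
  constructor
  · ext (i | i)
    · exact congrFun h (Sum.inl i)
    · exact congrFun h (Sum.inr (Sum.inr i))
  · ext i
    exact congrFun h (Sum.inr (Sum.inl i))

theorem exists_eq_stepVec (v : κ ⊕ (τ ⊕ Unit) → ℤ) : ∃ p k, v = stepVec p k := by
  refine ⟨Sum.elim (v ∘ Sum.inl) (v ∘ Sum.inr ∘ Sum.inr), v ∘ Sum.inr ∘ Sum.inl, ?_⟩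
  ext (i | i | i) <;> rfl

variable [Fintype κ]

/-- The forms `ζ`, perturbed by the first rows of `Ξ`, and one new form, a small multiple of the
last row of `Ξ`. -/
noncomputable def stepForm (ζ : τ → κ ⊕ Unit → ℝ) (r s : ℝ) (Ξ : τ ⊕ Unit → κ → ℝ) :
    τ ⊕ Unit → κ ⊕ Unit → ℝ :=
  Sum.elim (fun t => ζ t + r • Sum.elim (Ξ (Sum.inl t)) 0)
    (fun u => s • Sum.elim (Ξ (Sum.inr u)) 1)

/-- The last, integrally perturbed, coordinate. -/
noncomputable def lastForm (Ξ : τ ⊕ Unit → κ → ℝ) (p : κ ⊕ Unit → ℤ) : ℝ :=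
  p (Sum.inr ()) + lin Ξ (toR p ∘ Sum.inl) (Sum.inr ())

theorem formVal_stepForm_inl (ζ : τ → κ ⊕ Unit → ℝ) (r s : ℝ) (Ξ : τ ⊕ Unit → κ → ℝ)
    (p : κ ⊕ Unit → ℤ) (k : τ ⊕ Unit → ℤ) (t : τ) :
    formVal (stepForm ζ r s Ξ) p k (Sum.inl t)
      = formVal ζ p (k ∘ Sum.inl) t + r * lin Ξ (toR p ∘ Sum.inl) (Sum.inl t) := by
  simp [formVal, stepForm, lin, toR, Fintype.sum_sum_type, add_mul, Finset.sum_add_distrib,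
    Finset.mul_sum, mul_assoc]
  ring

theorem formVal_stepForm_inr (ζ : τ → κ ⊕ Unit → ℝ) (r s : ℝ) (Ξ : τ ⊕ Unit → κ → ℝ)
    (p : κ ⊕ Unit → ℤ) (k : τ ⊕ Unit → ℤ) (u : Unit) :
    formVal (stepForm ζ r s Ξ) p k (Sum.inr u) = k (Sum.inr u) + s * lastForm Ξ p := by
  simp [formVal, stepForm, lastForm, lin, toR, Fintype.sum_sum_type, mul_add, Finset.mul_sum, mul_assoc]
  ring

variable [Fintype τ]

theorem abs_det_stepMatrix [DecidableEq κ] [DecidableEq τ] (ζ : τ → κ ⊕ Unit → ℝ) {X a : ℝ}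
    (hX : 0 < X) (ha : 0 < a)
    (h : X ^ Fintype.card (κ ⊕ Unit) * a ^ Fintype.card τ = 1) : |(stepMatrix ζ X a).det| = 1 := by
  rw [Fintype.card_sum, Fintype.card_unit, pow_succ] at h
  rw [stepMatrix, Matrix.det_fromBlocks_zero₁₂, Matrix.det_fromBlocks_zero₂₁, Matrix.det_smul,
    Matrix.det_smul, Matrix.det_smul, Matrix.det_one, Matrix.det_one, Matrix.det_one,
    Fintype.card_unit, abs_of_pos (by positivity)]
  refine Eq.trans ?_ ((congrArg Inv.inv h).trans inv_one)
  simp only [inv_pow, mul_inv, mul_one, pow_one]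
  ring

theorem gx_stepMatrix [DecidableEq κ] [DecidableEq τ] (ζ : τ → κ ⊕ Unit → ℝ) (X a : ℝ)
    (p : κ ⊕ Unit → ℤ) (k : τ → ℤ) :
    gx (stepMatrix ζ X a) (stepVec p k) = X⁻¹ • (toR p ∘ Sum.inl) := by
  ext i
  simp [gx, stepMatrix, stepVec, Matrix.mulVec, dotProduct, Fintype.sum_sum_type,
    Matrix.one_apply]

theorem gy_stepMatrix_inl [DecidableEq κ] [DecidableEq τ] (ζ : τ → κ ⊕ Unit → ℝ) (X a : ℝ)
    (p : κ ⊕ Unit → ℤ) (k : τ → ℤ) (t : τ) :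
    gy (stepMatrix ζ X a) (stepVec p k) (Sum.inl t) = a⁻¹ * formVal ζ p k t := by
  simp [gy, stepMatrix, stepVec, Matrix.mulVec, dotProduct, Fintype.sum_sum_type,
    Matrix.one_apply, formVal, lin, toR, mul_add, Finset.mul_sum, mul_assoc]
  ring

theorem gy_stepMatrix_inr [DecidableEq κ] [DecidableEq τ] (ζ : τ → κ ⊕ Unit → ℝ) (X a : ℝ)
    (p : κ ⊕ Unit → ℤ) (k : τ → ℤ) (u : Unit) :
    gy (stepMatrix ζ X a) (stepVec p k) (Sum.inr u) = X⁻¹ * p (Sum.inr u) := by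
  simp [gy, stepMatrix, stepVec, Matrix.mulVec, dotProduct, Fintype.sum_sum_type]

theorem gy_add_lin_stepMatrix_inl [DecidableEq κ] [DecidableEq τ] (ζ : τ → κ ⊕ Unit → ℝ) (X : ℝ)
    {a : ℝ} (ha : 0 < a) (s : ℝ) (Ξ : τ ⊕ Unit → κ → ℝ) (p : κ ⊕ Unit → ℤ) (k : τ ⊕ Unit → ℤ)
    (t : τ) :
    (gy (stepMatrix ζ X a) (stepVec p (k ∘ Sum.inl))
      + lin Ξ (gx (stepMatrix ζ X a) (stepVec p (k ∘ Sum.inl)))) (Sum.inl t)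
      = a⁻¹ * formVal (stepForm ζ (a / X) s Ξ) p k (Sum.inl t) := by
  rw [Pi.add_apply, gy_stepMatrix_inl, gx_stepMatrix, lin_smul, formVal_stepForm_inl,
    Pi.smul_apply, smul_eq_mul]
  field_simp

theorem gy_add_lin_stepMatrix_inr [DecidableEq κ] [DecidableEq τ] (ζ : τ → κ ⊕ Unit → ℝ) (X a : ℝ)
    (Ξ : τ ⊕ Unit → κ → ℝ) (p : κ ⊕ Unit → ℤ) (k : τ → ℤ) (u : Unit) :
    (gy (stepMatrix ζ X a) (stepVec p k)
      + lin Ξ (gx (stepMatrix ζ X a) (stepVec p k))) (Sum.inr u) = X⁻¹ * lastForm Ξ p := by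
  rw [Pi.add_apply, gy_stepMatrix_inr, gx_stepMatrix, lin_smul, lastForm, Pi.smul_apply,
    smul_eq_mul, mul_add]

theorem norm_toR_inl_le (p : κ ⊕ Unit → ℤ) : ‖toR p ∘ Sum.inl‖ ≤ ‖toR p‖ :=
  (pi_norm_le_iff_of_nonneg (norm_nonneg _)).2 fun i => norm_le_pi_norm (toR p) (Sum.inl i)

theorem abs_lin_le (Ξ : τ → κ → ℝ) (z : κ → ℝ) (i : τ) :
    |lin Ξ z i| ≤ Fintype.card κ * ‖Ξ‖ * ‖z‖ := by
  rw [← Real.norm_eq_abs]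
  exact (norm_le_pi_norm _ i).trans (norm_lin_le _ _)

theorem abs_lastForm_le {Ξ : τ ⊕ Unit → κ → ℝ} (hΞ : ‖Ξ‖ ≤ 1) (p : κ ⊕ Unit → ℤ) :
    |lastForm Ξ p| ≤ (Fintype.card κ + 1) * ‖toR p‖ := by
  have h1 : |((p (Sum.inr ()) : ℤ) : ℝ)| ≤ ‖toR p‖ := by
    rw [← Real.norm_eq_abs]
    exact norm_le_pi_norm (toR p) (Sum.inr ())
  have h2 := abs_lin_le Ξ (toR p ∘ Sum.inl) (Sum.inr ())
  have h3 : (Fintype.card κ : ℝ) * ‖Ξ‖ * ‖toR p ∘ Sum.inl‖ ≤ Fintype.card κ * 1 * ‖toR p‖ := by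
    gcongr
    exact norm_toR_inl_le p
  have h4 := abs_add_le ((p (Sum.inr ()) : ℤ) : ℝ) (lin Ξ (toR p ∘ Sum.inl) (Sum.inr ()))
  rw [lastForm]
  linarith

/-- Values of `stepForm` are bounded below. -/
theorem le_norm_formVal_stepForm [DecidableEq κ] [DecidableEq τ] {ζ : τ → κ ⊕ Unit → ℝ}
    {X a δ' lam σ : ℝ} {Ξ : τ ⊕ Unit → κ → ℝ} (hX : 0 < X) (ha : 0 < a) (ha1 : a ≤ 1)
    (hΞ : ‖Ξ‖ ≤ 1) (hlam : 1 ≤ lam) (hδ' : 0 < δ') (hδ1 : δ' ≤ 1) (hσ : 0 < σ) (hσ1 : σ ≤ 1 / 2)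
    (h : Cpt (stepMatrix ζ X a) Ξ lam δ') {p : κ ⊕ Unit → ℤ} {k : τ ⊕ Unit → ℤ}
    (hpk : ¬(p = 0 ∧ k = 0)) (hp : ‖toR p‖ < δ' * lam ^ Fintype.card (τ ⊕ Unit) * X)
    (hp2 : σ * (a / X) * ((Fintype.card κ + 1) * ‖toR p‖) ≤ 1 / 2) :
    σ * δ' * (a * (lam ^ Fintype.card κ)⁻¹) ≤ ‖formVal (stepForm ζ (a / X) (σ * (a / X)) Ξ) p k‖ := by
  have hlam0 : 0 < lam := by linarith
  have hinv : (lam ^ Fintype.card κ)⁻¹ ≤ 1 := inv_le_one_of_one_le₀ (one_le_pow₀ hlam)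
  have hinv0 : 0 < (lam ^ Fintype.card κ)⁻¹ := by positivity
  have hsmall : σ * δ' * (a * (lam ^ Fintype.card κ)⁻¹) ≤ 1 / 2 := by
    calc σ * δ' * (a * (lam ^ Fintype.card κ)⁻¹) ≤ 1 / 2 * 1 * (1 * 1) := by gcongr
      _ = 1 / 2 := by norm_num
  by_cases hku : k (Sum.inr ()) = 0
  · have hv : stepVec p (k ∘ Sum.inl) ≠ 0 := by
      intro h0
      obtain ⟨h1, h2⟩ := stepVec_eq_zero h0
      refine hpk ⟨h1, ?_⟩
      ext (i | i)
      · exact congrFun h2 i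
      · exact hku
    rcases h _ hv with h | h
    · exfalso
      rw [gx_stepMatrix, norm_smul, norm_inv, Real.norm_of_nonneg hX.le, inv_mul_eq_div,
        le_div_iff₀ hX] at h
      linarith [norm_toR_inl_le p]
    · by_contra hcon
      push Not at hcon
      rw [← not_lt] at h
      apply h
      refine (pi_norm_lt_iff (by positivity)).2 ?_
      rintro (t | u)
      · rw [gy_add_lin_stepMatrix_inl ζ X ha (σ * (a / X)), norm_mul, norm_inv,
          Real.norm_of_nonneg ha.le, inv_mul_lt_iff₀ ha]
        refine (norm_le_pi_norm _ _).trans_lt (hcon.trans_le ?_)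
        have : 0 < δ' * (a * (lam ^ Fintype.card κ)⁻¹) := by positivity
        nlinarith
      · rw [gy_add_lin_stepMatrix_inr, norm_mul, norm_inv, Real.norm_of_nonneg hX.le,
          inv_mul_lt_iff₀ hX]
        have h1 := (norm_le_pi_norm (formVal (stepForm ζ (a / X) (σ * (a / X)) Ξ) p k)
          (Sum.inr u)).trans_lt hcon
        rw [formVal_stepForm_inr, hku, Int.cast_zero, zero_add, norm_mul,
          Real.norm_of_nonneg (by positivity), ← lt_div_iff₀' (by positivity)] at h1
        refine h1.trans_eq ?_
        field_simp
  · refine hsmall.trans (le_trans ?_ (norm_le_pi_norm _ (Sum.inr ())))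
    rw [formVal_stepForm_inr, Real.norm_eq_abs]
    have h1 : (1 : ℝ) ≤ |((k (Sum.inr ()) : ℤ) : ℝ)| := by
      exact_mod_cast Int.one_le_abs hku
    have h2 : |σ * (a / X) * lastForm Ξ p| ≤ 1 / 2 := by
      rw [abs_mul, abs_of_pos (by positivity)]
      exact le_trans (by gcongr; exact abs_lastForm_le hΞ p) hp2
    have h3 := abs_sub_abs_le_abs_sub ((k (Sum.inr ()) : ℤ) : ℝ) (-(σ * (a / X) * lastForm Ξ p))
    rw [abs_neg, sub_neg_eq_add] at h3
    linarith

/-- Small values of `stepForm`, from Minkowski's theorem. -/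
theorem exists_formVal_stepForm_le [DecidableEq κ] [DecidableEq τ] {ζ : τ → κ ⊕ Unit → ℝ}
    {X a lam σ A B : ℝ} {Ξ : τ ⊕ Unit → κ → ℝ} (hX : 0 < X) (ha : 0 < a)
    (hdet : X ^ Fintype.card (κ ⊕ Unit) * a ^ Fintype.card τ = 1) (hΞ : ‖Ξ‖ ≤ 1) (hlam : 1 ≤ lam)
    (hσ : 0 < σ) (hσ1 : σ ≤ 1) (hA : 0 < A) (hB : 0 < B)
    (hAB : 1 < A ^ Fintype.card κ * B ^ Fintype.card (τ ⊕ Unit)) :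
    ∃ (p : κ ⊕ Unit → ℤ) (k : τ ⊕ Unit → ℤ), ¬(p = 0 ∧ k = 0) ∧
      ‖toR p‖ ≤ (A + B + Fintype.card κ * A) * (X * lam ^ Fintype.card (τ ⊕ Unit)) ∧
      ‖formVal (stepForm ζ (a / X) (σ * (a / X)) Ξ) p k‖ ≤ B * (a * (lam ^ Fintype.card κ)⁻¹) := by
  have hlam0 : 0 < lam := by linarith
  set G := act lam Ξ (stepMatrix ζ X a) with hG
  obtain ⟨v, hv0, hv⟩ := minkowski_box G
    (by rw [hG, abs_det_act hlam0, abs_det_stepMatrix ζ hX ha hdet]) (Sum.elim (fun _ => A) fun _ => B)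
    (by rintro (i | i) <;> simp [hA, hB])
    (by rw [Fintype.prod_sum_type]; simpa using hAB)
  obtain ⟨p, k, rfl⟩ := exists_eq_stepVec v
  have hk : k = Sum.elim k (fun _ : Unit => (0 : ℤ)) ∘ Sum.inl := rfl
  have hx : ∀ i, |((p (Sum.inl i) : ℤ) : ℝ)| ≤ A * (X * lam ^ Fintype.card (τ ⊕ Unit)) := by
    intro i
    have h1 : |gx G (stepVec p k) i| ≤ A := hv (Sum.inl i)
    rw [hG, gx_act, gx_stepMatrix] at h1
    simp only [Pi.smul_apply, smul_eq_mul, Function.comp_apply, toR] at h1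
    rwa [abs_mul, abs_mul, abs_of_pos (by positivity), abs_of_pos (by positivity), ← mul_assoc,
      ← mul_inv, inv_mul_le_iff₀ (by positivity), mul_comm, mul_comm _ X] at h1
  have hy : ∀ i, |(gy (stepMatrix ζ X a) (stepVec p k) + lin Ξ (gx (stepMatrix ζ X a) (stepVec p k))) i|
      ≤ B * (lam ^ Fintype.card κ)⁻¹ := by
    intro i
    have h1 : |gy G (stepVec p k) i| ≤ B := hv (Sum.inr i)
    rwa [hG, gy_act, Pi.smul_apply, smul_eq_mul, abs_mul, abs_of_pos (by positivity),
      ← le_div_iff₀' (by positivity), div_eq_mul_inv] at h1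
  have hz : |lastForm Ξ p| ≤ B * (X * (lam ^ Fintype.card κ)⁻¹) := by
    have h1 := hy (Sum.inr ())
    rw [gy_add_lin_stepMatrix_inr, abs_mul, abs_of_pos (by positivity), inv_mul_le_iff₀ hX] at h1
    linarith
  have hinv : (lam ^ Fintype.card κ)⁻¹ ≤ 1 := inv_le_one_of_one_le₀ (one_le_pow₀ hlam)
  have hinv0 : 0 < (lam ^ Fintype.card κ)⁻¹ := by positivity
  have hpow : 1 ≤ lam ^ Fintype.card (τ ⊕ Unit) := one_le_pow₀ hlam
  have hxn : ‖toR p ∘ Sum.inl‖ ≤ A * (X * lam ^ Fintype.card (τ ⊕ Unit)) :=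
    (pi_norm_le_iff_of_nonneg (by positivity)).2 fun i => hx i
  refine ⟨p, Sum.elim k (fun _ => 0), ?_, ?_, ?_⟩
  · rintro ⟨h1, h2⟩
    apply hv0
    have h3 : k = 0 := by
      rw [hk, h2]
      rfl
    rw [h1, h3]
    ext (i | i | i) <;> rfl
  · refine (pi_norm_le_iff_of_nonneg (by positivity)).2 ?_
    rintro (i | u)
    · refine (hx i).trans ?_
      gcongr
      have : 0 ≤ Fintype.card κ * A := by positivity
      linarith
    · have h1 := abs_lin_le Ξ (toR p ∘ Sum.inl) (Sum.inr ())
      have h2 : (Fintype.card κ : ℝ) * ‖Ξ‖ * ‖toR p ∘ Sum.inl‖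
          ≤ Fintype.card κ * 1 * (A * (X * lam ^ Fintype.card (τ ⊕ Unit))) := by gcongr
      have h3 := abs_sub (lastForm Ξ p) (lin Ξ (toR p ∘ Sum.inl) (Sum.inr ()))
      rw [lastForm, add_sub_cancel_right, ← lastForm] at h3
      have h4 : B * (X * (lam ^ Fintype.card κ)⁻¹) ≤ B * (X * lam ^ Fintype.card (τ ⊕ Unit)) := by
        gcongr
        exact hinv.trans hpow
      have h5 : 0 ≤ A * (X * lam ^ Fintype.card (τ ⊕ Unit)) := by positivity
      change |((p (Sum.inr ()) : ℤ) : ℝ)| ≤ _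
      linarith
  · refine (pi_norm_le_iff_of_nonneg (by positivity)).2 ?_
    rintro (t | u)
    · have h1 := hy (Sum.inl t)
      rw [hk, gy_add_lin_stepMatrix_inl ζ X ha (σ * (a / X)), abs_mul, abs_of_pos (by positivity),
        inv_mul_le_iff₀ ha] at h1
      rw [Real.norm_eq_abs]
      linarith
    · rw [formVal_stepForm_inr, Sum.elim_inr, Int.cast_zero, zero_add, norm_mul,
        Real.norm_of_nonneg (by positivity), Real.norm_eq_abs]
      calc σ * (a / X) * |lastForm Ξ p| ≤ 1 * (a / X) * (B * (X * (lam ^ Fintype.card κ)⁻¹)) := by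
            gcongr
        _ = _ := by field_simp

end Step

theorem exists_one_le_pow_eq {n : ℕ} (hn : n ≠ 0) {y : ℝ} (hy : 1 ≤ y) :
    ∃ lam : ℝ, 1 ≤ lam ∧ lam ^ n = y :=
  ⟨y ^ (n : ℝ)⁻¹, Real.one_le_rpow hy (by positivity), Real.rpow_inv_natCast_pow (by linarith) hn⟩

section

variable {κ τ : Type*} [Fintype κ] [Fintype τ]

/-- Short values of a family of forms with one additional form with small coefficients. -/
theorem exists_improvement_of_short {ζ : τ → κ ⊕ Unit → ℝ} {X a δ M κ₀ I η ς m : ℝ}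
    (hm : m = Fintype.card (κ ⊕ Unit)) (hX : 1 ≤ X)
    (ha : 0 < a) (ha1 : a ≤ 1) (hδ : 0 < δ) (hδ1 : δ ≤ 1) (hM : 1 ≤ M) (hI : 1 ≤ I)
    (hS : ∀ (p : κ ⊕ Unit → ℤ) (k : τ → ℤ), ¬(p = 0 ∧ k = 0) →
      δ * X ≤ ‖toR p‖ ∨ δ * a ≤ ‖formVal ζ p k‖)
    (hR : ∀ ζ' : τ → κ ⊕ Unit → ℝ, ‖ζ' - ζ‖ ≤ κ₀ * (a / X) → ∀ (p : κ ⊕ Unit → ℤ) (k : τ → ℤ),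
      p ≠ 0 → ‖toR p‖ < δ * X → ∃ (p' : κ ⊕ Unit → ℤ) (k' : τ → ℤ), ¬(p' = 0 ∧ k' = 0) ∧
        ‖toR p'‖ ≤ M * ‖toR p‖ ∧ I * ‖formVal ζ' p' k'‖ ≤ ‖formVal ζ' p k‖)
    (hη0 : 0 ≤ η) (hη : η ≤ κ₀) (hη1 : m * η ≤ 1 / 2) (hς : 0 ≤ ς) (hς1 : I * m * ς * M ≤ 1 / 2)
    {ξ : τ ⊕ Unit → κ ⊕ Unit → ℝ} (hξ1 : ‖(fun t => ξ (Sum.inl t)) - ζ‖ ≤ η * (a / X))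
    (hξ2 : ‖ξ (Sum.inr ())‖ ≤ ς * (a / X)) (hξ : I * m * ‖ξ‖ ≤ 1 / 2)
    {p : κ ⊕ Unit → ℤ} (k : τ ⊕ Unit → ℤ) (hp : p ≠ 0) (hpX : ‖toR p‖ < δ * X) :
    ∃ (p' : κ ⊕ Unit → ℤ) (k' : τ ⊕ Unit → ℤ), ¬(p' = 0 ∧ k' = 0) ∧
      ‖toR p'‖ ≤ M * ‖toR p‖ ∧ I * ‖formVal ξ p' k'‖ ≤ ‖formVal ξ p k‖ := by
  have hX0 : 0 < X := by linarith
  have hm0 : 0 ≤ m := by rw [hm]; positivity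
  have hlast : ∀ (q : κ ⊕ Unit → ℤ), |lin ξ (toR q) (Sum.inr ())| ≤ m * (ς * (a / X)) * ‖toR q‖ := by
    intro q
    have h1 := abs_lin_le (fun _ : Unit => ξ (Sum.inr ())) (toR q) ()
    rw [pi_norm_const] at h1
    refine le_trans h1 ?_
    rw [← hm]
    gcongr
  have hp1 := one_le_norm_toR hp
  by_cases hk : k (Sum.inr ()) = 0
  · obtain ⟨p', k', h0, h1, h2⟩ := hR (fun t => ξ (Sum.inl t)) (hξ1.trans (by gcongr)) p
      (k ∘ Sum.inl) hp hpX
    have hup : ‖formVal (fun t => ξ (Sum.inl t)) p (k ∘ Sum.inl)‖ ≤ ‖formVal ξ p k‖ :=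
      (pi_norm_le_iff_of_nonneg (norm_nonneg _)).2 fun t => norm_le_pi_norm (formVal ξ p k) (Sum.inl t)
    have hlow : δ * a / 2 ≤ ‖formVal ξ p k‖ := by
      have h3 := (hS p (k ∘ Sum.inl) (fun h => hp h.1)).resolve_left (not_le.2 hpX)
      have h4 := norm_formVal_sub_le ζ (fun t => ξ (Sum.inl t)) p (k ∘ Sum.inl)
      rw [← hm] at h4
      have h5 : m * ‖(fun t => ξ (Sum.inl t)) - ζ‖ * ‖toR p‖ ≤ m * (η * (a / X)) * (δ * X) := by
        gcongr
      have h6 : m * (η * (a / X)) * (δ * X) = (m * η) * (δ * a) := by field_simp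
      have h7 : (m * η) * (δ * a) ≤ 1 / 2 * (δ * a) := by gcongr
      have h8 := norm_sub_norm_le (formVal ζ p (k ∘ Sum.inl))
        (formVal (fun t => ξ (Sum.inl t)) p (k ∘ Sum.inl))
      rw [norm_sub_rev] at h8
      linarith
    refine ⟨p', Sum.elim k' 0, fun h => h0 ⟨h.1, ?_⟩, h1, ?_⟩
    · ext t
      exact congrFun h.2 (Sum.inl t)
    · rw [← le_div_iff₀' (by linarith)]
      refine (pi_norm_le_iff_of_nonneg (by positivity)).2 ?_
      rintro (t | u)
      · rw [le_div_iff₀' (by linarith)]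
        refine le_trans ?_ (h2.trans hup)
        gcongr
        exact norm_le_pi_norm (formVal (fun t => ξ (Sum.inl t)) p' k') t
      · rw [le_div_iff₀' (by linarith)]
        have h3 : formVal ξ p' (Sum.elim k' 0) (Sum.inr u) = lin ξ (toR p') (Sum.inr ()) := by
          simp [formVal, toR]
        rw [h3, Real.norm_eq_abs]
        refine le_trans ?_ hlow
        calc I * |lin ξ (toR p') (Sum.inr ())| ≤ I * (m * (ς * (a / X)) * (M * (δ * X))) := by
              gcongr
              refine (hlast p').trans ?_
              gcongr
              exact h1.trans (by gcongr)
          _ = I * m * ς * M * (δ * a) := by field_simp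
          _ ≤ 1 / 2 * (δ * a) := by gcongr
          _ = _ := by ring
  · refine ⟨Sum.elim 0 1, 0, fun h => ?_, ?_, ?_⟩
    · have := congrFun h.1 (Sum.inr ())
      simp at this
    · have h1 : ‖toR (Sum.elim 0 1 : κ ⊕ Unit → ℤ)‖ ≤ 1 := by
        refine (pi_norm_le_iff_of_nonneg zero_le_one).2 ?_
        rintro (i | i) <;> simp [toR]
      nlinarith
    · have h1 : ‖toR (Sum.elim 0 1 : κ ⊕ Unit → ℤ)‖ ≤ 1 := by
        refine (pi_norm_le_iff_of_nonneg zero_le_one).2 ?_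
        rintro (i | i) <;> simp [toR]
      have h2 : formVal ξ (Sum.elim 0 1) 0
          = lin ξ (toR (Sum.elim 0 1 : κ ⊕ Unit → ℤ)) := by
        ext i
        simp [formVal, toR]
      have h3 : I * ‖formVal ξ (Sum.elim 0 1) 0‖ ≤ 1 / 2 := by
        rw [h2]
        calc I * ‖lin ξ (toR (Sum.elim 0 1 : κ ⊕ Unit → ℤ))‖
            ≤ I * (m * ‖ξ‖ * 1) := by
              gcongr
              refine (norm_lin_le _ _).trans ?_
              rw [← hm]
              gcongr
          _ ≤ 1 / 2 := by linarith
      refine h3.trans (le_trans ?_ (norm_le_pi_norm _ (Sum.inr ())))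
      have h4 : (1 : ℝ) ≤ |((k (Sum.inr ()) : ℤ) : ℝ)| := by
        exact_mod_cast Int.one_le_abs hk
      have h5 : |lin ξ (toR p) (Sum.inr ())| ≤ 1 / 2 := by
        refine (hlast p).trans ?_
        calc m * (ς * (a / X)) * ‖toR p‖ ≤ m * (ς * (a / X)) * (δ * X) := by gcongr
          _ = 1 * m * ς * 1 * (δ * a) := by field_simp
          _ ≤ I * m * ς * M * (1 * 1) := by gcongr
          _ ≤ 1 / 2 := by linarith
      have h6 := abs_sub_abs_le_abs_sub ((k (Sum.inr ()) : ℤ) : ℝ) (-(lin ξ (toR p) (Sum.inr ())))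
      rw [abs_neg, sub_neg_eq_add] at h6
      rw [Real.norm_eq_abs]
      change _ ≤ |((k (Sum.inr ()) : ℤ) : ℝ) + lin ξ (toR p) (Sum.inr ())|
      linarith

set_option maxHeartbeats 1600000 in
theorem HasSteadyForms.step [Nonempty κ] (h : HasSteadyForms (κ ⊕ Unit) τ) :
    HasSteadyForms (κ ⊕ Unit) (τ ⊕ Unit) := by
  classical
  intro I hI
  obtain ⟨M₀, δ, κ₀, hM₀, hδ, hδ1, hκ₀, hold⟩ := h I hI
  set m : ℝ := (Fintype.card (κ ⊕ Unit) : ℝ) with hm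
  set α := Fintype.card κ with hα
  have hmα : m = α + 1 := by rw [hm, Fintype.card_sum, Fintype.card_unit]; push_cast; rfl
  have hα1 : 1 ≤ α := Fintype.card_pos
  have hm1 : 1 ≤ m := by rw [hmα]; linarith [Nat.cast_nonneg (α := ℝ) α]
  set β := Fintype.card (τ ⊕ Unit) with hβ
  have hβ1 : β = Fintype.card τ + 1 := by rw [hβ, Fintype.card_sum, Fintype.card_unit]
  set M : ℝ := max M₀ 1 with hM
  have hM1 : 1 ≤ M := le_max_right _ _
  set η : ℝ := min 1 (min (1 / (4 * m)) (κ₀ / 2)) with hη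
  have hη0 : 0 < η := by positivity
  have hη1 : η ≤ 1 := min_le_left _ _
  have hηm : η ≤ 1 / (4 * m) := (min_le_right _ _).trans (min_le_left _ _)
  have hηκ : η ≤ κ₀ / 2 := (min_le_right _ _).trans (min_le_right _ _)
  obtain ⟨δ'₀, hδ'₀, hbad⟩ := exists_badly_approximable κ (τ ⊕ Unit) hδ hη0
  set δ' : ℝ := min δ'₀ 1 with hδ'
  have hδ'0 : 0 < δ' := by positivity
  have hδ'1 : δ' ≤ 1 := min_le_right _ _
  set σ : ℝ := 1 / (4 * (I * m * M)) with hσ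
  have hσ0 : 0 < σ := by positivity
  have hσ1 : σ ≤ 1 / 4 := by
    rw [hσ]
    gcongr
    have : 1 * 1 * 1 ≤ I * m * M := by gcongr
    linarith
  have hσm : σ ≤ 1 / (4 * m) := by
    rw [hσ]
    gcongr
    have : 1 * m * 1 ≤ I * m * M := by gcongr
    linarith
  set δ₁ : ℝ := min δ δ' with hδ₁
  have hδ₁0 : 0 < δ₁ := by positivity
  set c₁ : ℝ := σ * δ' / 2 with hc₁
  have hc₁0 : 0 < c₁ := by positivity
  set B : ℝ := c₁ / (2 * I) with hB
  have hB0 : 0 < B := by positivity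
  set A : ℝ := (B ^ β)⁻¹ + 1 with hA
  have hA0 : 0 < A := by positivity
  have hA1 : 1 ≤ A := by
    have : 0 < (B ^ β)⁻¹ := by positivity
    linarith
  have hAB : 1 < A ^ α * B ^ β := by
    have h1 : A ≤ A ^ α := le_self_pow₀ hA1 (by omega)
    have h2 : 0 < B ^ β := by positivity
    calc 1 < 1 + B ^ β := by linarith
      _ = A * B ^ β := by rw [hA, add_mul, inv_mul_cancel₀ h2.ne', one_mul]
      _ ≤ A ^ α * B ^ β := by gcongr
  set A₂ : ℝ := A + B + α * A with hA₂
  have hA₂0 : 0 < A₂ := by positivity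
  set δ₂ : ℝ := min (σ * δ') (min (δ₁ / 2) (1 / (2 * m))) with hδ₂
  have hδ₂0 : 0 < δ₂ := by positivity
  have hδ₂a : δ₂ ≤ σ * δ' := min_le_left _ _
  have hδ₂b : δ₂ ≤ δ₁ / 2 := (min_le_right _ _).trans (min_le_left _ _)
  have hδ₂c : δ₂ ≤ 1 / (2 * m) := (min_le_right _ _).trans (min_le_right _ _)
  have hδ₂d : δ₂ ≤ δ' / 2 := hδ₂b.trans (by gcongr; exact min_le_right _ _)
  have hδ₂1 : δ₂ ≤ 1 := by linarith
  set κ₁ : ℝ := min σ (min (κ₀ / 2) (min (c₁ / m) (B / (m * A₂)))) with hκ₁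
  have hκ₁0 : 0 < κ₁ := by positivity
  have hκ₁a : κ₁ ≤ σ := min_le_left _ _
  have hκ₁b : κ₁ ≤ κ₀ / 2 := (min_le_right _ _).trans (min_le_left _ _)
  have hκ₁c : m * κ₁ ≤ c₁ := by
    rw [← le_div_iff₀' (by linarith)]
    exact (min_le_right _ _).trans ((min_le_right _ _).trans (min_le_left _ _))
  have hκ₁d : m * κ₁ * A₂ ≤ B := by
    have : κ₁ ≤ B / (m * A₂) :=
      (min_le_right _ _).trans ((min_le_right _ _).trans (min_le_right _ _))
    rw [le_div_iff₀ (by positivity)] at this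
    linarith
  refine ⟨max M (2 * A₂ / δ₁), δ₂, κ₁, lt_max_of_lt_left (by linarith), hδ₂0, hδ₂1, hκ₁0,
    fun ε hε hε1 => ?_⟩
  set ε₁ : ℝ := min (ε / 4) (1 / (8 * (I * m))) with hε₁
  have hε₁0 : 0 < ε₁ := by positivity
  have hε₁a : ε₁ ≤ ε / 4 := min_le_left _ _
  have hε₁b : I * m * ε₁ ≤ 1 / 8 := by
    have : ε₁ ≤ 1 / (8 * (I * m)) := min_le_right _ _
    rw [le_div_iff₀ (by positivity)] at this
    linarith
  obtain ⟨ζ, X, a, hX, ha, haε, hdet, hζ, hS, hR⟩ := hold ε₁ hε₁0 (by linarith)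
  have hX0 : 0 < X := by linarith
  have ha1 : a ≤ 1 := by linarith
  have haX : a / X ≤ a := div_le_self ha.le hX
  have haX0 : 0 < a / X := by positivity
  obtain ⟨Ξ, hΞη, hΞ₀⟩ := hbad (stepMatrix ζ X a) (abs_det_stepMatrix ζ hX0 ha hdet) (by
    intro v hv
    obtain ⟨p, k, rfl⟩ := exists_eq_stepVec v
    have hpk : ¬(p = 0 ∧ k = 0) := by
      rintro ⟨rfl, rfl⟩
      apply hv
      ext (i | i | i) <;> rfl
    set w := (stepMatrix ζ X a).mulVec (toR (stepVec p k)) with hw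
    by_contra hcon
    push Not at hcon
    rcases hS p k hpk with h | h
    · refine absurd h (not_le.2 ((pi_norm_lt_iff (by positivity)).2 ?_))
      rintro (i | i)
      · have h1 := (norm_gx_le (stepMatrix ζ X a) (stepVec p k)).trans_lt hcon
        have h2 := (norm_le_pi_norm _ i).trans_lt h1
        rwa [gx_stepMatrix, Pi.smul_apply, smul_eq_mul, norm_mul, norm_inv,
          Real.norm_of_nonneg hX0.le, inv_mul_lt_iff₀ hX0, mul_comm] at h2
      · have h1 := (norm_gy_le (stepMatrix ζ X a) (stepVec p k)).trans_lt hcon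
        have h2 := (norm_le_pi_norm _ (Sum.inr i)).trans_lt h1
        rwa [gy_stepMatrix_inr, norm_mul, norm_inv,
          Real.norm_of_nonneg hX0.le, inv_mul_lt_iff₀ hX0, mul_comm] at h2
    · refine absurd h (not_le.2 ((pi_norm_lt_iff (by positivity)).2 fun t => ?_))
      have h1 := (norm_gy_le (stepMatrix ζ X a) (stepVec p k)).trans_lt hcon
      have h2 := (norm_le_pi_norm _ (Sum.inl t)).trans_lt h1
      rwa [gy_stepMatrix_inl, norm_mul, norm_inv,
        Real.norm_of_nonneg ha.le, inv_mul_lt_iff₀ ha, mul_comm] at h2)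
  have hΞ : ∀ lam : ℝ, 1 ≤ lam → Cpt (stepMatrix ζ X a) Ξ lam δ' := fun lam hlam =>
    (hΞ₀ lam hlam).mono (by linarith) (min_le_left _ _)
  have hΞ1 : ‖Ξ‖ ≤ 1 := hΞη.trans hη1
  obtain ⟨lam₁, hlam₁, hlamβ⟩ := exists_one_le_pow_eq (n := β) (by omega)
    ((one_le_inv₀ ha).2 ha1)
  have hlam₁0 : 0 < lam₁ := by linarith
  set ζn := stepForm ζ (a / X) (σ * (a / X)) Ξ with hζn
  set a' : ℝ := a * (lam₁ ^ α)⁻¹ with ha'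
  have ha'0 : 0 < a' := by positivity
  have ha'a : a' ≤ a := mul_le_of_le_one_right ha.le (inv_le_one_of_one_le₀ (one_le_pow₀ hlam₁))
  have hX' : X * lam₁ ^ β = X / a := by rw [hlamβ, div_eq_mul_inv]
  have hX'1 : 1 ≤ X / a := by
    rw [← hX']
    exact one_le_mul_of_one_le_of_one_le hX (one_le_pow₀ hlam₁)
  have haX' : a' / (X / a) ≤ a / X := by
    rw [div_div_eq_mul_div]
    gcongr
    calc a' * a ≤ a * 1 := by gcongr
      _ = a := mul_one a
  have hrow1 : ∀ t, ‖ζn (Sum.inl t) - ζ t‖ ≤ η * (a / X) := by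
    intro t
    refine (pi_norm_le_iff_of_nonneg (by positivity)).2 ?_
    rintro (i | i)
    · simp only [hζn, stepForm, Sum.elim_inl, Pi.sub_apply, Pi.add_apply, Pi.smul_apply,
        smul_eq_mul, add_sub_cancel_left]
      rw [norm_mul, Real.norm_of_nonneg haX0.le, mul_comm]
      gcongr
      exact (norm_le_pi_norm _ i).trans ((norm_le_pi_norm Ξ _).trans hΞη)
    · simp only [hζn, stepForm, Sum.elim_inl, Pi.sub_apply, Pi.add_apply, Pi.smul_apply,
        smul_eq_mul, add_sub_cancel_left, Sum.elim_inr, Pi.zero_apply, mul_zero, norm_zero]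
      positivity
  have hrow2 : ‖ζn (Sum.inr ())‖ ≤ σ * (a / X) := by
    refine (pi_norm_le_iff_of_nonneg (by positivity)).2 ?_
    rintro (i | i)
    · simp only [hζn, stepForm, Sum.elim_inl, Sum.elim_inr, Pi.smul_apply, smul_eq_mul]
      rw [norm_mul, Real.norm_of_nonneg (by positivity)]
      exact mul_le_of_le_one_right (by positivity)
        ((norm_le_pi_norm _ i).trans ((norm_le_pi_norm Ξ _).trans hΞ1))
    · simp only [hζn, stepForm, Sum.elim_inr, Pi.smul_apply, smul_eq_mul, Pi.one_apply]
      rw [mul_one, Real.norm_of_nonneg (by positivity)]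
  have hζn2 : ‖ζn‖ ≤ 2 * ε₁ := by
    refine (pi_norm_le_iff_of_nonneg (by positivity)).2 ?_
    rintro (t | u)
    · have h1 := norm_le_pi_norm ζ t
      have h2 := norm_sub_norm_le (ζn (Sum.inl t)) (ζ t)
      have h3 : η * (a / X) ≤ 1 * ε₁ := by gcongr; linarith
      linarith [hrow1 t]
    · have h3 : σ * (a / X) ≤ 1 * ε₁ := by
        gcongr
        · linarith
        · linarith
      linarith [hrow2]
  refine ⟨ζn, X / a, a', hX'1, ha'0, by linarith, ?_, by linarith, ?_, ?_⟩
  · rw [← hX', ha', hβ1, mul_pow, mul_pow, ← pow_mul, inv_pow, ← pow_mul, ← hβ1, Fintype.card_sum,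
      Fintype.card_unit, ← hα]
    rw [Fintype.card_sum, Fintype.card_unit, ← hα] at hdet
    have h1 : lam₁ ^ (β * (α + 1)) = lam₁ ^ (α * β) * a⁻¹ := by
      rw [← hlamβ, ← pow_add]
      ring_nf
    rw [h1, hβ1, pow_succ]
    have h2 : 0 < lam₁ ^ (α * (Fintype.card τ + 1)) := by positivity
    field_simp
    linear_combination a * hdet
  · intro p k hpk
    by_contra! hcon
    obtain ⟨hcon1, hcon2⟩ := hcon
    have h1 := le_norm_formVal_stepForm hX0 ha ha1 hΞ1 hlam₁ hδ'0 hδ'1 hσ0 (by linarith)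
      (hΞ lam₁ hlam₁) hpk (by
        rw [← hβ, mul_assoc, mul_comm _ X, hX']
        refine hcon1.trans_le ?_
        gcongr
        linarith) (by
        calc σ * (a / X) * ((α + 1) * ‖toR p‖)
            ≤ 1 * (a / X) * ((α + 1) * (1 / (2 * m) * (X / a))) := by
              gcongr
              · linarith
              · exact hcon1.le.trans (by gcongr)
          _ = 1 / 2 := by
              rw [← hmα]
              field_simp)
    rw [← hα, ← ha'] at h1
    have h2 : δ₂ * a' ≤ σ * δ' * a' := by gcongr
    linarith
  · intro ξ hξ p k hp hpX
    have hdiff : ∀ (T : ℝ) (p : κ ⊕ Unit → ℤ) (k : τ ⊕ Unit → ℤ), ‖toR p‖ ≤ T * (X / a) →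
        ‖formVal ξ p k - formVal ζn p k‖ ≤ m * κ₁ * T * a' := by
      intro T p k hp
      refine (norm_formVal_sub_le ζn ξ p k).trans ?_
      rw [← hm]
      calc m * ‖ξ - ζn‖ * ‖toR p‖ ≤ m * (κ₁ * (a' / (X / a))) * (T * (X / a)) := by gcongr
        _ = _ := by field_simp
    have hξrow : ∀ i, ‖ξ i - ζn i‖ ≤ κ₁ * (a / X) := fun i =>
      (norm_le_pi_norm (ξ - ζn) i).trans (hξ.trans (by gcongr))
    rcases lt_or_ge ‖toR p‖ (δ * X) with hshort | hlong
    · obtain ⟨p', k', h1, h2, h3⟩ := exists_improvement_of_short hm hX ha ha1 hδ hδ1 hM1 hI hS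
        (fun ζ' hζ' p k hp hpX => by
          obtain ⟨p', k', h1, h2, h3⟩ := hR ζ' hζ' p k hp hpX
          exact ⟨p', k', h1, h2.trans (by gcongr; exact le_max_left _ _), h3⟩)
        (η := η + κ₁) (ς := σ + κ₁) (by positivity) (by linarith)
        (by
          have : m * (η + κ₁) ≤ m * (1 / (4 * m) + 1 / (4 * m)) := by gcongr; linarith
          refine this.trans_eq ?_
          field_simp
          norm_num)
        (by positivity)
        (by
          have : I * m * (σ + κ₁) * M ≤ I * m * (σ + σ) * M := by gcongr
          refine this.trans_eq ?_
          rw [hσ]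
          field_simp
          norm_num)
        (ξ := ξ)
        (by
          refine (pi_norm_le_iff_of_nonneg (by positivity)).2 fun t => ?_
          have h1 := norm_add_le (ξ (Sum.inl t) - ζn (Sum.inl t)) (ζn (Sum.inl t) - ζ t)
          rw [sub_add_sub_cancel] at h1
          refine h1.trans ?_
          linarith [hξrow (Sum.inl t), hrow1 t])
        (by
          have h1 := norm_sub_norm_le (ξ (Sum.inr ())) (ζn (Sum.inr ()))
          linarith [hξrow (Sum.inr ())])
        (by
          have h1 := norm_sub_norm_le ξ ζn
          have h2 : κ₁ * (a' / (X / a)) ≤ 1 * ε₁ := by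
            gcongr
            · linarith
            · linarith
          have h3 : ‖ξ‖ ≤ 3 * ε₁ := by linarith
          have h4 : I * m * ‖ξ‖ ≤ I * m * (3 * ε₁) := by gcongr
          linarith) k hp hshort
      exact ⟨p', k', h1, h2.trans (by gcongr; exact le_max_left _ _), h3⟩
    · have hδ₁X : 1 ≤ 2 * ‖toR p‖ / (δ₁ * X) := by
        rw [one_le_div (by positivity)]
        have : δ₁ * X ≤ δ * X := by gcongr; exact min_le_left _ _
        linarith [norm_nonneg (toR p)]
      obtain ⟨lam, hlam, hlamp⟩ := exists_one_le_pow_eq (n := β) (by omega) hδ₁X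
      have hXlam : X * lam ^ β = 2 * ‖toR p‖ / δ₁ := by
        rw [hlamp]
        field_simp
      have hlele : lam ^ β ≤ lam₁ ^ β := by
        rw [hlamp, hlamβ, div_le_iff₀ (by positivity)]
        have : δ₂ * (X / a) ≤ δ₁ / 2 * (X / a) := by gcongr
        calc 2 * ‖toR p‖ ≤ 2 * (δ₁ / 2 * (X / a)) := by linarith
          _ = _ := by field_simp
      have hle : lam ≤ lam₁ := (pow_le_pow_iff_left₀ (by linarith) (by linarith) (by omega)).1 hlele
      have haa : a' ≤ a * (lam ^ α)⁻¹ := by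
        rw [ha']
        gcongr
      have haa0 : 0 < a * (lam ^ α)⁻¹ := by positivity
      have hlow := le_norm_formVal_stepForm hX0 ha ha1 hΞ1 hlam hδ'0 hδ'1 hσ0 (by linarith)
        (hΞ lam hlam) (p := p) (k := k) (fun h => hp h.1) (by
          rw [← hβ, mul_assoc, mul_comm _ X, hXlam, ← mul_div_assoc, lt_div_iff₀ hδ₁0]
          have h1 : δ₁ ≤ δ' := min_le_right _ _
          have h2 : 0 < ‖toR p‖ := by linarith [one_le_norm_toR hp]
          nlinarith) (by
          calc σ * (a / X) * ((α + 1) * ‖toR p‖)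
              ≤ 1 * (a / X) * ((α + 1) * (1 / (2 * m) * (X / a))) := by
                gcongr
                · linarith
                · exact hpX.le.trans (by gcongr)
            _ = 1 / 2 := by
                rw [← hmα]
                field_simp)
      rw [← hα] at hlow
      have hlow2 : c₁ * (a * (lam ^ α)⁻¹) ≤ ‖formVal ξ p k‖ := by
        have h1 := hdiff δ₂ p k hpX.le
        have h2 : m * κ₁ * δ₂ * a' ≤ c₁ * 1 * (a * (lam ^ α)⁻¹) := by gcongr
        have h3 := norm_sub_norm_le (formVal ζn p k) (formVal ξ p k)
        rw [norm_sub_rev] at h3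
        have h4 : σ * δ' * (a * (lam ^ α)⁻¹) = 2 * c₁ * (a * (lam ^ α)⁻¹) := by rw [hc₁]; ring
        linarith
      obtain ⟨p', k', h0, h1, h2⟩ := exists_formVal_stepForm_le (Ξ := Ξ) hX0 ha hdet hΞ1 hlam hσ0
        (by linarith) hA0 hB0 hAB
      rw [← hβ, ← hα, ← hA₂] at h1
      rw [← hα, ← hζn] at h2
      refine ⟨p', k', h0, ?_, ?_⟩
      · refine h1.trans ?_
        rw [hXlam]
        calc A₂ * (2 * ‖toR p‖ / δ₁) = 2 * A₂ / δ₁ * ‖toR p‖ := by ring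
          _ ≤ _ := by gcongr; exact le_max_right _ _
      · have h3 := hdiff A₂ p' k' (h1.trans (by rw [← hX']; gcongr))
        have h4 : m * κ₁ * A₂ * a' ≤ B * (a * (lam ^ α)⁻¹) := by gcongr
        have h5 := norm_sub_norm_le (formVal ξ p' k') (formVal ζn p' k')
        have h6 : ‖formVal ξ p' k'‖ ≤ 2 * B * (a * (lam ^ α)⁻¹) := by linarith
        refine le_trans ?_ hlow2
        calc I * ‖formVal ξ p' k'‖ ≤ I * (2 * B * (a * (lam ^ α)⁻¹)) := by gcongr
          _ = c₁ * (a * (lam ^ α)⁻¹) := by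
            rw [hB]
            field_simp

end

section

variable {K K' τ τ' : Type*} [Fintype K] [Fintype K'] [Fintype τ] [Fintype τ']

theorem norm_comp_equiv {E : Type*} [SeminormedAddCommGroup E] (e : K' ≃ K) (f : K → E) :
    ‖f ∘ e‖ = ‖f‖ := by
  refine le_antisymm ((pi_norm_le_iff_of_nonneg (norm_nonneg _)).2 fun i => norm_le_pi_norm f _)
    ((pi_norm_le_iff_of_nonneg (norm_nonneg _)).2 fun i => ?_)
  simpa using norm_le_pi_norm (f ∘ e) (e.symm i)

theorem formVal_comp_equiv (eK : K' ≃ K) (eτ : τ' ≃ τ) (ζ : τ → K → ℝ) (p : K → ℤ) (k : τ → ℤ) :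
    formVal (fun i j => ζ (eτ i) (eK j)) (p ∘ eK) (k ∘ eτ) = formVal ζ p k ∘ eτ := by
  ext i
  change (k (eτ i) : ℝ) + ∑ j, ζ (eτ i) (eK j) * (p (eK j) : ℝ) =
    (k (eτ i) : ℝ) + ∑ j, ζ (eτ i) j * (p j : ℝ)
  rw [Equiv.sum_comp eK fun j => ζ (eτ i) j * (p j : ℝ)]

theorem norm_reindex (eK : K' ≃ K) (eτ : τ' ≃ τ) (ζ : τ → K → ℝ) :
    ‖fun i j => ζ (eτ i) (eK j)‖ = ‖ζ‖ := by
  rw [← norm_comp_equiv eτ ζ]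
  simp only [Pi.norm_def]
  congr 2
  ext i
  exact congrArg _ (Subtype.ext (norm_comp_equiv eK (ζ (eτ i))))

theorem HasSteadyForms.of_equiv (h : HasSteadyForms K τ) (eK : K' ≃ K) (eτ : τ' ≃ τ) :
    HasSteadyForms K' τ' := by
  intro I hI
  obtain ⟨M, δ, κ₀, hM, hδ, hδ1, hκ₀, hold⟩ := h I hI
  refine ⟨M, δ, κ₀, hM, hδ, hδ1, hκ₀, fun ε hε hε1 => ?_⟩
  obtain ⟨ζ, X, a, hX, ha, haε, hdet, hζ, hS, hR⟩ := hold ε hε hε1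
  have hp (p : K' → ℤ) : ‖toR (p ∘ eK.symm)‖ = ‖toR p‖ := norm_comp_equiv eK.symm (toR p)
  have hf (ζ' : τ' → K' → ℝ) (p : K' → ℤ) (k : τ' → ℤ) :
      ‖formVal (fun i j => ζ' (eτ.symm i) (eK.symm j)) (p ∘ eK.symm) (k ∘ eτ.symm)‖ =
        ‖formVal ζ' p k‖ := by
    rw [formVal_comp_equiv]
    exact norm_comp_equiv eτ.symm _
  have h0 (p : K' → ℤ) : p ∘ eK.symm = 0 ↔ p = 0 := by
    refine ⟨fun h => ?_, fun h => by rw [h]; rfl⟩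
    ext i
    simpa using congrFun h (eK i)
  have h0' (k : τ' → ℤ) : k ∘ eτ.symm = 0 ↔ k = 0 := by
    refine ⟨fun h => ?_, fun h => by rw [h]; rfl⟩
    ext i
    simpa using congrFun h (eτ i)
  refine ⟨fun i j => ζ (eτ i) (eK j), X, a, hX, ha, haε, ?_, ?_, ?_, ?_⟩
  · rwa [Fintype.card_congr eK, Fintype.card_congr eτ]
  · rwa [norm_reindex]
  · intro p k hpk
    have h1 := hS (p ∘ eK.symm) (k ∘ eτ.symm) (by rwa [h0, h0'])
    rw [hp] at h1
    have h2 := hf (fun i j => ζ (eτ i) (eK j)) p k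
    simp only [Equiv.apply_symm_apply] at h2
    rwa [h2] at h1
  · intro ζ' hζ' p k hp0 hpX
    obtain ⟨p', k', h1, h2, h3⟩ := hR (fun i j => ζ' (eτ.symm i) (eK.symm j)) (by
      refine le_of_eq_of_le ?_ hζ'
      rw [← norm_reindex eK eτ]
      congr 1
      ext i j
      simp) (p ∘ eK.symm) (k ∘ eτ.symm) (by rwa [Ne, h0]) (by rwa [hp])
    have hp' : (p' ∘ eK) ∘ eK.symm = p' := by ext; simp
    have hk' : (k' ∘ eτ) ∘ eτ.symm = k' := by ext; simp
    refine ⟨p' ∘ eK, k' ∘ eτ, ?_, ?_, ?_⟩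
    · rwa [← h0, ← h0', hp', hk']
    · rwa [← hp, ← hp p, hp']
    · rwa [← hf, ← hf _ p, hp', hk']

theorem HasSteadyForms.of_isEmpty [IsEmpty τ] : HasSteadyForms K τ := by
  intro I hI
  refine ⟨1, 1, 1, one_pos, one_pos, le_rfl, one_pos, fun ε hε hε1 => ?_⟩
  refine ⟨0, 1, ε, le_rfl, hε, le_rfl, by simp, by simpa using hε.le, fun p k hpk => ?_,
    fun ζ' _ p k hp0 hp => ?_⟩
  · rw [Subsingleton.elim k 0] at hpk
    left
    rw [one_mul]
    exact one_le_norm_toR fun h => hpk ⟨h, rfl⟩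
  · rw [one_mul] at hp
    exact absurd (one_le_norm_toR hp0) (not_le.2 hp)

end

theorem hasSteadyForms {K : Type*} [Fintype K] (hK : 2 ≤ Fintype.card K) (n : ℕ) :
    HasSteadyForms K (Fin n) := by
  obtain ⟨m, hm⟩ := Nat.exists_eq_add_of_le' hK
  have : HasSteadyForms (Fin (m + 1) ⊕ Unit) (Fin n) := by
    induction n with
    | zero => exact HasSteadyForms.of_isEmpty
    | succ n ih =>
      exact ih.step.of_equiv (Equiv.refl _)
        ((finSuccEquivLast).trans (Equiv.optionEquivSumPUnit _))
  refine this.of_equiv ?_ (Equiv.refl _)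
  exact Fintype.equivOfCardEq (by simp [hm])

section NearScalar

variable {ι : Type*} [DecidableEq ι]

/-- A matrix within `e` of `N` times the identity, entrywise. -/
def NearScalar (N e : ℝ) (A : Matrix ι ι ℝ) : Prop :=
  ∀ i j, |A i j - N * (1 : Matrix ι ι ℝ) i j| ≤ e

theorem NearScalar.abs_le {N e : ℝ} {A : Matrix ι ι ℝ} (h : NearScalar N e A)
    (hN : 0 ≤ N) (i j : ι) : |A i j| ≤ N + e := by
  have h1 : |N * (1 : Matrix ι ι ℝ) i j| ≤ N := by
    rw [Matrix.one_apply]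
    split_ifs <;> simp [abs_of_nonneg hN, hN]
  have h2 := abs_add_le (A i j - N * (1 : Matrix ι ι ℝ) i j) (N * (1 : Matrix ι ι ℝ) i j)
  rw [sub_add_cancel] at h2
  linarith [h i j]

theorem NearScalar.add_of_abs_le {N e e' e'' : ℝ} {A B : Matrix ι ι ℝ} (h : NearScalar N e A)
    (hB : ∀ i j, |B i j| ≤ e') (he : e + e' ≤ e'') : NearScalar N e'' (A + B) := fun i j => by
  have h1 := abs_add_le (A i j - N * (1 : Matrix ι ι ℝ) i j) (B i j)
  rw [Matrix.add_apply, add_sub_right_comm]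
  linarith [h i j, hB i j]

theorem NearScalar.transpose {N e : ℝ} {A : Matrix ι ι ℝ} (h : NearScalar N e A) :
    NearScalar N e A.transpose := fun i j => by
  simpa [Matrix.one_apply, eq_comm] using h j i

variable [Fintype ι]

theorem NearScalar.norm_mulVec_sub_le {N e : ℝ} {A : Matrix ι ι ℝ} (h : NearScalar N e A)
    (he : 0 ≤ e) (v : ι → ℝ) : ‖A.mulVec v - N • v‖ ≤ Fintype.card ι * e * ‖v‖ := by
  have h1 : A.mulVec v - N • v = lin (fun i j => A i j - N * (1 : Matrix ι ι ℝ) i j) v := by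
    ext i
    simp [lin, Matrix.mulVec, dotProduct, sub_mul, Finset.sum_sub_distrib, Matrix.one_apply]
  rw [h1]
  refine (norm_lin_le _ _).trans ?_
  gcongr
  refine (pi_norm_le_iff_of_nonneg he).2 fun i => (pi_norm_le_iff_of_nonneg he).2 fun j => h i j

theorem NearScalar.norm_mulVec_le {N e : ℝ} {A : Matrix ι ι ℝ} (h : NearScalar N e A)
    (hN : 0 ≤ N) (he : 0 ≤ e) (heN : 2 * (Fintype.card ι * e) ≤ N) (v : ι → ℝ) :
    ‖A.mulVec v‖ ≤ 2 * N * ‖v‖ := by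
  have h1 := h.norm_mulVec_sub_le he v
  have h2 : ‖A.mulVec v‖ ≤ ‖A.mulVec v - N • v‖ + ‖N • v‖ := by
    simpa using norm_add_le (A.mulVec v - N • v) (N • v)
  rw [norm_smul, Real.norm_of_nonneg hN] at h2
  nlinarith [norm_nonneg v, mul_le_mul_of_nonneg_right heN (norm_nonneg v),
    mul_nonneg hN (norm_nonneg v)]

theorem NearScalar.le_norm_mulVec {N e : ℝ} {A : Matrix ι ι ℝ} (h : NearScalar N e A)
    (hN : 0 ≤ N) (he : 0 ≤ e) (heN : 2 * (Fintype.card ι * e) ≤ N) (v : ι → ℝ) :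
    N * ‖v‖ ≤ 2 * ‖A.mulVec v‖ := by
  have h1 := h.norm_mulVec_sub_le he v
  have h2 : ‖N • v‖ ≤ ‖A.mulVec v‖ + ‖A.mulVec v - N • v‖ := by
    simpa using norm_sub_le (A.mulVec v) (A.mulVec v - N • v)
  rw [norm_smul, Real.norm_of_nonneg hN] at h2
  nlinarith [norm_nonneg v, mul_le_mul_of_nonneg_right heN (norm_nonneg v)]

theorem NearScalar.isUnit_det {N e : ℝ} {A : Matrix ι ι ℝ} (h : NearScalar N e A)
    (hN : 0 < N) (he : 0 ≤ e) (heN : 2 * (Fintype.card ι * e) ≤ N) : IsUnit A.det := by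
  rw [isUnit_iff_ne_zero]
  intro h0
  obtain ⟨v, hv, hv0⟩ := Matrix.exists_mulVec_eq_zero_iff.2 h0
  have h1 := h.le_norm_mulVec hN.le he heN v
  rw [hv0, norm_zero, mul_zero] at h1
  have := mul_pos hN (norm_pos_iff.2 hv)
  linarith

end NearScalar

theorem abs_apply_le_norm {τ κ : Type*} [Fintype κ] [Fintype τ] (Ξ : τ → κ → ℝ) (i : τ) (j : κ) :
    |Ξ i j| ≤ ‖Ξ‖ :=
  (norm_le_pi_norm (Ξ i) j).trans (norm_le_pi_norm Ξ i)

theorem abs_sum_mul_le {κ : Type*} [Fintype κ] {f g : κ → ℝ} {A B : ℝ} (hf : ∀ i, |f i| ≤ A) (hg : ∀ i, |g i| ≤ B) :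
    |∑ i, f i * g i| ≤ Fintype.card κ * (A * B) := by
  refine (Finset.abs_sum_le_sum_abs _ _).trans ?_
  refine (Finset.sum_le_card_nsmul _ _ (A * B) fun i _ => ?_).trans ?_
  · rw [abs_mul]
    have := (abs_nonneg _).trans (hf i)
    gcongr
    · exact hf i
    · exact hg i
  · simp

section Frame

variable {κ τ : Type*} [Fintype κ] [Fintype τ]

/-- The integer vectors close to the multiples `N eᵢ` of the standard basis in a lattice `g` form
a matrix of bounded index. -/
theorem exists_nearScalar_mul {ι : Type*} [Fintype ι] [DecidableEq ι] {g : Matrix ι ι ℝ} {r N : ℝ}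
    (hg : |g.det| = 1) (hr : ∀ z : ι → ℝ, ∃ v : ι → ℤ, ‖g.mulVec (toR v) - z‖ ≤ r) (hr0 : 0 ≤ r)
    (hN : 0 < N) (hrN : 2 * (Fintype.card ι * r) ≤ N) :
    ∃ Γ : Matrix ι ι ℤ, NearScalar N r (g * Γ.map (Int.cast : ℤ → ℝ)) ∧ Γ.det ≠ 0 ∧
      |(Γ.det : ℝ)| ≤ (Fintype.card ι).factorial • (N + r) ^ Fintype.card ι := by
  choose γ hγ using fun j => hr (N • Pi.single j 1)
  have hG : NearScalar N r (g * (Matrix.of fun i j => γ j i).map (Int.cast : ℤ → ℝ)) := by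
    intro i j
    have h1 := (norm_le_pi_norm _ i).trans (hγ j)
    rw [Real.norm_eq_abs] at h1
    rw [Pi.sub_apply, Pi.smul_apply, smul_eq_mul, Pi.single_apply, ← Matrix.one_apply] at h1
    exact h1
  have hdet : |(g * (Matrix.of fun i j => γ j i).map (Int.cast : ℤ → ℝ)).det| =
      |((Matrix.of fun i j => γ j i).det : ℝ)| := by
    rw [Matrix.det_mul, abs_mul, hg, one_mul, Int.cast_det]
  refine ⟨_, hG, fun h0 => ?_, ?_⟩
  · rw [h0, Int.cast_zero, abs_zero, abs_eq_zero] at hdet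
    exact (hG.isUnit_det hN hr0 hrN).ne_zero hdet
  · rw [← hdet]
    exact Matrix.det_le (abv := AbsoluteValue.abs) fun i j => hG.abs_le hN.le i j

theorem mulVec_toR {ι : Type*} [Fintype ι] (Γ : Matrix ι ι ℤ) (q : ι → ℤ) :
    toR (Γ.mulVec q) = (Γ.map (Int.cast : ℤ → ℝ)).mulVec (toR q) := by
  ext i
  simp [toR, Matrix.mulVec, dotProduct]

theorem exists_mulVec_eq_det_smul {ι : Type*} [Fintype ι] [DecidableEq ι] (Γ : Matrix ι ι ℤ)
    (v : ι → ℤ) : ∃ q, Γ.mulVec q = Γ.det • v := by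
  refine ⟨Γ.adjugate.mulVec v, ?_⟩
  rw [Matrix.mulVec_mulVec, Matrix.mul_adjugate, Matrix.smul_mulVec, Matrix.one_mulVec]

/-- The algebra of the change of coordinates: the combination of columns of a block matrix with
coefficients `(p, k)` in terms of `p` and of the value `k + ζ p`. -/
theorem change_of_forms {Xw : Matrix κ κ ℝ} {Xu : Matrix κ τ ℝ} {Yw : Matrix τ κ ℝ}
    {Yu : Matrix τ τ ℝ} {Ξ ζ : Matrix τ κ ℝ} (h : (Yu + Ξ * Xu) * ζ = Yw + Ξ * Xw)
    (p : κ → ℝ) (k : τ → ℝ) :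
    Xw.mulVec p + Xu.mulVec k = (Xw - Xu * ζ).mulVec p + Xu.mulVec (k + ζ.mulVec p) ∧
      Yw.mulVec p + Yu.mulVec k + Ξ.mulVec (Xw.mulVec p + Xu.mulVec k) =
        (Yu + Ξ * Xu).mulVec (k + ζ.mulVec p) := by
  constructor
  · rw [Matrix.sub_mulVec, Matrix.mulVec_add, Matrix.mulVec_mulVec]
    abel
  · rw [Matrix.mulVec_add (Yu + Ξ * Xu), Matrix.mulVec_mulVec, h, Matrix.mulVec_add,
      Matrix.add_mulVec, Matrix.add_mulVec, Matrix.mulVec_mulVec, Matrix.mulVec_mulVec]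
    abel


theorem abs_mul_apply_le {ι ι' : Type*} (A : Matrix ι κ ℝ) (B : Matrix κ ι' ℝ) {a b : ℝ}
    (hA : ∀ i j, |A i j| ≤ a) (hB : ∀ i j, |B i j| ≤ b) (i : ι) (j : ι') :
    |(A * B) i j| ≤ Fintype.card κ * (a * b) := by
  rw [Matrix.mul_apply]
  exact abs_sum_mul_le (fun l => hA i l) fun l => hB l j

/-- Solving `D ζ' = B` when `B` is close to `D ζ`. -/
theorem NearScalar.exists_mul_eq [DecidableEq τ] {N e : ℝ} {D : Matrix τ τ ℝ} (h : NearScalar N e D)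
    (hN : 0 < N) (he : 0 ≤ e) (heN : 2 * (Fintype.card τ * e) ≤ N) (B : Matrix τ κ ℝ)
    (ζ : τ → κ → ℝ) {b : ℝ} (hb : 0 ≤ b) (hB : ∀ i j, |(B - D * Matrix.of ζ) i j| ≤ b) :
    ∃ ζ' : τ → κ → ℝ, D * Matrix.of ζ' = B ∧ ‖ζ' - ζ‖ ≤ 2 * b / N := by
  refine ⟨fun i j => (D⁻¹ * B) i j, ?_, ?_⟩
  · exact Matrix.mul_nonsing_inv_cancel_left _ _ (h.isUnit_det hN he heN)
  · refine (pi_norm_le_iff_of_nonneg (by positivity)).2 fun i =>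
      (pi_norm_le_iff_of_nonneg (by positivity)).2 fun j => ?_
    have h1 := h.le_norm_mulVec hN.le he heN fun i => (D⁻¹ * B) i j - ζ i j
    have h2 : D.mulVec (fun i => (D⁻¹ * B) i j - ζ i j) = fun i => (B - D * Matrix.of ζ) i j := by
      ext l
      conv_rhs => rw [← Matrix.mul_nonsing_inv_cancel_left D B (h.isUnit_det hN he heN),
        ← Matrix.mul_sub, Matrix.mul_apply]
      rfl
    have h3 : ‖fun i => (B - D * Matrix.of ζ) i j‖ ≤ b :=
      (pi_norm_le_iff_of_nonneg hb).2 fun i => hB i j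
    have h4 := norm_le_pi_norm (fun i => (D⁻¹ * B) i j - ζ i j) i
    rw [h2] at h1
    rw [le_div_iff₀ hN]
    calc _ ≤ ‖fun i => (D⁻¹ * B) i j - ζ i j‖ * N := by
          gcongr
          exact h4
      _ ≤ 2 * b := by linarith

/-- Solving `ξ A = B`. -/
theorem NearScalar.exists_eq_mul [DecidableEq κ] {N e : ℝ} {A : Matrix κ κ ℝ} (h : NearScalar N e A)
    (hN : 0 < N) (he : 0 ≤ e) (heN : 2 * (Fintype.card κ * e) ≤ N) (B : Matrix τ κ ℝ)
    {b : ℝ} (hb : 0 ≤ b) (hB : ∀ i j, |B i j| ≤ b) :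
    ∃ ξ : τ → κ → ℝ, Matrix.of ξ * A = B ∧ ‖ξ‖ ≤ 2 * b / N := by
  obtain ⟨ζ', h1, h2⟩ := h.transpose.exists_mul_eq hN he heN B.transpose 0 hb (by
    intro i j
    have : A.transpose * Matrix.of (0 : κ → τ → ℝ) = 0 := Matrix.mul_zero _
    rw [this, sub_zero]
    exact hB j i)
  refine ⟨fun i j => ζ' j i, ?_, ?_⟩
  · rw [← Matrix.transpose_inj, Matrix.transpose_mul]
    exact h1
  · rw [sub_zero] at h2
    exact (pi_norm_le_iff_of_nonneg (by positivity)).2 fun i =>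
      (pi_norm_le_iff_of_nonneg (by positivity)).2 fun j => (abs_apply_le_norm ζ' j i).trans h2

end Frame

section

variable {κ τ : Type*} [Fintype κ] [Fintype τ]

theorem gx_smul (g : Matrix (κ ⊕ τ) (κ ⊕ τ) ℝ) (J : ℤ) (v : κ ⊕ τ → ℤ) :
    gx g (J • v) = (J : ℝ) • gx g v := by
  have h : toR (J • v) = (J : ℝ) • toR v := by
    ext i
    simp [toR]
  ext i
  change g.mulVec (toR (J • v)) _ = _
  rw [h, Matrix.mulVec_smul]
  rfl

theorem gy_smul (g : Matrix (κ ⊕ τ) (κ ⊕ τ) ℝ) (J : ℤ) (v : κ ⊕ τ → ℤ) :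
    gy g (J • v) = (J : ℝ) • gy g v := by
  have h : toR (J • v) = (J : ℝ) • toR v := by
    ext i
    simp [toR]
  ext i
  change g.mulVec (toR (J • v)) _ = _
  rw [h, Matrix.mulVec_smul]
  rfl

/-- The values of the shear `Ξ` on the lattice `g` are controlled, up to the factors `N` and
`I₀`, by the values of the forms `ζ` on integer vectors `(p, k)`. -/
def IsFrame (g : Matrix (κ ⊕ τ) (κ ⊕ τ) ℝ) (Ξ ζ : τ → κ → ℝ) (N I₀ : ℝ) : Prop :=
  (∀ v, ∃ p k, (v ≠ 0 → ¬(p = 0 ∧ k = 0)) ∧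
    ‖gy g v + lin Ξ (gx g v)‖ ≤ 2 * N * ‖formVal ζ p k‖ ∧
    N * ‖formVal ζ p k‖ ≤ 2 * I₀ * ‖gy g v + lin Ξ (gx g v)‖ ∧
    N * ‖toR p‖ ≤ 2 * I₀ * ‖gx g v‖ + N / 2 * ‖formVal ζ p k‖) ∧
  ∀ p k, ∃ v, ‖gy g v + lin Ξ (gx g v)‖ ≤ 2 * N * ‖formVal ζ p k‖ ∧
    N * ‖toR p‖ ≤ 2 * ‖gx g v‖ + N / 2 * ‖formVal ζ p k‖ ∧
    ‖gx g v‖ ≤ 2 * N * ‖toR p‖ + N / 2 * ‖formVal ζ p k‖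

/-- Forms `ζ` in the coordinates given by a nearly orthogonal system of vectors of a lattice `g`
become a shear `ξ`; shears close to `ξ` correspond to forms close to `ζ`. -/
theorem exists_frame [DecidableEq κ] [DecidableEq τ] [Nonempty κ] [Nonempty τ] {r N d I₀ : ℝ} (hr : 1 ≤ r)
    (hd : d = Fintype.card (κ ⊕ τ)) (hN : N = 32 * d ^ 2 * r)
    (hI : I₀ = (Fintype.card (κ ⊕ τ)).factorial • (N + r) ^ Fintype.card (κ ⊕ τ))
    {g : Matrix (κ ⊕ τ) (κ ⊕ τ) ℝ} (hg : |g.det| = 1)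
    (hcov : ∀ z : κ ⊕ τ → ℝ, ∃ v : κ ⊕ τ → ℤ, ‖g.mulVec (toR v) - z‖ ≤ r)
    {ζ : τ → κ → ℝ} (hζ : ‖ζ‖ ≤ 1 / (32 * d)) :
    ∃ ξ : τ → κ → ℝ, ‖ξ‖ ≤ 1 / 4 ∧ ∀ Ξ : τ → κ → ℝ, ‖Ξ - ξ‖ ≤ 1 / (16 * d ^ 2) →
      ∃ ζ' : τ → κ → ℝ, ‖ζ' - ζ‖ ≤ 4 * Fintype.card κ * ‖Ξ - ξ‖ ∧
        IsFrame g Ξ ζ' N I₀ := by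
  set m : ℝ := (Fintype.card κ : ℝ) with hm
  set n : ℝ := (Fintype.card τ : ℝ) with hn
  have hm1 : 1 ≤ m := by rw [hm]; exact_mod_cast Fintype.card_pos
  have hn1 : 1 ≤ n := by rw [hn]; exact_mod_cast Fintype.card_pos
  have hdmn : d = m + n := by rw [hd, Fintype.card_sum]; push_cast; rfl
  have hr0 : 0 < r := by linarith
  have hd2 : 2 ≤ d := by linarith
  have hd4 : 2 * d ≤ d ^ 2 := by nlinarith
  have hN0 : 0 < N := by rw [hN]; positivity
  have hdr : 64 * (d * r) ≤ N := by
    rw [hN]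
    nlinarith
  have hdr2 : 32 * (d * (d * r)) = N := by
    rw [hN]
    ring
  have hdr0 : 2 * r ≤ d * r := by gcongr
  obtain ⟨Γ, hG, hΓ0, hΓI⟩ := exists_nearScalar_mul hg hcov hr0.le hN0 (by rw [← hd]; linarith)
  rw [← hI] at hΓI
  set G := g * Γ.map (Int.cast : ℤ → ℝ) with hGdef
  set Xw := G.toBlocks₁₁ with hXw
  set Xu := G.toBlocks₁₂ with hXu
  set Yw := G.toBlocks₂₁ with hYw
  set Yu := G.toBlocks₂₂ with hYu
  have hXwN : NearScalar N r Xw := fun i j => by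
    have h := hG (Sum.inl i) (Sum.inl j)
    simp only [Matrix.one_apply, Sum.inl.injEq] at h ⊢
    exact h
  have hYuN : NearScalar N r Yu := fun i j => by
    have h := hG (Sum.inr i) (Sum.inr j)
    simp only [Matrix.one_apply, Sum.inr.injEq] at h ⊢
    exact h
  have hXur (i j) : |Xu i j| ≤ r := by
    have h := hG (Sum.inl i) (Sum.inr j)
    simp only [Matrix.one_apply, reduceCtorEq, if_false, mul_zero, sub_zero] at h
    exact h
  have hYwr (i j) : |Yw i j| ≤ r := by
    have h := hG (Sum.inr i) (Sum.inl j)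
    simp only [Matrix.one_apply, reduceCtorEq, if_false, mul_zero, sub_zero] at h
    exact h
  have hXuζ (ζ' : τ → κ → ℝ) (h : ‖ζ'‖ ≤ 1 / d) :
      NearScalar N (2 * r) (Xw - Xu * Matrix.of ζ') := by
    rw [sub_eq_add_neg]
    refine hXwN.add_of_abs_le (e' := r) (fun i j => ?_) (by linarith)
    rw [Matrix.neg_apply, abs_neg]
    refine (abs_mul_apply_le _ _ hXur (fun i j => abs_apply_le_norm ζ' i j) i j).trans ?_
    calc n * (r * ‖ζ'‖) ≤ d * (r * (1 / d)) := by
          gcongr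
          linarith
      _ = r := by field_simp
  have hζd : 1 / (32 * d) ≤ 1 / d := by gcongr; linarith
  have hA := hXuζ ζ (hζ.trans hζd)
  have hmdr : m * r ≤ d * r := by gcongr; linarith
  have hndr : n * r ≤ d * r := by gcongr; linarith
  have hA2 : 2 * (m * (2 * r)) ≤ N := by linarith
  have hζ64 : ‖ζ‖ ≤ 1 / 64 := hζ.trans (by gcongr; linarith)
  obtain ⟨ξ, hξ, hξn⟩ := hA.exists_eq_mul hN0 (by positivity) hA2 (Yu * Matrix.of ζ - Yw)
    (b := N / 8) (by positivity) (by
      intro i j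
      have h1 := (norm_le_pi_norm (Yu.mulVec fun t => ζ t j) i).trans
        (hYuN.norm_mulVec_le hN0.le hr0.le (by linarith) _)
      have h2 : ‖fun t => ζ t j‖ ≤ 1 / 64 :=
        (pi_norm_le_iff_of_nonneg (by norm_num)).2 fun t => (abs_apply_le_norm ζ t j).trans hζ64
      rw [Matrix.sub_apply]
      refine (abs_sub _ _).trans ?_
      have h3 : |(Yu * Matrix.of ζ) i j| ≤ N / 32 := by
        refine h1.trans ?_
        calc _ ≤ 2 * N * (1 / 64) := by gcongr
          _ = N / 32 := by ring
      linarith [hYwr i j])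
  refine ⟨ξ, hξn.trans (le_of_eq (by field_simp; norm_num)), fun Ξ hΞ => ?_⟩
  have hΞd : 1 / (16 * d ^ 2) ≤ 3 / 4 := by
    rw [div_le_iff₀ (by positivity)]
    nlinarith
  have hξ4 : ‖ξ‖ ≤ 1 / 4 := hξn.trans (le_of_eq (by field_simp; norm_num))
  have hΞ1 : ‖Ξ‖ ≤ 1 := by
    have := norm_add_le (Ξ - ξ) ξ
    rw [sub_add_cancel] at this
    linarith
  have hD : NearScalar N (r + d * r) (Yu + Matrix.of Ξ * Xu) := by
    refine hYuN.add_of_abs_le (e' := d * r) (fun i j => ?_) le_rfl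
    refine (abs_mul_apply_le _ _ (fun i j => abs_apply_le_norm Ξ i j) hXur i j).trans ?_
    calc m * (‖Ξ‖ * r) ≤ d * (1 * r) := by
          gcongr
          linarith
      _ = d * r := by ring
  have hD0 : 0 ≤ r + d * r := by positivity
  have hD2 : 2 * (n * (r + d * r)) ≤ N := by
    have : n * (r + d * r) ≤ d * (d * r + d * r) := by
      gcongr
      · linarith
      · linarith
    linarith
  obtain ⟨ζ', hζ', hζ'n⟩ := hD.exists_mul_eq hN0 hD0 hD2 (Yw + Matrix.of Ξ * Xw) ζ
    (b := 2 * m * N * ‖Ξ - ξ‖) (by positivity) (by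
      intro i j
      have h1 : Yw + Matrix.of Ξ * Xw - (Yu + Matrix.of Ξ * Xu) * Matrix.of ζ =
          Matrix.of (Ξ - ξ) * (Xw - Xu * Matrix.of ζ) := by
        have h2 : (Matrix.of (Ξ - ξ) : Matrix τ κ ℝ) = Matrix.of Ξ - Matrix.of ξ := rfl
        rw [h2, Matrix.sub_mul (Matrix.of Ξ), hξ]
        simp only [Matrix.mul_sub, Matrix.add_mul, Matrix.mul_assoc]
        abel
      rw [h1]
      refine (abs_mul_apply_le _ _ (fun i j => abs_apply_le_norm (Ξ - ξ) i j)
        (hA.abs_le hN0.le) i j).trans ?_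
      calc m * (‖Ξ - ξ‖ * (N + 2 * r)) ≤ m * (‖Ξ - ξ‖ * (N + N)) := by gcongr; linarith
        _ = _ := by ring)
  have hζ'n' : ‖ζ' - ζ‖ ≤ 4 * m * ‖Ξ - ξ‖ := hζ'n.trans (le_of_eq (by
    rw [div_eq_iff hN0.ne']
    ring))
  have hζ'd : ‖ζ'‖ ≤ 1 / d := by
    have h1 := norm_add_le (ζ' - ζ) ζ
    rw [sub_add_cancel] at h1
    have h2 : 4 * m * ‖Ξ - ξ‖ ≤ 4 * d * (1 / (16 * d ^ 2)) := by
      gcongr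
      linarith
    have h3 : 4 * d * (1 / (16 * d ^ 2)) = 1 / 4 * (1 / d) := by field_simp; norm_num
    have h4 : 1 / (32 * d) = 1 / 32 * (1 / d) := by field_simp
    have h5 : 0 < 1 / d := by positivity
    linarith
  have hA' := hXuζ ζ' hζ'd
  refine ⟨ζ', hζ'n', ?_⟩
  have key (p : κ → ℤ) (k : τ → ℤ) :
      ∃ X Y, gx g (Γ.mulVec (Sum.elim p k)) = X ∧ gy g (Γ.mulVec (Sum.elim p k)) = Y ∧
        ‖Y + lin Ξ X‖ ≤ 2 * N * ‖formVal ζ' p k‖ ∧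
        N * ‖formVal ζ' p k‖ ≤ 2 * ‖Y + lin Ξ X‖ ∧
        N * ‖toR p‖ ≤ 2 * ‖X‖ + N / 2 * ‖formVal ζ' p k‖ ∧
        ‖X‖ ≤ 2 * N * ‖toR p‖ + N / 2 * ‖formVal ζ' p k‖ := by
    have h1 : g.mulVec (toR (Γ.mulVec (Sum.elim p k))) =
        Sum.elim (Xw.mulVec (toR p) + Xu.mulVec (toR k))
          (Yw.mulVec (toR p) + Yu.mulVec (toR k)) := by
      rw [mulVec_toR, Matrix.mulVec_mulVec, ← hGdef]
      conv_lhs => rw [← Matrix.fromBlocks_toBlocks G, Matrix.fromBlocks_mulVec]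
      rfl
    refine ⟨Xw.mulVec (toR p) + Xu.mulVec (toR k), Yw.mulVec (toR p) + Yu.mulVec (toR k), ?_, ?_,
      ?_⟩
    · ext i
      exact congrFun h1 (Sum.inl i)
    · ext i
      exact congrFun h1 (Sum.inr i)
    obtain ⟨h2, h3⟩ := change_of_forms hζ' (toR p) (toR k)
    have h4 : toR k + (Matrix.of ζ').mulVec (toR p) = formVal ζ' p k := rfl
    rw [h4] at h2 h3
    change _ + _ + lin Ξ _ = _ at h3
    rw [h3, h2]
    have h5 := hD.norm_mulVec_le hN0.le hD0 hD2 (formVal ζ' p k)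
    have h6 := hD.le_norm_mulVec hN0.le hD0 hD2 (formVal ζ' p k)
    have h7 := hA'.norm_mulVec_le hN0.le (by positivity) hA2 (toR p)
    have h8 := hA'.le_norm_mulVec hN0.le (by positivity) hA2 (toR p)
    have h9 : ‖Xu.mulVec (formVal ζ' p k)‖ ≤ N / 4 * ‖formVal ζ' p k‖ := by
      refine (norm_lin_le (fun i j => Xu i j) _).trans ?_
      gcongr
      have : ‖fun i j => Xu i j‖ ≤ r := (pi_norm_le_iff_of_nonneg hr0.le).2 fun i =>
        (pi_norm_le_iff_of_nonneg hr0.le).2 fun j => hXur i j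
      calc n * ‖fun i j => Xu i j‖ ≤ n * r := by gcongr
        _ ≤ N / 4 := by linarith
    have h10 := norm_add_le ((Xw - Xu * Matrix.of ζ').mulVec (toR p)) (Xu.mulVec (formVal ζ' p k))
    have h11 := norm_sub_le_norm_add ((Xw - Xu * Matrix.of ζ').mulVec (toR p))
      (Xu.mulVec (formVal ζ' p k))
    have h12 := mul_nonneg hN0.le (norm_nonneg (formVal ζ' p k))
    exact ⟨h5, h6, by linarith, by linarith⟩
  refine ⟨fun v => ?_, fun p k => ?_⟩
  · obtain ⟨q, hq⟩ := exists_mulVec_eq_det_smul Γ v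
    obtain ⟨X, Y, hX, hY, h1, h2, h3, h4⟩ := key (q ∘ Sum.inl) (q ∘ Sum.inr)
    rw [Sum.elim_comp_inl_inr, hq] at hX hY
    rw [gx_smul] at hX
    rw [gy_smul] at hY
    have hXY : Y + lin Ξ X = (Γ.det : ℝ) • (gy g v + lin Ξ (gx g v)) := by
      rw [← hX, ← hY, lin_smul, smul_add]
    rw [hXY, norm_smul, Real.norm_eq_abs] at h1 h2
    rw [← hX, norm_smul, Real.norm_eq_abs] at h3
    have h5 := mul_le_mul_of_nonneg_right hΓI (norm_nonneg (gy g v + lin Ξ (gx g v)))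
    have h6 := mul_le_mul_of_nonneg_right hΓI (norm_nonneg (gx g v))
    have h7 : (1 : ℝ) ≤ |(Γ.det : ℝ)| := by exact_mod_cast Int.one_le_abs hΓ0
    have h8 := mul_le_mul_of_nonneg_right h7 (norm_nonneg (gy g v + lin Ξ (gx g v)))
    refine ⟨q ∘ Sum.inl, q ∘ Sum.inr, ?_, by linarith, by linarith, by linarith⟩
    rintro hv ⟨hp, hk⟩
    apply hv
    have hq0 : q = 0 := by
      rw [← Sum.elim_comp_inl_inr q, hp, hk]
      ext (i | i) <;> rfl
    rw [hq0, Matrix.mulVec_zero] at hq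
    exact (smul_eq_zero.1 hq.symm).resolve_left hΓ0
  · obtain ⟨X, Y, hX, hY, h1, h2, h3, h4⟩ := key p k
    exact ⟨Γ.mulVec (Sum.elim p k), by rw [hX, hY]; exact ⟨h1, h3, h4⟩⟩

end

section

variable {κ τ : Type*} [Fintype κ] [Fintype τ]

/-- A family of forms close to one without small values has no small values either. -/
theorem le_norm_formVal_of_near {ζ ζ' : τ → κ → ℝ} {X a δ b : ℝ} (hX : 0 < X) (ha : 0 < a)
    (hδ : 0 < δ)
    (hS : ∀ (p : κ → ℤ) (k : τ → ℤ), ¬(p = 0 ∧ k = 0) → δ * X ≤ ‖toR p‖ ∨ δ * a ≤ ‖formVal ζ p k‖)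
    (hb : 2 * (Fintype.card κ * b) ≤ 1) (hζ : ‖ζ' - ζ‖ ≤ b * (a / X)) {p : κ → ℤ} {k : τ → ℤ}
    (h0 : ¬(p = 0 ∧ k = 0)) (hp : ‖toR p‖ < δ * X) : δ * a ≤ 2 * ‖formVal ζ' p k‖ := by
  have h1 := (hS p k h0).resolve_left (not_le.2 hp)
  have h2 : ‖formVal ζ' p k - formVal ζ p k‖ ≤ δ * a / 2 := by
    refine (norm_formVal_sub_le ζ ζ' p k).trans ?_
    calc _ ≤ Fintype.card κ * (b * (a / X)) * (δ * X) := by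
          gcongr
          have := (norm_nonneg _).trans hζ
          positivity
      _ = Fintype.card κ * b * (δ * a) := by field_simp
      _ ≤ 1 / 2 * (δ * a) := by
          gcongr
          linarith
      _ = _ := by ring
  have h3 := norm_sub_norm_le (formVal ζ p k) (formVal ζ' p k)
  rw [norm_sub_rev] at h3
  linarith

theorem norm_toR_single [DecidableEq κ] (j : κ) : ‖toR (Pi.single j 1 : κ → ℤ)‖ = 1 := by
  refine le_antisymm ((pi_norm_le_iff_of_nonneg zero_le_one).2 fun i => ?_)
    (one_le_norm_toR fun h => one_ne_zero (α := ℤ) ?_)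
  · by_cases h : i = j
    · subst h
      simp [toR]
    · simp [toR, h]
  · simpa using congrFun h j

theorem eq_zero_of_norm_formVal_lt {ζ : τ → κ → ℝ} {p : κ → ℤ} {k : τ → ℤ} {b : ℝ}
    (h : ‖formVal ζ p k‖ < 1 / 2) (hp : Fintype.card κ * (b * ‖toR p‖) ≤ 1 / 2) (hζ : ‖ζ‖ ≤ b) :
    k = 0 := by
  refine eq_zero_of_norm_toR_lt ?_
  have h1 : toR k = formVal ζ p k - lin ζ (toR p) := by
    rw [formVal]
    abel
  have h2 : ‖lin ζ (toR p)‖ ≤ Fintype.card κ * (b * ‖toR p‖) := by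
    refine (norm_lin_le _ _).trans ?_
    rw [mul_assoc]
    gcongr
  rw [h1]
  linarith [norm_sub_le (formVal ζ p k) (lin ζ (toR p))]

theorem IsFrame.compat {g : Matrix (κ ⊕ τ) (κ ⊕ τ) ℝ} {Ξ ζ : τ → κ → ℝ} {N I₀ f δ X a : ℝ}
    (h : IsFrame g Ξ ζ N I₀) (hN : 0 < N) (hI₀ : 1 ≤ I₀) (hf : 4 * I₀ * f = N) (hX : 0 < X)
    (ha : 0 < a) (ha1 : a ≤ 1) (hδ : 0 < δ) (hδ1 : δ ≤ 1)
    (hS : ∀ (p : κ → ℤ) (k : τ → ℤ), ¬(p = 0 ∧ k = 0) → ‖toR p‖ < δ * X →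
      δ * a ≤ 2 * ‖formVal ζ p k‖) {v : κ ⊕ τ → ℤ} (hv : v ≠ 0) :
    f * δ * X ≤ ‖gx g v‖ ∨ f * δ * a ≤ ‖gy g v + lin Ξ (gx g v)‖ := by
  have hI0 : 0 < I₀ := by linarith
  obtain ⟨p, k, h0, -, h2, h3⟩ := h.1 v
  subst hf
  have hf0 : 0 < f := by
    by_contra! hf
    nlinarith
  have h2' : 2 * f * ‖formVal ζ p k‖ ≤ ‖gy g v + lin Ξ (gx g v)‖ := by
    by_contra! hcon
    have := mul_lt_mul_of_pos_left hcon (show 0 < 2 * I₀ by linarith)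
    linarith
  rcases lt_or_ge ‖toR p‖ (δ * X) with hp | hp
  · right
    have h4 := mul_le_mul_of_nonneg_left (hS p k (h0 hv) hp) hf0.le
    linarith
  · rcases le_or_gt ‖formVal ζ p k‖ 1 with h4 | h4
    · left
      have hp1 : 1 ≤ ‖toR p‖ := one_le_norm_toR fun hp0 => by
        rw [hp0] at hp
        have : ‖toR (0 : κ → ℤ)‖ = 0 := by
          rw [norm_eq_zero]
          ext
          simp [toR]
        rw [this] at hp
        exact absurd (mul_pos hδ hX) (not_lt.2 hp)
      have h5 : f * ‖toR p‖ ≤ ‖gx g v‖ := by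
        by_contra! hcon
        have h6 := mul_lt_mul_of_pos_left hcon (show 0 < 2 * I₀ by linarith)
        have h7 := mul_le_mul_of_nonneg_left (h4.trans hp1) (show 0 ≤ 2 * I₀ * f by positivity)
        nlinarith
      calc f * δ * X = f * (δ * X) := by ring
        _ ≤ f * ‖toR p‖ := by gcongr
        _ ≤ _ := h5
    · right
      calc f * δ * a ≤ f * 1 * 1 := by gcongr
        _ ≤ 2 * f * 1 := by linarith
        _ ≤ 2 * f * ‖formVal ζ p k‖ := by gcongr
        _ ≤ _ := h2'

theorem IsFrame.exists_small [Nonempty κ] {g : Matrix (κ ⊕ τ) (κ ⊕ τ) ℝ} {Ξ ζ : τ → κ → ℝ}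
    {N I₀ b : ℝ} (h : IsFrame g Ξ ζ N I₀) (hN : 0 < N) (hζ : ‖ζ‖ ≤ b)
    (hb : Fintype.card κ * b ≤ 1) :
    ∃ v, gx g v ≠ 0 ∧ ‖gx g v‖ ≤ 3 * N ∧
      ‖gy g v + lin Ξ (gx g v)‖ ≤ 2 * N * (Fintype.card κ * b) := by
  classical
  obtain ⟨j⟩ := ‹Nonempty κ›
  obtain ⟨v, h1, h2, h3⟩ := h.2 (Pi.single j 1) 0
  have h4 : ‖formVal ζ (Pi.single j 1) 0‖ ≤ Fintype.card κ * b := by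
    have h5 : formVal ζ (Pi.single j 1) 0 = lin ζ (toR (Pi.single j 1)) := by
      ext
      simp [formVal, toR]
    rw [h5]
    refine (norm_lin_le _ _).trans ?_
    rw [norm_toR_single, mul_one]
    gcongr
  rw [norm_toR_single] at h2 h3
  have h6 := mul_le_mul_of_nonneg_left (h4.trans hb) hN.le
  refine ⟨v, fun h0 => ?_, by linarith, h1.trans (by gcongr)⟩
  rw [h0, norm_zero] at h2
  linarith

theorem IsFrame.exists_improvement [Nonempty κ] {g : Matrix (κ ⊕ τ) (κ ⊕ τ) ℝ} {Ξ ζ : τ → κ → ℝ}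
    {N I₀ f δ X a b c M : ℝ} (h : IsFrame g Ξ ζ N I₀) (hN : 0 < N) (hI₀ : 1 ≤ I₀)
    (hf : 4 * I₀ * f = N) (ha : 0 < a) (hδ : 0 < δ) (hM : 0 ≤ M) (hc : 0 < c)
    (hS : ∀ (p : κ → ℤ) (k : τ → ℤ), ¬(p = 0 ∧ k = 0) → ‖toR p‖ < δ * X →
      δ * a ≤ 2 * ‖formVal ζ p k‖)
    (hR : ∀ (p : κ → ℤ) (k : τ → ℤ), p ≠ 0 →
        ‖toR p‖ < δ * X → ∃ (p' : κ → ℤ) (k' : τ → ℤ), ¬(p' = 0 ∧ k' = 0) ∧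
          ‖toR p'‖ ≤ M * ‖toR p‖ ∧ 8 * I₀ * ‖formVal ζ p' k'‖ ≤ ‖formVal ζ p k‖)
    (hζ : ‖ζ‖ ≤ b) (hb : Fintype.card κ * b ≤ 1) (hbf : 2 * N * (Fintype.card κ * b) < f)
    {v : κ ⊕ τ → ℤ} (hv0 : gx g v ≠ 0) (hvc : c ≤ ‖gx g v‖) (hvX : ‖gx g v‖ < f * δ * X) :
    ∃ v', gx g v' ≠ 0 ∧ ‖gx g v'‖ ≤ (3 * N / c + 12 * M * I₀) * ‖gx g v‖ ∧
      ‖gy g v' + lin Ξ (gx g v')‖ < ‖gy g v + lin Ξ (gx g v)‖ := by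
  have hI0 : 0 < I₀ := by linarith
  obtain ⟨p, k, h0, -, h2, h3⟩ := h.1 v
  have hv : v ≠ 0 := by
    rintro rfl
    apply hv0
    ext i
    have : toR (0 : κ ⊕ τ → ℤ) = 0 := by
      ext
      simp [toR]
    simp [gx, this]
  have hf0 : 0 < f := by
    by_contra! hf1
    nlinarith
  rcases le_or_gt (1 / 2) ‖formVal ζ p k‖ with hl | hl
  · obtain ⟨v', h4, h5, h6⟩ := h.exists_small hN hζ hb
    refine ⟨v', h4, ?_, h6.trans_lt (hbf.trans_le ?_)⟩
    · calc _ ≤ 3 * N / c * c := by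
            rw [div_mul_cancel₀ _ hc.ne']
            exact h5
        _ ≤ (3 * N / c + 12 * M * I₀) * ‖gx g v‖ := by
            gcongr
            have : 0 ≤ 12 * M * I₀ := by positivity
            linarith
    · by_contra! hcon
      have h7 := mul_lt_mul_of_pos_left hcon (show 0 < 2 * I₀ by linarith)
      have h8 := mul_le_mul_of_nonneg_left hl hN.le
      linarith
  · have hp0 : p ≠ 0 := by
      rintro rfl
      have h4 : formVal ζ 0 k = toR k := by
        ext
        simp [formVal, toR, lin]
      rw [h4] at hl
      exact h0 hv ⟨rfl, eq_zero_of_norm_toR_lt (by linarith)⟩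
    have hp1 := one_le_norm_toR hp0
    have h4 : N * ‖toR p‖ ≤ 4 * I₀ * ‖gx g v‖ := by
      have h5 := mul_le_mul_of_nonneg_left hl.le hN.le
      have h6 := mul_le_mul_of_nonneg_left hp1 hN.le
      linarith
    have hpX : ‖toR p‖ < δ * X := by
      have h5 : N * ‖toR p‖ < N * (δ * X) := by
        refine h4.trans_lt ?_
        rw [← hf]
        have := mul_lt_mul_of_pos_left hvX (show 0 < 4 * I₀ by linarith)
        linarith
      exact lt_of_mul_lt_mul_left h5 hN.le
    obtain ⟨p', k', h5, h6, h7⟩ := hR p k hp0 hpX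
    have hl0 : 0 < ‖formVal ζ p k‖ := by
      have := hS p k (h0 hv) hpX
      have := mul_pos hδ ha
      linarith
    have hl' : ‖formVal ζ p' k'‖ < 1 / 2 := by
      have : 1 * ‖formVal ζ p' k'‖ ≤ 8 * I₀ * ‖formVal ζ p' k'‖ := by
        gcongr
        linarith
      linarith
    have hp'0 : p' ≠ 0 := by
      rintro rfl
      have h4 : formVal ζ 0 k' = toR k' := by
        ext
        simp [formVal, toR, lin]
      rw [h4] at hl'
      exact h5 ⟨rfl, eq_zero_of_norm_toR_lt (by linarith)⟩
    have hp'1 := one_le_norm_toR hp'0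
    obtain ⟨v', h8, h9, h10⟩ := h.2 p' k'
    have h11 := mul_le_mul_of_nonneg_left hl'.le hN.le
    have h12 := mul_le_mul_of_nonneg_left hp'1 hN.le
    refine ⟨v', fun hv' => ?_, ?_, ?_⟩
    · rw [hv', norm_zero] at h9
      linarith
    · calc ‖gx g v'‖ ≤ 3 * (N * ‖toR p'‖) := by linarith
        _ ≤ 3 * (N * (M * ‖toR p‖)) := by gcongr
        _ = 3 * M * (N * ‖toR p‖) := by ring
        _ ≤ 3 * M * (4 * I₀ * ‖gx g v‖) := by gcongr
        _ = (0 + 12 * M * I₀) * ‖gx g v‖ := by ring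
        _ ≤ _ := by gcongr; positivity
    · have h13 : 8 * I₀ * ‖gy g v' + lin Ξ (gx g v')‖ ≤ 4 * I₀ * ‖gy g v + lin Ξ (gx g v)‖ := by
        calc _ ≤ 8 * I₀ * (2 * N * ‖formVal ζ p' k'‖) := by gcongr
          _ = 2 * N * (8 * I₀ * ‖formVal ζ p' k'‖) := by ring
          _ ≤ 2 * N * ‖formVal ζ p k‖ := by gcongr
          _ = 2 * (N * ‖formVal ζ p k‖) := by ring
          _ ≤ 2 * (2 * I₀ * ‖gy g v + lin Ξ (gx g v)‖) := by gcongr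
          _ = _ := by ring
      have h14 : 0 < 2 * I₀ * ‖gy g v + lin Ξ (gx g v)‖ := (mul_pos hN hl0).trans_le h2
      have h15 : 8 * I₀ * ‖gy g v' + lin Ξ (gx g v')‖ < 8 * I₀ * ‖gy g v + lin Ξ (gx g v)‖ := by
        linarith
      exact lt_of_mul_lt_mul_left h15 (by positivity)

theorem IsFrame.small_of_lt {g : Matrix (κ ⊕ τ) (κ ⊕ τ) ℝ} {Ξ ζ : τ → κ → ℝ}
    {N I₀ f b : ℝ} (h : IsFrame g Ξ ζ N I₀) (hN : 0 < N) (hI₀ : 1 ≤ I₀)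
    (hf : 4 * I₀ * f = N) (hζ : ‖ζ‖ ≤ b) (hb : Fintype.card κ * (b * (12 * I₀)) ≤ 1 / 2)
    {v : κ ⊕ τ → ℤ} (hv0 : gx g v ≠ 0) (hvR : ‖gx g v‖ ≤ 3 * N)
    (hvf : ‖gy g v + lin Ξ (gx g v)‖ < f) :
    f ≤ ‖gx g v‖ ∧ ‖gy g v + lin Ξ (gx g v)‖ ≤ 2 * N * (Fintype.card κ * (b * (12 * I₀))) := by
  have hI0 : 0 < I₀ := by linarith
  obtain ⟨p, k, h0, h1, h2, h3⟩ := h.1 v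
  have hv : v ≠ 0 := by
    rintro rfl
    apply hv0
    ext i
    have : toR (0 : κ ⊕ τ → ℤ) = 0 := by
      ext
      simp [toR]
    simp [gx, this]
  have hl : ‖formVal ζ p k‖ < 1 / 2 := by
    have h4 := mul_lt_mul_of_pos_left hvf (show 0 < 2 * I₀ by linarith)
    have h5 : N * ‖formVal ζ p k‖ < N * (1 / 2) := by linarith
    exact lt_of_mul_lt_mul_left h5 hN.le
  have hp0 : p ≠ 0 := by
    rintro rfl
    have h4 : formVal ζ 0 k = toR k := by
      ext
      simp [formVal, toR, lin]
    rw [h4] at hl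
    exact h0 hv ⟨rfl, eq_zero_of_norm_toR_lt (by linarith)⟩
  have hp1 := one_le_norm_toR hp0
  have h4 : N * ‖toR p‖ ≤ 4 * I₀ * ‖gx g v‖ := by
    have h5 := mul_le_mul_of_nonneg_left hl.le hN.le
    have h6 := mul_le_mul_of_nonneg_left hp1 hN.le
    linarith
  have hb0 := (norm_nonneg _).trans hζ
  have h5 : ‖toR p‖ ≤ 12 * I₀ := by
    have h6 := mul_le_mul_of_nonneg_left hvR (show 0 ≤ 4 * I₀ by linarith)
    have h7 : N * ‖toR p‖ ≤ N * (12 * I₀) := by linarith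
    exact le_of_mul_le_mul_left h7 hN
  have h6 : Fintype.card κ * (b * ‖toR p‖) ≤ Fintype.card κ * (b * (12 * I₀)) := by gcongr
  constructor
  · have h7 := mul_le_mul_of_nonneg_left hp1 hN.le
    have h8 : 4 * I₀ * f ≤ 4 * I₀ * ‖gx g v‖ := by linarith
    exact le_of_mul_le_mul_left h8 (by positivity)
  · have hk := eq_zero_of_norm_formVal_lt hl (h6.trans hb) hζ
    have h7 : formVal ζ p k = lin ζ (toR p) := by
      rw [hk]
      ext
      simp [formVal, toR]
    refine h1.trans ?_
    gcongr
    rw [h7]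
    refine (norm_lin_le _ _).trans (le_trans ?_ h6)
    rw [mul_assoc]
    gcongr

end

theorem exists_excursion (κ τ : Type*) [Fintype κ] [Fintype τ] [DecidableEq κ] [DecidableEq τ]
    [Nonempty κ] [Nonempty τ] (hsf : HasSteadyForms κ τ) {δs δ c₀ : ℝ} (hδ : 0 < δ) (hc₀ : 0 < c₀)
    (hstep : RefinesTo κ τ δs) :
    ∃ M θ f R : ℝ, 0 < M ∧ 0 < θ ∧ 0 < f ∧ ∀ ε : ℝ, 0 < ε → ε < 1 → ∃ S : ℝ, 1 ≤ S ∧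
      ∀ g : Matrix (κ ⊕ τ) (κ ⊕ τ) ℝ, |g.det| = 1 →
        (∀ v : κ ⊕ τ → ℤ, v ≠ 0 → δ ≤ ‖g.mulVec (toR v)‖) →
        ∃ c : τ → κ → ℝ, ‖c‖ ≤ 1 - (S ^ (Fintype.card κ + Fintype.card τ))⁻¹ ∧ Cpt g c S δs ∧
          ∀ Ξ : τ → κ → ℝ, ‖Ξ - c‖ ≤ (S ^ (Fintype.card κ + Fintype.card τ))⁻¹ →
            (∀ v, gx g v ≠ 0 → c₀ ≤ ‖gx g v‖ → ‖gx g v‖ < θ * S ^ Fintype.card τ →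
              ∃ v', gx g v' ≠ 0 ∧ ‖gx g v'‖ ≤ M * ‖gx g v‖ ∧
                ‖gy g v' + lin Ξ (gx g v')‖ < ‖gy g v + lin Ξ (gx g v)‖) ∧
            (∃ v, gx g v ≠ 0 ∧ ‖gx g v‖ ≤ R ∧ ‖gy g v + lin Ξ (gx g v)‖ < f) ∧
            ∀ v, gx g v ≠ 0 → ‖gx g v‖ ≤ R → ‖gy g v + lin Ξ (gx g v)‖ < f →
              f ≤ ‖gx g v‖ ∧ ‖gy g v + lin Ξ (gx g v)‖ ≤ ε * f := by
  obtain ⟨C, hC0, hC⟩ := exists_lattice_near (ι := κ ⊕ τ) hδ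
  set r : ℝ := max C 1 with hr
  have hr1 : 1 ≤ r := le_max_right _ _
  set D := Fintype.card κ + Fintype.card τ with hD
  set m : ℝ := (Fintype.card κ : ℝ) with hm
  have hm1 : 1 ≤ m := by rw [hm]; exact_mod_cast Fintype.card_pos
  have hτ0 : Fintype.card τ ≠ 0 := Fintype.card_ne_zero
  have hD0 : D ≠ 0 := by omega
  set d : ℝ := (Fintype.card (κ ⊕ τ) : ℝ) with hd
  have hdm : m ≤ d := by rw [hd, Fintype.card_sum]; push_cast; linarith [Nat.cast_nonneg (α := ℝ) (Fintype.card τ)]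
  have hd1 : 1 ≤ d := hm1.trans hdm
  set N : ℝ := 32 * d ^ 2 * r with hN
  have hN0 : 0 < N := by positivity
  set I₀ : ℝ := (Fintype.card (κ ⊕ τ)).factorial • (N + r) ^ Fintype.card (κ ⊕ τ) with hI
  have hI1 : 1 ≤ I₀ := by
    rw [hI, nsmul_eq_mul]
    have h1 : (1 : ℝ) ≤ ((Fintype.card (κ ⊕ τ)).factorial : ℝ) := by
      exact_mod_cast Nat.factorial_pos _
    have h2 : 1 ≤ (N + r) ^ Fintype.card (κ ⊕ τ) := one_le_pow₀ (by linarith)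
    exact one_le_mul_of_one_le_of_one_le h1 h2
  have hI0 : 0 < I₀ := by linarith
  obtain ⟨M₁, δ₁, κ₁, hM₁, hδ₁, hδ₁1, hκ₁, hforms⟩ := hsf (8 * I₀) (by linarith)
  set f : ℝ := N / (4 * I₀) with hf
  have hf0 : 0 < f := by positivity
  have hfN : 4 * I₀ * f = N := by rw [hf]; field_simp
  set b : ℝ := min (1 / (16 * d ^ 2)) (min (κ₁ / (4 * m)) (1 / (8 * m ^ 2))) with hb
  have hb0 : 0 < b := by positivity
  have hb1 : b ≤ 1 / (16 * d ^ 2) := min_le_left _ _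
  have hb2 : 4 * m * b ≤ κ₁ := by
    have : b ≤ κ₁ / (4 * m) := (min_le_right _ _).trans (min_le_left _ _)
    rw [le_div_iff₀ (by positivity)] at this
    linarith
  have hb3 : 2 * (m * (4 * m * b)) ≤ 1 := by
    have : b ≤ 1 / (8 * m ^ 2) := (min_le_right _ _).trans (min_le_right _ _)
    rw [le_div_iff₀ (by positivity)] at this
    linarith
  have hb4 : 4 * m * b ≤ 1 := by
    have : 1 * (4 * m * b) ≤ m * (4 * m * b) := by gcongr
    linarith
  have hb5 : b ≤ 1 / 4 := by
    have : 1 * b ≤ m * b := by gcongr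
    linarith
  obtain ⟨s, hs1, hsD⟩ := exists_one_le_pow_eq hD0 (y := 1 / b) (by
    rw [le_div_iff₀ hb0]
    linarith)
  have hs0 : 0 < s := by linarith
  have hsb : (s ^ D)⁻¹ = b := by rw [hsD]; simp
  obtain ⟨ρ₀, hρ₀⟩ := hstep.exists_step (δin := f * δ₁ * (s ^ D)⁻¹) (by positivity)
  set ρ : ℕ := 2 * (ρ₀ + 1) with hρ
  have hρ2 : (2 : ℝ) ≤ ρ := by rw [hρ]; push_cast; linarith [Nat.cast_nonneg (α := ℝ) ρ₀]
  have hρ0 : (0 : ℝ) < ρ := by linarith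
  refine ⟨3 * N / c₀ + 12 * M₁ * I₀, f * δ₁ / (s * ρ) ^ Fintype.card τ, f, 3 * N, by positivity,
    by positivity, hf0, fun ε hε hε1 => ?_⟩
  set ε' : ℝ := min (1 / (32 * d)) (ε * f / (96 * N * m * I₀)) with hε'
  have hε'0 : 0 < ε' := by positivity
  have hε'1 : ε' ≤ 1 / (32 * d) := min_le_left _ _
  have hε'2 : 96 * N * m * I₀ * ε' ≤ ε * f := by
    have : ε' ≤ ε * f / (96 * N * m * I₀) := min_le_right _ _
    rw [le_div_iff₀ (by positivity)] at this
    linarith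
  have hε'3 : ε' < 1 := by
    refine hε'1.trans_lt ?_
    rw [div_lt_one (by positivity)]
    linarith
  have hε'f : ε * f ≤ f := mul_le_of_le_one_left hf0.le hε1.le
  have hε'4 : 384 * (m * (I₀ * (I₀ * ε'))) ≤ 1 := by
    have h1 : f * (384 * (m * (I₀ * (I₀ * ε')))) ≤ f * 1 := by
      rw [← hfN] at hε'2
      linarith
    exact le_of_mul_le_mul_left h1 hf0
  have hmε : 0 ≤ m * ε' := by positivity
  have hε'5 : 384 * (m * (I₀ * ε')) ≤ 1 := by
    have : 1 * (m * (I₀ * ε')) ≤ I₀ * (m * (I₀ * ε')) := by gcongr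
    linarith
  have hε'6 : 384 * (m * ε') ≤ 1 := by
    have : 1 * (m * ε') ≤ I₀ * (m * ε') := by gcongr
    linarith
  obtain ⟨ζ, X, a, hX1, ha, haε, hdet, hζ, hS, hR⟩ := hforms ε' hε'0 hε'3
  have hX0 : 0 < X := by linarith
  have ha1 : a ≤ 1 := by linarith
  obtain ⟨σ, hσ1, hσX⟩ := exists_one_le_pow_eq hτ0 hX1
  have hσ0 : 0 < σ := by linarith
  have hσa : (σ ^ Fintype.card κ)⁻¹ = a := by
    have h1 : (σ ^ Fintype.card κ * a) ^ Fintype.card τ = 1 := by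
      rw [mul_pow, ← pow_mul, mul_comm (Fintype.card κ), pow_mul, hσX, hdet]
    exact inv_eq_of_mul_eq_one_right
      ((pow_eq_one_iff_of_nonneg (by positivity) hτ0).1 h1)
  have hσD : (σ ^ D)⁻¹ = a / X := by
    rw [hD, pow_add, mul_inv, hσa, hσX]
    rfl
  have haX : a / X ≤ a := div_le_self ha.le hX1
  have haX0 : 0 < a / X := by positivity
  set S : ℝ := σ * s * ρ with hSdef
  have hSD : (S ^ D)⁻¹ ≤ b * (a / X) / 2 := by
    rw [hSdef, mul_pow, mul_pow, mul_inv, mul_inv, hσD, hsb]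
    have : ((ρ : ℝ) ^ D)⁻¹ ≤ 1 / 2 := by
      rw [inv_eq_one_div]
      gcongr
      exact hρ2.trans (le_self_pow₀ (by linarith) hD0)
    calc _ ≤ a / X * b * (1 / 2) := by gcongr
      _ = _ := by ring
  have hS1 : 1 ≤ S := by
    have h1 : 1 ≤ σ * s := one_le_mul_of_one_le_of_one_le hσ1 hs1
    exact one_le_mul_of_one_le_of_one_le h1 (by linarith)
  refine ⟨S, hS1, fun g hg hgδ => ?_⟩
  obtain ⟨ξ, hξ, hframe⟩ := exists_frame (r := r) (N := N) (d := d) (I₀ := I₀) hr1 hd hN hI hg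
    (fun z => (hC g hg hgδ z).imp fun v hv => hv.trans (le_max_left _ _)) (hζ.trans hε'1)
  have key (Ξ : τ → κ → ℝ) (hΞ : ‖Ξ - ξ‖ ≤ b * (a / X)) : ∃ ζ' : τ → κ → ℝ,
      ‖ζ' - ζ‖ ≤ 4 * m * b * (a / X) ∧ ‖ζ'‖ ≤ 2 * ε' ∧ IsFrame g Ξ ζ' N I₀ := by
    obtain ⟨ζ', h1, h2⟩ := hframe Ξ (hΞ.trans (le_trans
      (mul_le_of_le_one_right hb0.le (haX.trans ha1)) hb1))
    have h3 : ‖ζ' - ζ‖ ≤ 4 * m * b * (a / X) := by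
      refine h1.trans ?_
      rw [mul_assoc _ b]
      gcongr
    refine ⟨ζ', h3, ?_, h2⟩
    have h4 := norm_add_le (ζ' - ζ) ζ
    rw [sub_add_cancel] at h4
    have h5 : 4 * m * b * (a / X) ≤ 1 * ε' := by
      gcongr
      linarith
    linarith
  have hcpt : Cpt g ξ σ (f * δ₁) := by
    intro v hv
    obtain ⟨ζ', h1, -, h2⟩ := key ξ (by simp; positivity)
    rw [hσX, hσa]
    exact h2.compat hN0 hI1 hfN hX0 ha ha1 hδ₁ hδ₁1
      (fun p k h0 hp => le_norm_formVal_of_near hX0 ha hδ₁ hS hb3 h1 h0 hp) hv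
  obtain ⟨c, hc, hcξ⟩ := hρ₀ ρ (by omega) (even_two_mul _) g hg ξ (σ * s) (by positivity)
    (hcpt.scale hσ0 (by positivity) hs1)
  have hσsD : ((σ * s) ^ D)⁻¹ = b * (a / X) := by
    rw [mul_pow, mul_inv, hσD, hsb, mul_comm]
  rw [hσsD] at hcξ
  have hSD0 : 0 < (S ^ D)⁻¹ := by positivity
  refine ⟨c, ?_, hc, fun Ξ hΞ => ?_⟩
  · have h1 := norm_add_le (c - ξ) ξ
    rw [sub_add_cancel] at h1
    have h2 : b * (a / X) ≤ 1 / 4 * 1 := by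
      gcongr
      linarith
    linarith
  have hΞξ : ‖Ξ - ξ‖ ≤ b * (a / X) := by
    have h1 := norm_add_le (Ξ - c) (c - ξ)
    rw [sub_add_sub_cancel] at h1
    linarith
  obtain ⟨ζ', h1, h2, h3⟩ := key Ξ hΞξ
  have hb7 : 2 * N * (m * (2 * ε')) < f := by
    have h4 : 1 * (N * (m * ε')) ≤ I₀ * (N * (m * ε')) := by gcongr
    linarith
  have hb8 : m * (2 * ε') ≤ 1 := by linarith
  refine ⟨fun v hv hvc hvX => ?_, ?_, fun v hv hvR hvf => ?_⟩
  · refine h3.exists_improvement hN0 hI1 hfN ha hδ₁ hM₁.le hc₀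
      (fun p k h0 hp => le_norm_formVal_of_near hX0 ha hδ₁ hS hb3 h1 h0 hp)
      (hR ζ' (h1.trans (by gcongr))) h2 hb8 hb7 hv hvc (hvX.trans_le (le_of_eq ?_))
    rw [← hσX, hSdef, mul_assoc σ, mul_pow σ]
    field_simp
  · obtain ⟨v, h4, h5, h6⟩ := h3.exists_small hN0 h2 hb8
    exact ⟨v, h4, h5, h6.trans_lt hb7⟩
  · obtain ⟨h4, h5⟩ := h3.small_of_lt hN0 hI1 hfN h2 (by linarith) hv hvR hvf
    exact ⟨h4, by linarith [mul_pos hε hf0]⟩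

section Excursion

variable {κ τ : Type*} [Fintype κ] [Fintype τ] [DecidableEq κ] [DecidableEq τ]

theorem gx_one (x : κ → ℤ) (y : τ → ℤ) :
    gx (1 : Matrix (κ ⊕ τ) (κ ⊕ τ) ℝ) (Sum.elim x (-y)) = toR x := by
  ext i
  simp [gx]

theorem norm_gy_one_add_lin (ξ : τ → κ → ℝ) (x : κ → ℤ) (y : τ → ℤ) :
    ‖gy (1 : Matrix (κ ⊕ τ) (κ ⊕ τ) ℝ) (Sum.elim x (-y)) +
      lin ξ (gx (1 : Matrix (κ ⊕ τ) (κ ⊕ τ) ℝ) (Sum.elim x (-y)))‖ = err ξ x y := by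
  rw [gx_one, err, add_comm, sub_eq_add_neg]
  congr 2
  ext i
  simp [gy, toR]

theorem norm_gy_act_add_lin {lam : ℝ} (hlam : 0 < lam) (c ξ : τ → κ → ℝ) (x : κ → ℤ) (y : τ → ℤ) :
    ‖gy (act lam c 1) (Sum.elim x (-y)) + lin (lam ^ (Fintype.card κ + Fintype.card τ) • (ξ - c))
      (gx (act lam c 1) (Sum.elim x (-y)))‖ = lam ^ Fintype.card κ * err ξ x y := by
  rw [← norm_gy_one_add_lin, gy_act, gx_act, smul_lin, lin_smul, smul_smul, pow_add,
    mul_assoc (lam ^ _), mul_inv_cancel₀ (by positivity), mul_one, ← smul_add, sub_lin,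
    norm_smul, Real.norm_of_nonneg (by positivity)]
  congr 2
  abel

theorem exists_sum_elim_neg (v : κ ⊕ τ → ℤ) : ∃ x y, v = Sum.elim x (-y) :=
  ⟨v ∘ Sum.inl, -(v ∘ Sum.inr), by rw [neg_neg, Sum.elim_comp_inl_inr]⟩

theorem toR_ne_zero_iff {ι : Type*} {v : ι → ℤ} : toR v ≠ 0 ↔ v ≠ 0 :=
  ⟨fun h hv => h (by subst hv; ext i; simp), toR_ne_zero⟩

/-- At any scale `lam`, one may move to a much larger scale `lam * S` so that on the way the
integer points with small error do not get sparse, but one of them has a very small error. -/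
theorem exists_excursion_at (κ τ : Type*) [Fintype κ] [Fintype τ] [DecidableEq κ] [DecidableEq τ]
    [Nonempty κ] [Nonempty τ] (hsf : HasSteadyForms κ τ) {δs c₀ : ℝ} (hδs : 0 < δs) (hc₀ : 0 < c₀)
    (hstep : RefinesTo κ τ δs) :
    ∃ M θ f : ℝ, 0 < M ∧ 0 < θ ∧ 0 < f ∧ ∀ ε, 0 < ε → ε < 1 → ∃ S : ℝ, 1 ≤ S ∧
      ∀ (c : τ → κ → ℝ) (lam : ℝ), 0 < lam → Cpt 1 c lam δs → ∃ c' : τ → κ → ℝ,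
        Cpt 1 c' (lam * S) δs ∧
        ‖c' - c‖ ≤ (lam ^ (Fintype.card κ + Fintype.card τ))⁻¹ -
          ((lam * S) ^ (Fintype.card κ + Fintype.card τ))⁻¹ ∧
        ∀ ξ : τ → κ → ℝ, ‖ξ - c'‖ ≤ ((lam * S) ^ (Fintype.card κ + Fintype.card τ))⁻¹ →
          (∀ x y, x ≠ 0 → c₀ * lam ^ Fintype.card τ ≤ ‖toR x‖ →
            ‖toR x‖ < θ * (lam * S) ^ Fintype.card τ →
            ∃ x' y', x' ≠ 0 ∧ ‖toR x'‖ ≤ M * ‖toR x‖ ∧ err ξ x' y' < err ξ x y) ∧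
          ∃ x₀ y₀, f * lam ^ Fintype.card τ ≤ ‖toR x₀‖ ∧
            ∀ x y, x ≠ 0 → ‖toR x‖ < ‖toR x₀‖ → err ξ x₀ y₀ ≤ ε * err ξ x y := by
  obtain ⟨M, θ, f, R, hM, hθ, hf, h⟩ := exists_excursion κ τ hsf hδs hc₀ hstep
  refine ⟨M, θ, f, hM, hθ, hf, fun ε hε hε1 => ?_⟩
  obtain ⟨S, hS1, hS⟩ := h ε hε hε1
  refine ⟨S, hS1, fun c lam hlam hc => ?_⟩
  obtain ⟨c', hc'1, hc', hξ⟩ := hS (act lam c 1) (by rw [abs_det_act hlam]; simp)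
    fun v hv => hc.le_norm_act hlam v hv
  set D := Fintype.card κ + Fintype.card τ with hD
  have hS0 : 0 < S := by linarith
  refine ⟨_, (cpt_act_iff hlam c c' 1 S δs).1 hc', ?_, fun ξ hξc => ?_⟩
  · rw [add_sub_cancel_left, norm_smul, Real.norm_of_nonneg (by positivity), mul_pow, mul_inv]
    calc _ ≤ (lam ^ D)⁻¹ * (1 - (S ^ D)⁻¹) := by gcongr
      _ = _ := by ring
  obtain ⟨h1, ⟨v, hv⟩, h3⟩ := hξ (lam ^ D • (ξ - c)) (by
    have : lam ^ D • (ξ - c) - c' = lam ^ D • (ξ - (c + (lam ^ D)⁻¹ • c')) := by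
      rw [sub_add_eq_sub_sub, smul_sub _ (ξ - c), smul_smul, mul_inv_cancel₀ (by positivity),
        one_smul]
    rw [this, norm_smul, Real.norm_of_nonneg (by positivity)]
    rw [mul_pow, mul_inv] at hξc
    calc _ ≤ lam ^ D * ((lam ^ D)⁻¹ * (S ^ D)⁻¹) := by gcongr
      _ = _ := by field_simp)
  have hx (x : κ → ℤ) (y : τ → ℤ) :
      gx (act lam c 1) (Sum.elim x (-y)) = (lam ^ Fintype.card τ)⁻¹ • toR x := by
    rw [gx_act, gx_one]
  have hxn (x : κ → ℤ) : ‖(lam ^ Fintype.card τ)⁻¹ • toR x‖ = ‖toR x‖ / lam ^ Fintype.card τ := by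
    rw [norm_smul, Real.norm_of_nonneg (by positivity), inv_mul_eq_div]
  have hx0 (x : κ → ℤ) : (lam ^ Fintype.card τ)⁻¹ • toR x ≠ 0 ↔ x ≠ 0 := by
    rw [smul_ne_zero_iff, toR_ne_zero_iff]
    exact and_iff_right (by positivity)
  constructor
  · intro x y hx0' hxl hxr
    obtain ⟨v', h4, h5, h6⟩ := h1 (Sum.elim x (-y)) (by rwa [hx, hx0])
      (by rwa [hx, hxn, le_div_iff₀ (by positivity)])
      (by rw [hx, hxn, div_lt_iff₀ (by positivity), mul_assoc, ← mul_pow, mul_comm S]; exact hxr)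
    obtain ⟨x', y', rfl⟩ := exists_sum_elim_neg v'
    rw [hx, hx0] at h4
    rw [hx, hx, hxn, hxn, ← mul_div_assoc, div_le_div_iff_of_pos_right (by positivity)] at h5
    rw [norm_gy_act_add_lin hlam, norm_gy_act_add_lin hlam] at h6
    exact ⟨x', y', h4, h5, lt_of_mul_lt_mul_left h6 (by positivity)⟩
  · obtain ⟨x, y, rfl⟩ := exists_sum_elim_neg v
    rw [norm_gy_act_add_lin hlam, hx, hx0, hxn, ← lt_div_iff₀' (by positivity),
      div_le_iff₀ (by positivity)] at hv
    obtain ⟨⟨x₀, y₀⟩, ⟨h4, h5⟩, h6⟩ := exists_shortest_err_lt ξ (f / lam ^ Fintype.card κ)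
      ⟨(x, y), hv.1, hv.2.2⟩
    obtain ⟨h7, h8⟩ := h3 (Sum.elim x₀ (-y₀)) (by rwa [hx, hx0])
      (by
        rw [hx, hxn, div_le_iff₀ (by positivity)]
        exact (h6 x y hv.1 hv.2.2).1.trans hv.2.1)
      (by rwa [norm_gy_act_add_lin hlam, ← lt_div_iff₀' (by positivity)])
    rw [hx, hxn, le_div_iff₀ (by positivity)] at h7
    refine ⟨x₀, y₀, h7, fun x' y' hx' hlt => ?_⟩
    have h9 : f / lam ^ Fintype.card κ ≤ err ξ x' y' := by
      by_contra! hcon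
      exact hlt.not_ge (h6 x' y' hx' hcon).1
    rw [norm_gy_act_add_lin hlam] at h8
    calc err ξ x₀ y₀ ≤ ε * (f / lam ^ Fintype.card κ) := by
          rw [← mul_div_assoc, le_div_iff₀' (by positivity)]
          exact h8
      _ ≤ _ := by gcongr

end Excursion

section Tree

open scoped NNReal Topology

/-- A lower bound for the Hausdorff dimension of a limit set of a tree of nested balls, in which
each ball has `b` well separated children. -/
theorem le_dimH_of_tree {E : Type*} [MetricSpace E] [CompleteSpace E] {b : ℕ} (hb : 1 < b)
    {r : ℕ → ℝ} (hr0 : ∀ i, 0 < r i) (hr : Filter.Tendsto r Filter.atTop (𝓝 0))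
    {G : ℕ → E → Prop} {c₀ : E} (h₀ : G 0 c₀)
    (hG : ∀ i c, G i c → ∃ F : Fin b → E, (∀ j, G (i + 1) (F j)) ∧
      (∀ j, dist (F j) c ≤ r i - r (i + 1)) ∧ ∀ j j', j ≠ j' → 3 * r (i + 1) ≤ dist (F j) (F j'))
    {C s : ℝ≥0} (hs : 0 < s) (hC : ∀ i, ((b : ℝ) ^ i)⁻¹ ≤ C * r (i + 1) ^ (s : ℝ)) :
    (s : ENNReal) ≤ dimH {ξ : E | ∀ i, ∃ c, G i c ∧ dist ξ c ≤ r i} := by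
  have : NeZero b := ⟨by omega⟩
  choose! F hFG hFd hFs using hG
  set IsPath : (ℕ → Fin b) → E → Prop := fun ω ξ => ∃ c : ℕ → E, c 0 = c₀ ∧
    ∀ i, G i (c i) ∧ c (i + 1) = F i (c i) (ω i) ∧ dist ξ (c i) ≤ r i with hPath
  have hexists (ω : ℕ → Fin b) : ∃ ξ, IsPath ω ξ := by
    set c : ℕ → E := fun i => Nat.rec c₀ (fun k e => F k e (ω k)) i with hc
    have hcG (i : ℕ) : G i (c i) := by
      induction i with
      | zero => exact h₀
      | succ i ih => exact hFG i (c i) ih (ω i)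
    obtain ⟨ξ, hξ⟩ := exists_limit_of_nested (c := c) hr (fun k => (hr0 k).le)
      fun k => hFd k (c k) (hcG k) (ω k)
    exact ⟨ξ, c, rfl, fun i => ⟨hcG i, rfl, hξ i⟩⟩
  have hdist (ω ω' : ℕ → Fin b) (ξ ξ' : E) (h : IsPath ω ξ) (h' : IsPath ω' ξ') :
      dist (Real.ofDigits ω) (Real.ofDigits ω') ≤ C * dist ξ ξ' ^ (s : ℝ) := by
    by_cases hω : ω = ω'
    · subst hω
      rw [dist_self]
      positivity
    obtain ⟨c, hc0, hc⟩ := h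
    obtain ⟨c', hc0', hc'⟩ := h'
    have hne : ∃ i, ω i ≠ ω' i := by
      by_contra! hcon
      exact hω (funext hcon)
    classical
    set i := Nat.find hne with hi
    have hlt (k : ℕ) (hk : k < i) : ω k = ω' k := not_not.1 (Nat.find_min hne hk)
    have hcc (k : ℕ) (hk : k ≤ i) : c k = c' k := by
      induction k with
      | zero => rw [hc0, hc0']
      | succ k ih => rw [(hc k).2.1, (hc' k).2.1, ih (by omega), hlt k (by omega)]
    have hsep := hFs i (c i) (hc i).1 (ω i) (ω' i) (Nat.find_spec hne)
    rw [← (hc i).2.1, hcc i le_rfl, ← (hc' i).2.1] at hsep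
    have hri : r (i + 1) ≤ dist ξ ξ' := by
      have h1 := dist_triangle4 (c (i + 1)) ξ ξ' (c' (i + 1))
      have h2 := (hc (i + 1)).2.2
      have h3 := (hc' (i + 1)).2.2
      rw [dist_comm] at h2
      linarith
    calc dist (Real.ofDigits ω) (Real.ofDigits ω') ≤ ((b : ℝ) ^ i)⁻¹ :=
          Real.abs_ofDigits_sub_ofDigits_le hlt
      _ ≤ C * r (i + 1) ^ (s : ℝ) := hC i
      _ ≤ C * dist ξ ξ' ^ (s : ℝ) := by
          gcongr
          exact (hr0 _).le
  set A : Set E := {ξ | ∃ ω, IsPath ω ξ} with hA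
  have hAsub : A ⊆ {ξ : E | ∀ i, ∃ c, G i c ∧ dist ξ c ≤ r i} := by
    rintro ξ ⟨ω, c, -, hc⟩ i
    exact ⟨c i, (hc i).1, (hc i).2.2⟩
  refine le_trans ?_ (dimH_mono hAsub)
  choose! ω hω using fun (ξ : E) (h : ξ ∈ A) => (h : ∃ ω, IsPath ω ξ)
  have hholder : HolderOnWith C s (fun ξ => Real.ofDigits (ω ξ)) A := by
    intro ξ hξ ξ' hξ'
    rw [edist_nndist, edist_nndist, ← ENNReal.coe_rpow_of_nonneg _ s.coe_nonneg,
      ← ENNReal.coe_mul, ENNReal.coe_le_coe, ← NNReal.coe_le_coe]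
    push_cast
    exact hdist _ _ _ _ (hω ξ hξ) (hω ξ' hξ')
  have himage : Set.Ico (0 : ℝ) 1 ⊆ (fun ξ => Real.ofDigits (ω ξ)) '' A := by
    intro x hx
    obtain ⟨ξ, hξ⟩ := hexists (x.digits b)
    have hξA : ξ ∈ A := ⟨_, hξ⟩
    refine ⟨ξ, hξA, ?_⟩
    have h1 := hdist _ _ _ _ (hω ξ hξA) hξ
    rw [dist_self, Real.zero_rpow (by positivity), mul_zero, Real.ofDigits_digits hb hx] at h1
    exact dist_le_zero.1 h1
  have h1 : (1 : ENNReal) ≤ dimH A / s := by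
    have h2 : dimH (Set.Ico (0 : ℝ) 1) = 1 := by
      rw [Real.dimH_of_mem_nhds (x := 1 / 2) (Ico_mem_nhds (by norm_num) (by norm_num))]
      simp
    rw [← h2]
    exact (dimH_mono himage).trans (hholder.dimH_image_le hs)
  rwa [ENNReal.le_div_iff_mul_le (by simp [hs.ne']) (by simp), one_mul] at h1

/-- Factors `S k` can be inserted, in order and one at a time, into a sequence so slowly that after
`i` steps their product is at most `2 ^ i`. -/
theorem exists_schedule (S : ℕ → ℝ) : ∃ k : ℕ → ℕ, k 0 = 0 ∧
    (∀ i, k (i + 1) = k i ∨ k (i + 1) = k i + 1) ∧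
    (∀ i, ∏ j ∈ Finset.range (k i), S j ≤ 2 ^ i) ∧ ∀ K, ∃ i, k i = K ∧ k (i + 1) = K + 1 := by
  classical
  set P : ℕ → ℝ := fun k => ∏ j ∈ Finset.range k, S j with hP
  set k : ℕ → ℕ := fun i =>
    Nat.rec 0 (fun i l => if P (l + 1) ≤ 2 ^ (i + 1) then l + 1 else l) i with hk
  have hsucc (i : ℕ) : k (i + 1) = if P (k i + 1) ≤ 2 ^ (i + 1) then k i + 1 else k i := rfl
  have hstep (i : ℕ) : k (i + 1) = k i ∨ k (i + 1) = k i + 1 := by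
    rw [hsucc]
    split_ifs
    · exact Or.inr rfl
    · exact Or.inl rfl
  refine ⟨k, rfl, hstep, fun i => ?_, fun K => ?_⟩
  · induction i with
    | zero => simp [k]
    | succ i ih =>
      rw [hsucc]
      split_ifs with h
      · exact h
      · exact ih.trans (pow_le_pow_right₀ (by norm_num) (by omega))
  · have hunb : ∀ K, ∃ i, K ≤ k i := by
      intro K
      induction K with
      | zero => exact ⟨0, Nat.zero_le _⟩
      | succ K ih =>
        obtain ⟨i, hi⟩ := ih
        by_contra! hcon
        have hKi (l : ℕ) : k (i + l) = K := by
          have h1 := hcon (i + l)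
          have h2 : K ≤ k (i + l) := by
            induction l with
            | zero => exact hi
            | succ l ih => rcases hstep (i + l) with h | h <;> rw [← add_assoc, h] <;>
                linarith [ih (hcon _)]
          omega
        obtain ⟨l, hl⟩ := pow_unbounded_of_one_lt (P (K + 1)) (one_lt_two (α := ℝ))
        have h3 := hKi (l + 1)
        rw [← add_assoc, hsucc, hKi l, if_pos (hl.le.trans
          (pow_le_pow_right₀ (by norm_num) (by omega)))] at h3
        omega
    have hex := hunb (K + 1)
    obtain ⟨i, hi⟩ : ∃ i, Nat.find hex = i + 1 := by
      refine Nat.exists_eq_succ_of_ne_zero fun h0 => ?_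
      have h1 := Nat.find_spec hex
      rw [h0] at h1
      simp [k] at h1
    have h1 := Nat.find_spec hex
    rw [hi] at h1
    have h2 := Nat.find_min hex (m := i) (by omega)
    refine ⟨i, ?_, ?_⟩ <;> rcases hstep i with h | h <;> omega

section Step

variable {κ τ : Type*} [Fintype κ] [Fintype τ] [DecidableEq κ] [DecidableEq τ] [Nonempty κ]
  [Nonempty τ]

theorem four_mul_le_dist_gridCenter {q : ℕ} {r : ℝ} (hr : 0 ≤ r) {t t' : τ → κ → Fin q}
    (h : t ≠ t') :
    4 * r ≤ dist (fun i => gridCenter r (t i)) (fun i => gridCenter r (t' i)) := by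
  obtain ⟨i, hi⟩ := Function.ne_iff.1 h
  obtain ⟨j, hj⟩ := Function.ne_iff.1 hi
  have h1 : (1 : ℝ) ≤ |((t i j : ℕ) : ℝ) - ((t' i j : ℕ) : ℝ)| := by
    have h2 : ((t i j : ℕ) : ℤ) - ((t' i j : ℕ) : ℤ) ≠ 0 := by
      rw [sub_ne_zero]
      exact_mod_cast fun h3 => hj (Fin.ext h3)
    exact_mod_cast Int.one_le_abs h2
  calc 4 * r ≤ 4 * r * |((t i j : ℕ) : ℝ) - ((t' i j : ℕ) : ℝ)| :=
        le_mul_of_one_le_right (by positivity) h1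
    _ = |gridCenter r (t i) j - gridCenter r (t' i) j| := by
        rw [← abs_of_nonneg (show 0 ≤ 4 * r by positivity), ← abs_mul]
        congr 1
        simp only [gridCenter]
        ring
    _ = dist (gridCenter r (t i) j) (gridCenter r (t' i) j) := (Real.dist_eq _ _).symm
    _ ≤ dist (gridCenter r (t i)) (gridCenter r (t' i)) := dist_le_pi_dist _ _ j
    _ ≤ _ := dist_le_pi_dist (fun i => gridCenter r (t i)) (fun i => gridCenter r (t' i)) i

theorem RefinesTo.exists_children {δs : ℝ} (h : RefinesTo κ τ δs) (hδs : 0 < δs) :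
    ∃ ρ₀ : ℕ, ∀ ρ : ℕ, ρ₀ ≤ ρ → Even ρ → 0 < ρ → ∀ b : ℕ,
      2 * b ≤ (ρ ^ (Fintype.card κ + Fintype.card τ) / 2) ^ (Fintype.card κ * Fintype.card τ) →
      ∀ (c : τ → κ → ℝ) (lam : ℝ), 0 < lam → Cpt 1 c lam δs →
      ∃ F : Fin b → τ → κ → ℝ, (∀ j, Cpt 1 (F j) (lam * ρ) δs) ∧
        (∀ j, ‖F j - c‖ ≤ (lam ^ (Fintype.card κ + Fintype.card τ))⁻¹ -
          ((lam * ρ) ^ (Fintype.card κ + Fintype.card τ))⁻¹) ∧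
        ∀ j j', j ≠ j' →
          3 * ((lam * ρ) ^ (Fintype.card κ + Fintype.card τ))⁻¹ ≤ dist (F j) (F j') := by
  obtain ⟨ρ₀, hρ₀⟩ := h δs hδs
  set D := Fintype.card κ + Fintype.card τ with hD
  have hD0 : D ≠ 0 := by
    have := Fintype.card_pos (α := κ)
    omega
  refine ⟨ρ₀, fun ρ hρ hev hρ1 b hb c lam hlam hc => ?_⟩
  obtain ⟨q, hq⟩ := hev.two_dvd.trans (dvd_pow_self ρ hD0)
  have hq0 : 0 < q := by
    have : 0 < ρ ^ D := pow_pos hρ1 _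
    omega
  rw [hq, Nat.mul_div_cancel_left _ two_pos] at hb
  obtain ⟨G, hG, hG'⟩ := hρ₀ ρ hρ hev 1 (by simp) c lam hlam hc q hq.symm
  obtain ⟨e⟩ : Nonempty (Fin b ↪ G) := by
    rw [Function.Embedding.nonempty_iff_card_le, Fintype.card_fin, Fintype.card_coe]
    omega
  have hρ0 : (0 : ℝ) < ρ := by exact_mod_cast hρ1
  have hpos : 0 < ((lam * ρ) ^ D)⁻¹ := by positivity
  refine ⟨fun j => c + (lam ^ D)⁻¹ • (fun i => gridCenter ((ρ : ℝ) ^ D)⁻¹ ((e j : τ → κ → Fin q) i)),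
    fun j => hG' _ (e j).2, fun j => ?_, fun j j' hj => ?_⟩
  · have := norm_gridCenter_sub_le hq.symm hq0 hlam c (e j : τ → κ → Fin q)
    linarith
  · rw [dist_add_left, dist_smul₀, Real.norm_of_nonneg (by positivity)]
    have h1 : (e j : τ → κ → Fin q) ≠ e j' := fun h2 => hj (e.injective (Subtype.ext h2))
    have h2 := four_mul_le_dist_gridCenter (r := ((ρ : ℝ) ^ D)⁻¹) (by positivity) h1
    calc 3 * ((lam * ρ) ^ D)⁻¹ ≤ 4 * ((lam * ρ) ^ D)⁻¹ := by linarith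
      _ = (lam ^ D)⁻¹ * (4 * ((ρ : ℝ) ^ D)⁻¹) := by
          rw [mul_pow, mul_inv]
          ring
      _ ≤ _ := by gcongr

theorem exists_lt_err_of_cpt (κ τ : Type*) [Fintype κ] [Fintype τ] [DecidableEq κ] [DecidableEq τ]
    [Nonempty κ] {δ : ℝ} (hδ : 0 < δ) (hδ1 : δ ≤ 1) :
    ∃ B : ℝ, 0 < B ∧ ∀ (c ξ : τ → κ → ℝ) (lam : ℝ), 1 ≤ lam → Cpt 1 c lam δ →
      ‖ξ - c‖ ≤ (lam ^ (Fintype.card κ + Fintype.card τ))⁻¹ → ∀ x y, x ≠ 0 →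
      ‖toR x‖ < δ / (Fintype.card κ + 1) * lam ^ Fintype.card τ →
      ∃ x' y', x' ≠ 0 ∧ ‖toR x'‖ ≤ B * lam ^ Fintype.card τ ∧ err ξ x' y' < err ξ x y := by
  set δ' : ℝ := δ / (Fintype.card κ + 1) with hδ'
  have hδ'0 : 0 < δ' := by positivity
  have hδ'1 : δ' ≤ 1 := (div_le_self hδ.le (by linarith [Nat.cast_nonneg (α := ℝ) (Fintype.card κ)])).trans hδ1
  have hκ : Fintype.card κ ≠ 0 := Fintype.card_ne_zero
  obtain ⟨B, hB1, hB⟩ := exists_one_le_pow_eq hκ (y := 2 * ((δ' / 2) ^ Fintype.card τ)⁻¹) (by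
    have : 1 ≤ ((δ' / 2) ^ Fintype.card τ)⁻¹ :=
      (one_le_inv₀ (by positivity)).2 (pow_le_one₀ (by positivity) (by linarith))
    linarith)
  have hB0 : 0 < B := by linarith
  refine ⟨B, hB0, fun c ξ lam hlam hc hξ x y hx hxl => ?_⟩
  have hlam0 : 0 < lam := by linarith
  have hxy : δ' * (lam ^ Fintype.card κ)⁻¹ ≤ err ξ x y := by
    rcases hc.of_near hlam0 hδ hξ (Sum.elim x (-y)) (fun h => hx (by
      ext i
      exact congrFun h (Sum.inl i))) with h | h
    · rw [gx_one] at h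
      linarith
    · rwa [norm_gy_one_add_lin] at h
  have hlam1 : (lam ^ Fintype.card κ)⁻¹ ≤ 1 := inv_le_one_of_one_le₀ (one_le_pow₀ hlam)
  have hpos : 0 < δ' * (lam ^ Fintype.card κ)⁻¹ := by positivity
  obtain ⟨x', y', hx', h1, h2⟩ := exists_small_err ξ (X := B * lam ^ Fintype.card τ)
    (L := δ' / 2 * (lam ^ Fintype.card κ)⁻¹) (by positivity) (by positivity) (by
      calc δ' / 2 * (lam ^ Fintype.card κ)⁻¹ ≤ δ' / 2 * 1 := by gcongr
        _ < 1 := by linarith) (by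
      rw [mul_pow, hB, mul_pow (δ' / 2), inv_pow, ← pow_mul, ← pow_mul,
        mul_comm (Fintype.card τ) (Fintype.card κ)]
      have h3 : ((δ' / 2) ^ Fintype.card τ)⁻¹ * (δ' / 2) ^ Fintype.card τ = 1 :=
        inv_mul_cancel₀ (by positivity)
      have h4 : lam ^ (Fintype.card κ * Fintype.card τ) *
        (lam ^ (Fintype.card κ * Fintype.card τ))⁻¹ = 1 := mul_inv_cancel₀ (by positivity)
      calc (1 : ℝ) < 2 * (((δ' / 2) ^ Fintype.card τ)⁻¹ * (δ' / 2) ^ Fintype.card τ) *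
            (lam ^ (Fintype.card κ * Fintype.card τ) *
              (lam ^ (Fintype.card κ * Fintype.card τ))⁻¹) := by
            rw [h3, h4]
            norm_num
        _ = _ := by ring)
  exact ⟨x', y', hx', h1, by linarith⟩

end Step

theorem exists_grid_size {N D : ℕ} (hD : D ≠ 0) {s : ℝ} (hs : 0 < s) (hsN : s < N) (ρ₀ : ℕ) :
    ∃ ρ b : ℕ, ρ₀ ≤ ρ ∧ Even ρ ∧ 0 < ρ ∧ 1 < b ∧ 2 * b ≤ (ρ ^ D / 2) ^ N ∧
      (((2 * ρ : ℝ)) ^ D) ^ s ≤ b := by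
  have hD0 : (0 : ℝ) < D := by exact_mod_cast Nat.pos_of_ne_zero hD
  have hN : N ≠ 0 := by
    rintro rfl
    rw [Nat.cast_zero] at hsN
    linarith
  have hlim : Filter.Tendsto (fun l : ℕ => ((l : ℝ)) ^ (D * (N - s))) Filter.atTop Filter.atTop :=
    (tendsto_rpow_atTop (mul_pos hD0 (sub_pos.2 hsN))).comp tendsto_natCast_atTop_atTop
  obtain ⟨l, hl, hlρ⟩ := ((hlim.eventually_ge_atTop ((2 : ℝ) ^ (D * s) * 2 ^ (N + 2))).and
    (Filter.eventually_ge_atTop (ρ₀ + 2))).exists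
  set ρ : ℕ := 2 * l with hρ
  have hρl : (l : ℝ) ≤ ρ := by exact_mod_cast (by omega : l ≤ ρ)
  have hρ0 : (0 : ℝ) < ρ := by exact_mod_cast (by omega : 0 < ρ)
  obtain ⟨q, hq⟩ := (even_two_mul l).two_dvd.trans (dvd_pow_self ρ hD)
  have hqd : ρ ^ D / 2 = q := by omega
  have hqN : 2 ≤ q ^ N := by
    have h1 : 2 ≤ q := by
      have := Nat.le_self_pow hD ρ
      omega
    exact h1.trans (Nat.le_self_pow hN q)
  have hb : (((2 * ρ : ℝ)) ^ D) ^ s ≤ ((q ^ N / 2 : ℕ) : ℝ) := by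
    have h1 : (q : ℝ) ^ N ≤ 4 * ((q ^ N / 2 : ℕ) : ℝ) := by
      exact_mod_cast (by omega : q ^ N ≤ 4 * (q ^ N / 2))
    have h2 : (2 : ℝ) ^ N * q ^ N = (ρ : ℝ) ^ (D * N : ℝ) := by
      rw [← mul_pow, Real.rpow_mul hρ0.le, Real.rpow_natCast, Real.rpow_natCast]
      congr 1
      exact_mod_cast hq.symm
    have h3 : (2 : ℝ) ^ (D * s) * 2 ^ (N + 2) ≤ (ρ : ℝ) ^ (D * (N - s)) :=
      hl.trans (by gcongr)
    have h4 : (ρ : ℝ) ^ (D * N : ℝ) = (ρ : ℝ) ^ (D * (N - s)) * (ρ : ℝ) ^ (D * s) := by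
      rw [← Real.rpow_add hρ0]
      congr 1
      ring
    have h5 : (((2 * ρ : ℝ)) ^ D) ^ s = 2 ^ (D * s) * (ρ : ℝ) ^ (D * s) := by
      rw [← Real.rpow_natCast, ← Real.rpow_mul (by positivity),
        Real.mul_rpow (by norm_num) hρ0.le]
    have h6 : (2 : ℝ) ^ (N + 2) * ((2 * ρ : ℝ) ^ D) ^ s ≤
        2 ^ (N + 2) * ((q ^ N / 2 : ℕ) : ℝ) := by
      calc (2 : ℝ) ^ (N + 2) * ((2 * ρ : ℝ) ^ D) ^ s
          = 2 ^ (D * s) * 2 ^ (N + 2) * (ρ : ℝ) ^ (D * s) := by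
            rw [h5]
            ring
        _ ≤ (ρ : ℝ) ^ (D * (N - s)) * (ρ : ℝ) ^ (D * s) := by gcongr
        _ = 2 ^ N * q ^ N := by rw [h2, h4]
        _ ≤ 2 ^ N * (4 * ((q ^ N / 2 : ℕ) : ℝ)) := by gcongr
        _ = _ := by ring
    exact le_of_mul_le_mul_left h6 (by positivity)
  refine ⟨ρ, q ^ N / 2, by omega, even_two_mul l, by omega, ?_, ?_, hb⟩
  · have h1 : (1 : ℝ) < ((2 * ρ : ℝ) ^ D) ^ s := by
      refine Real.one_lt_rpow (one_lt_pow₀ ?_ hD) hs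
      have : (2 : ℝ) ≤ l := by exact_mod_cast (by omega : 2 ≤ l)
      linarith
    exact_mod_cast h1.trans_le hb
  · rw [hqd]
    omega

/-- One level of the construction: a ball has many well separated sub-balls at scale
`lam * T * ρ`, where `T` is either `1` or a large factor which forces a good approximation. -/
theorem exists_level (κ τ : Type*) [Fintype κ] [Fintype τ] [DecidableEq κ] [DecidableEq τ]
    [Nonempty κ] [Nonempty τ] (hsf : HasSteadyForms κ τ) :
    ∃ (δs c₀ f : ℝ) (ρ₀ : ℕ) (S : ℕ → ℝ), c₀ ≤ 1 ∧ 0 < c₀ ∧ 0 < f ∧ (∀ k, 1 ≤ S k) ∧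
      Cpt (κ := κ) (τ := τ) 1 0 1 δs ∧
      ∀ ρ : ℕ, ρ₀ ≤ ρ → Even ρ → 0 < ρ → ∃ M : ℝ, ∀ b : ℕ,
      2 * b ≤ (ρ ^ (Fintype.card κ + Fintype.card τ) / 2) ^ (Fintype.card κ * Fintype.card τ) →
      ∀ (p : Prop) (k : ℕ) (T : ℝ), (¬ p ∧ T = 1) ∨ T = S k →
      ∀ (c : τ → κ → ℝ) (lam : ℝ), 1 ≤ lam → Cpt 1 c lam δs →
      ∃ F : Fin b → τ → κ → ℝ,
        (∀ j, Cpt 1 (F j) (lam * T * ρ) δs) ∧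
        (∀ j, dist (F j) c ≤ (lam ^ (Fintype.card κ + Fintype.card τ))⁻¹ -
          ((lam * T * ρ) ^ (Fintype.card κ + Fintype.card τ))⁻¹) ∧
        (∀ j j', j ≠ j' →
          3 * ((lam * T * ρ) ^ (Fintype.card κ + Fintype.card τ))⁻¹ ≤ dist (F j) (F j')) ∧
        ∀ j ξ, dist ξ (F j) ≤ ((lam * T * ρ) ^ (Fintype.card κ + Fintype.card τ))⁻¹ →
          (∀ x y, x ≠ 0 → c₀ * lam ^ Fintype.card τ ≤ ‖toR x‖ →
            ‖toR x‖ < c₀ * (lam * T * ρ) ^ Fintype.card τ →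
            ∃ x' y', x' ≠ 0 ∧ ‖toR x'‖ ≤ M * ‖toR x‖ ∧ err ξ x' y' < err ξ x y) ∧
          (p → ∃ x₀ y₀, f * lam ^ Fintype.card τ ≤ ‖toR x₀‖ ∧
            ∀ x y, x ≠ 0 → ‖toR x‖ < ‖toR x₀‖ → err ξ x₀ y₀ ≤ 1 / (k + 2) * err ξ x y) := by
  obtain ⟨δs, hδs, hδs1, href⟩ := exists_refinesTo κ τ
  have hκ : (0 : ℝ) ≤ Fintype.card κ := Nat.cast_nonneg _
  set c₀ : ℝ := δs / (Fintype.card κ + 1) with hc₀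
  have hc₀0 : 0 < c₀ := by positivity
  have hc₀1 : c₀ ≤ 1 := (div_le_self hδs.le (by linarith)).trans hδs1
  obtain ⟨M, θ, f, hM, hθ, hf, hexc⟩ := exists_excursion_at κ τ hsf hδs hc₀0 href
  obtain ⟨B, hB, hdir⟩ := exists_lt_err_of_cpt κ τ hδs hδs1
  obtain ⟨ρ₀, hρ₀⟩ := href.exists_children hδs
  have hεk (k : ℕ) : (0 : ℝ) < 1 / (k + 2) ∧ (1 : ℝ) / (k + 2) < 1 := by
    have : (0 : ℝ) ≤ k := Nat.cast_nonneg k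
    exact ⟨by positivity, by rw [div_lt_one (by positivity)]; linarith⟩
  choose S hS1 hS using fun k : ℕ => hexc (1 / (k + 2)) (hεk k).1 (hεk k).2
  refine ⟨δs, c₀, f, ρ₀, S, hc₀1, hc₀0, hf, hS1, cpt_zero_one fun v hv => ?_,
    fun ρ hρ hev hρ1 => ?_⟩
  · rw [Matrix.one_mulVec]
    exact hδs1.trans (one_le_norm_toR hv)
  set θ' : ℝ := min θ c₀ with hθ'
  have hθ'0 : 0 < θ' := lt_min hθ hc₀0
  have hρ0 : (0 : ℝ) < ρ := by exact_mod_cast hρ1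
  have hρ1' : (1 : ℝ) ≤ ρ := by exact_mod_cast hρ1
  set D := Fintype.card κ + Fintype.card τ with hD
  refine ⟨max M (B * ρ ^ Fintype.card τ / θ'), fun b hb p k T hT c lam hlam hc => ?_⟩
  have hlam0 : 0 < lam := by linarith
  have hT1 : 1 ≤ T := by
    rcases hT with ⟨-, rfl⟩ | rfl
    · exact le_rfl
    · exact hS1 k
  have hT0 : 0 < T := by linarith
  obtain ⟨e, he, hec, hξ⟩ : ∃ e : τ → κ → ℝ, Cpt 1 e (lam * T) δs ∧
      ‖e - c‖ ≤ (lam ^ D)⁻¹ - ((lam * T) ^ D)⁻¹ ∧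
      ∀ ξ : τ → κ → ℝ, ‖ξ - e‖ ≤ ((lam * T) ^ D)⁻¹ →
        (∀ x y, x ≠ 0 → c₀ * lam ^ Fintype.card τ ≤ ‖toR x‖ →
          ‖toR x‖ < θ' * (lam * T) ^ Fintype.card τ →
          ∃ x' y', x' ≠ 0 ∧ ‖toR x'‖ ≤ M * ‖toR x‖ ∧ err ξ x' y' < err ξ x y) ∧
        (p → ∃ x₀ y₀, f * lam ^ Fintype.card τ ≤ ‖toR x₀‖ ∧
          ∀ x y, x ≠ 0 → ‖toR x‖ < ‖toR x₀‖ → err ξ x₀ y₀ ≤ 1 / (k + 2) * err ξ x y) := by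
    rcases hT with ⟨hp, rfl⟩ | rfl
    · refine ⟨c, by rwa [mul_one], by simp, fun ξ _ => ⟨fun x y _ h1 h2 => ?_, fun h => (hp h).elim⟩⟩
      rw [mul_one] at h2
      have : θ' * lam ^ Fintype.card τ ≤ c₀ * lam ^ Fintype.card τ := by
        gcongr
        exact min_le_right _ _
      linarith
    · obtain ⟨e, he, hec, hξ⟩ := hS k c lam hlam0 hc
      refine ⟨e, he, hec, fun ξ h => ⟨fun x y hx h1 h2 => (hξ ξ h).1 x y hx h1 (h2.trans_le ?_),
        fun _ => (hξ ξ h).2⟩⟩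
      gcongr
      exact min_le_left _ _
  obtain ⟨F, hF, hFd, hFs⟩ := hρ₀ ρ hρ hev hρ1 b hb e (lam * T) (by positivity) he
  refine ⟨F, hF, fun j => ?_, hFs, fun j ξ hξF => ?_⟩
  · have h1 := dist_triangle (F j) e c
    rw [dist_eq_norm (F j) e, dist_eq_norm e c] at h1
    linarith [hFd j]
  have hξe : ‖ξ - e‖ ≤ ((lam * T) ^ D)⁻¹ := by
    have h1 := dist_triangle ξ (F j) e
    rw [dist_eq_norm (F j) e, dist_eq_norm ξ e] at h1
    linarith [hFd j]
  refine ⟨fun x y hx h1 h2 => ?_, (hξ ξ hξe).2⟩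
  by_cases h3 : ‖toR x‖ < θ' * (lam * T) ^ Fintype.card τ
  · obtain ⟨x', y', h4, h5, h6⟩ := (hξ ξ hξe).1 x y hx h1 h3
    exact ⟨x', y', h4, h5.trans (by gcongr; exact le_max_left _ _), h6⟩
  · push Not at h3
    have hmul : 1 ≤ lam * T * ρ :=
      one_le_mul_of_one_le_of_one_le (one_le_mul_of_one_le_of_one_le hlam hT1) hρ1'
    obtain ⟨x', y', h4, h5, h6⟩ := hdir (F j) ξ (lam * T * ρ) hmul (hF j)
      (by rwa [← dist_eq_norm]) x y hx h2
    refine ⟨x', y', h4, h5.trans ?_, h6⟩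
    calc B * (lam * T * ρ) ^ Fintype.card τ
        = B * ρ ^ Fintype.card τ / θ' * (θ' * (lam * T) ^ Fintype.card τ) := by
          rw [mul_pow _ (ρ : ℝ)]
          field_simp
      _ ≤ B * ρ ^ Fintype.card τ / θ' * ‖toR x‖ := by gcongr
      _ ≤ _ := by
          gcongr
          exact le_max_right _ _

theorem le_dimH_boundedGaps (κ τ : Type*) [Fintype κ] [Fintype τ] [DecidableEq κ] [DecidableEq τ]
    [Nonempty κ] [Nonempty τ] (hsf : HasSteadyForms κ τ) {s : ℝ≥0} (hs : 0 < s)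
    (hsN : (s : ℝ) < (Fintype.card κ * Fintype.card τ : ℕ)) :
    (s : ENNReal) ≤ dimH {ξ : τ → κ → ℝ | BoundedGaps ξ ∧ UnboundedDrops ξ} := by
  obtain ⟨δs, c₀, f, ρ₀, S, hc₀1, hc₀, hf, hS1, hcpt, hlevel⟩ := exists_level κ τ hsf
  set D := Fintype.card κ + Fintype.card τ with hD
  have hτ : Fintype.card τ ≠ 0 := Fintype.card_ne_zero
  have hD0 : D ≠ 0 := by omega
  obtain ⟨ρ, b, hρ, hev, hρ1, hb1, hb, hbs⟩ := exists_grid_size hD0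
    (by exact_mod_cast hs : (0 : ℝ) < s) hsN ρ₀
  obtain ⟨M, hM⟩ := hlevel ρ hρ hev hρ1
  obtain ⟨k, hk0, hkstep, hkP, hkK⟩ := exists_schedule S
  have hρ2 : (2 : ℝ) ≤ ρ := by
    obtain ⟨l, hl⟩ := hev
    exact_mod_cast (by omega : 2 ≤ ρ)
  set P : ℕ → ℝ := fun k => ∏ j ∈ Finset.range k, S j with hP
  have hP1 (k : ℕ) : 1 ≤ P k := by
    refine Finset.prod_induction _ (fun x => (1 : ℝ) ≤ x) (fun _ _ => one_le_mul_of_one_le_of_one_le)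
      le_rfl fun j _ => hS1 j
  set lam : ℕ → ℝ := fun i => P (k i) * ρ ^ i with hlam
  have hlamρ (i : ℕ) : (ρ : ℝ) ^ i ≤ lam i := le_mul_of_one_le_left (by positivity) (hP1 _)
  have hlam2 (i : ℕ) : (2 : ℝ) ^ i ≤ lam i := le_trans (by gcongr) (hlamρ i)
  have hlam1 (i : ℕ) : 1 ≤ lam i := (one_le_pow₀ one_le_two).trans (hlam2 i)
  have hlam0 (i : ℕ) : 0 < lam i := zero_lt_one.trans_le (hlam1 i)
  have hlamle (i : ℕ) : lam i ≤ (2 * ρ) ^ i := by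
    rw [mul_pow]
    exact mul_le_mul_of_nonneg_right (hkP i) (by positivity)
  have hlamtop : Filter.Tendsto lam Filter.atTop Filter.atTop :=
    Filter.tendsto_atTop_mono hlam2 (tendsto_pow_atTop_atTop_of_one_lt one_lt_two)
  set r : ℕ → ℝ := fun i => (lam i ^ D)⁻¹ with hr
  set Q : ℕ → (τ → κ → ℝ) → Prop := fun i ξ =>
    (∀ x y, x ≠ 0 → c₀ * lam i ^ Fintype.card τ ≤ ‖toR x‖ →
      ‖toR x‖ < c₀ * lam (i + 1) ^ Fintype.card τ →
      ∃ x' y', x' ≠ 0 ∧ ‖toR x'‖ ≤ M * ‖toR x‖ ∧ err ξ x' y' < err ξ x y) ∧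
    (k (i + 1) = k i + 1 → ∃ x₀ y₀, f * lam i ^ Fintype.card τ ≤ ‖toR x₀‖ ∧
      ∀ x y, x ≠ 0 → ‖toR x‖ < ‖toR x₀‖ → err ξ x₀ y₀ ≤ 1 / (k i + 2) * err ξ x y) with hQ
  set G : ℕ → (τ → κ → ℝ) → Prop := fun i c => Cpt 1 c (lam i) δs ∧
    ∀ j, i = j + 1 → ∀ ξ, dist ξ c ≤ r i → Q j ξ with hG
  have htree := le_dimH_of_tree hb1 (r := r) (G := G) (c₀ := 0) (C := ((2 * ρ : ℝ≥0) ^ D) ^ (s : ℝ))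
    (fun i => by have := hlam0 i; positivity)
    (((Filter.tendsto_pow_atTop hD0).comp hlamtop).inv_tendsto_atTop)
    ⟨by simpa [lam, hk0, P] using hcpt, fun j hj => by omega⟩ (fun i c hc => by
      obtain ⟨T, hT, hlamT⟩ : ∃ T, ((¬ (k (i + 1) = k i + 1) ∧ T = 1) ∨ T = S (k i)) ∧
          lam (i + 1) = lam i * T * ρ := by
        by_cases h : k (i + 1) = k i + 1
        · refine ⟨S (k i), Or.inr rfl, ?_⟩
          simp only [lam, P]
          rw [h, Finset.prod_range_succ, pow_succ]
          ring
        · refine ⟨1, Or.inl ⟨h, rfl⟩, ?_⟩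
          simp only [lam]
          rw [(hkstep i).resolve_right h, pow_succ]
          ring
      obtain ⟨F, hF, hFd, hFs, hFξ⟩ := hM b hb _ (k i) T hT c (lam i) (hlam1 i) hc.1
      rw [← hlamT] at hF hFd hFs hFξ
      refine ⟨F, fun j => ⟨hF j, fun i' hi' ξ hξ => ?_⟩, hFd, hFs⟩
      obtain rfl : i = i' := by omega
      exact hFξ j ξ hξ) hs (fun i => by
      have h1 : r (i + 1) ^ (s : ℝ) = ((lam (i + 1) ^ D) ^ (s : ℝ))⁻¹ :=
        Real.inv_rpow (by have := hlam0 (i + 1); positivity) _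
      have h2 : (lam (i + 1) ^ D) ^ (s : ℝ) ≤ b ^ i * (((2 * ρ : ℝ)) ^ D) ^ (s : ℝ) := by
        calc (lam (i + 1) ^ D) ^ (s : ℝ) ≤ (((2 * ρ : ℝ) ^ (i + 1)) ^ D) ^ (s : ℝ) := by
              have := hlam0 (i + 1)
              gcongr
              exact hlamle _
          _ = ((((2 * ρ : ℝ)) ^ D) ^ (s : ℝ)) ^ (i + 1) := by
              rw [Real.rpow_pow_comm (by positivity), pow_right_comm (2 * (ρ : ℝ))]
          _ ≤ _ := by
              rw [pow_succ]
              gcongr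
      have h3 : 0 < (lam (i + 1) ^ D) ^ (s : ℝ) := by
        have := hlam0 (i + 1)
        positivity
      have hb0 : (0 : ℝ) < (b : ℝ) ^ i := by positivity
      push_cast
      rw [h1, ← div_eq_mul_inv, le_div_iff₀ h3, inv_mul_le_iff₀ hb0]
      exact h2)
  refine htree.trans (dimH_mono fun ξ hξ => ?_)
  have hQξ (i : ℕ) : Q i ξ := by
    obtain ⟨c, hc, hd⟩ := hξ (i + 1)
    exact hc.2 i rfl ξ hd
  refine ⟨⟨M, fun x y hx => ?_⟩, fun A => ?_⟩
  · have hex : ∃ i, ‖toR x‖ < c₀ * lam i ^ Fintype.card τ :=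
      ((((Filter.tendsto_pow_atTop hτ).comp hlamtop).const_mul_atTop hc₀).eventually_gt_atTop
        _).exists
    classical
    obtain ⟨i, hi⟩ : ∃ i, Nat.find hex = i + 1 := by
      refine Nat.exists_eq_succ_of_ne_zero fun h0 => ?_
      have h1 := Nat.find_spec hex
      rw [h0] at h1
      have h2 : lam 0 = 1 := by simp [lam, hk0, P]
      rw [h2, one_pow, mul_one] at h1
      linarith [one_le_norm_toR hx]
    have h1 := Nat.find_spec hex
    rw [hi] at h1
    exact (hQξ i).1 x y hx (not_lt.1 (Nat.find_min hex (m := i) (by omega))) h1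
  · obtain ⟨K, hK⟩ := ((((tendsto_pow_atTop_atTop_of_one_lt (one_lt_two (α := ℝ))).const_mul_atTop
      hf).eventually_gt_atTop 1).and
        (tendsto_natCast_atTop_atTop.eventually_ge_atTop A)).exists
    obtain ⟨i, hi, hi'⟩ := hkK K
    obtain ⟨x₀, y₀, hx₀, h⟩ := (hQξ i).2 (by omega)
    have hKi : K ≤ i := by
      rw [← hi]
      clear hi hi' hx₀ h
      induction i with
      | zero => omega
      | succ i ih => rcases hkstep i with h | h <;> omega
    refine ⟨x₀, y₀, ?_, fun x y hx hlt => ?_⟩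
    · calc (1 : ℝ) < f * 2 ^ K := hK.1
        _ ≤ f * lam i := by
            gcongr
            exact (pow_le_pow_right₀ one_le_two hKi).trans (hlam2 i)
        _ ≤ f * lam i ^ Fintype.card τ := by
            gcongr
            exact le_self_pow₀ (hlam1 i) hτ
        _ ≤ _ := hx₀
    · have h1 := h x y hx hlt
      rw [hi, one_div, ← div_eq_inv_mul, le_div_iff₀ (by positivity)] at h1
      have h2 := err_nonneg ξ x₀ y₀
      calc A * err ξ x₀ y₀ ≤ (K + 2) * err ξ x₀ y₀ := by
            gcongr
            linarith [hK.2]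
        _ ≤ _ := by linarith

end Tree

/-- For `m ≥ 2, n ≥ 1`, the set of totally irrational `ξ ∈ ℝ^{n×m}`
satisfying (B) but neither (A) nor (C) is nonempty of full Hausdorff dimension `mn`. -/
theorem stmt_6 (m n : ℕ) (hm : 2 ≤ m) (hn : 1 ≤ n) :
    ({A : Fin n → Fin m → ℝ | TotallyIrrational (Matrix.of A) ∧
        (∃ (x : ℕ → Fin m → ℤ) (y : ℕ → Fin n → ℤ),
          IsBestApproxSeq (Matrix.of A) x y ∧ PropB x ∧ ¬ PropC (Matrix.of A) x y) ∧
        ¬ PropA (Matrix.of A)} : Set (Fin n → Fin m → ℝ)).Nonempty ∧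
    dimH ({A : Fin n → Fin m → ℝ | TotallyIrrational (Matrix.of A) ∧
        (∃ (x : ℕ → Fin m → ℤ) (y : ℕ → Fin n → ℤ),
          IsBestApproxSeq (Matrix.of A) x y ∧ PropB x ∧ ¬ PropC (Matrix.of A) x y) ∧
        ¬ PropA (Matrix.of A)} : Set (Fin n → Fin m → ℝ)) = ((m * n : ℕ) : ENNReal) := by
  set A : Set (Fin n → Fin m → ℝ) := {A | TotallyIrrational (Matrix.of A) ∧
    (∃ (x : ℕ → Fin m → ℤ) (y : ℕ → Fin n → ℤ),
      IsBestApproxSeq (Matrix.of A) x y ∧ PropB x ∧ ¬ PropC (Matrix.of A) x y) ∧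
    ¬ PropA (Matrix.of A)} with hA
  have : Nonempty (Fin m) := ⟨⟨0, by omega⟩⟩
  have : Nonempty (Fin n) := ⟨⟨0, by omega⟩⟩
  have hsub : {ξ : Fin n → Fin m → ℝ | BoundedGaps ξ ∧ UnboundedDrops ξ} ⊆ A := by
    rintro ξ ⟨hgap, hdrop⟩
    have hT := totallyIrrational_of_boundedGaps hgap
    obtain ⟨x, y, hxy, hB⟩ := exists_bestApproxSeq (by omega) hgap
    exact ⟨hT, ⟨x, y, hxy, hB, not_propC_of_unboundedDrops hT hdrop hxy⟩,
      not_propA_of_unboundedDrops (by omega) hn hT hdrop⟩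
  have hdim : dimH A = ((m * n : ℕ) : ENNReal) := by
    refine le_antisymm ?_ ?_
    · refine (dimH_mono (Set.subset_univ A)).trans (le_of_eq ?_)
      rw [Real.dimH_univ_eq_finrank, Module.finrank_pi_fintype]
      simp [mul_comm]
    · refine ENNReal.le_of_forall_nnreal_lt fun s hs => ?_
      rcases eq_or_ne s 0 with rfl | hs0
      · simp
      · refine (le_dimH_boundedGaps (Fin m) (Fin n) (hasSteadyForms (by simpa) n)
          (pos_iff_ne_zero.2 hs0) ?_).trans (dimH_mono hsub)
        rw [Fintype.card_fin, Fintype.card_fin]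
        exact_mod_cast hs
  refine ⟨Set.nonempty_iff_ne_empty.2 fun h => ?_, hdim⟩
  rw [h, dimH_empty] at hdim
  have h1 : m * n = 0 := by exact_mod_cast hdim.symm
  have h2 : 0 < m * n := Nat.mul_pos (by omega) (by omega)
  omega
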